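/- arXiv:2005.08933 — 7 statements merged into one kernel-verified Lean document; each statement's English description precedes it below -/
import Mathlib

section
/- For every k ∈ ℤ³ \ {0} and every real γ > 131/208 there exists a constant C > 0 such that for all real R ≥ 1 and all s ∈ ℤ, the number of lattice points p ∈ ℤ³ with |p| > R ≥ |p − k| and p · k = s is at most C(|s| + R^γ). -/
open scoped BigOperators

/-- Euclidean norm of a lattice point in `ℤ³`. -/
noncomputable def latNorm (p : Fin 3 → ℤ) : ℝ := Real.sqrt (∑ i, ((p i : ℝ)) ^ 2)

lemma sv_mult_count (a b d : ℕ) (hab : a ≤ b) (hd : 0 < d) :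
    |(((Finset.Ioc a b).filter (fun n => d ∣ n)).card : ℝ) - ((b:ℝ) - a) / d| ≤ 1 := by
  have h := Nat.Ioc_filter_dvd_card_eq_div b d
  have h' := Nat.Ioc_filter_dvd_card_eq_div a d
  have hu : (Finset.Ioc 0 b).filter (fun n => d ∣ n) =
      (Finset.Ioc 0 a).filter (fun n => d ∣ n) ∪ (Finset.Ioc a b).filter (fun n => d ∣ n) := by
    ext n; simp only [Finset.mem_filter, Finset.mem_union, Finset.mem_Ioc]
    constructor
    · rintro ⟨⟨h1, h2⟩, h3⟩
      by_cases hn : n ≤ a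
      · left; exact ⟨⟨h1, hn⟩, h3⟩
      · right; exact ⟨⟨by omega, h2⟩, h3⟩
    · rintro (⟨⟨h1, h2⟩, h3⟩ | ⟨⟨h1, h2⟩, h3⟩)
      · exact ⟨⟨h1, by omega⟩, h3⟩
      · exact ⟨⟨by omega, h2⟩, h3⟩
  have hdj : Disjoint ((Finset.Ioc 0 a).filter (fun n => d ∣ n)) ((Finset.Ioc a b).filter (fun n => d ∣ n)) := by
    rw [Finset.disjoint_left]
    intro n; simp only [Finset.mem_filter, Finset.mem_Ioc]; omega
  rw [hu, Finset.card_union_of_disjoint hdj, h'] at h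
  have hR : (((Finset.Ioc a b).filter (fun n => d ∣ n)).card : ℝ) = ((b / d : ℕ) : ℝ) - ((a / d : ℕ) : ℝ) := by
    rw [← h]; push_cast; ring
  rw [hR]
  have hd' : (0:ℝ) < d := by exact_mod_cast hd
  have e1 : ((b / d : ℕ) : ℝ) ≤ b / d := Nat.cast_div_le
  have e2 : ((a / d : ℕ) : ℝ) ≤ a / d := Nat.cast_div_le
  have e3 : (b : ℝ) / d < ((b / d : ℕ) : ℝ) + 1 := by
    rw [div_lt_iff₀ hd']
    have := Nat.lt_div_mul_add (a := b) hd
    have h2 : b < (b / d + 1) * d := by rw [add_mul, one_mul]; exact this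
    exact_mod_cast h2
  have e4 : (a : ℝ) / d < ((a / d : ℕ) : ℝ) + 1 := by
    rw [div_lt_iff₀ hd']
    have := Nat.lt_div_mul_add (a := a) hd
    have h2 : a < (a / d + 1) * d := by rw [add_mul, one_mul]; exact this
    exact_mod_cast h2
  rw [abs_le, sub_div]; constructor <;> linarith

lemma sv_moebius_sum (l m : ℕ) (hm : m ≠ 0) (hlm : l ∣ m) :
    ∑ d ∈ m.divisors.filter (fun d => l ∣ d), (ArithmeticFunction.moebius (m / d) : ℝ)
      = if l = m then 1 else 0 := by
  obtain ⟨t, rfl⟩ := hlm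
  have hl : l ≠ 0 := left_ne_zero_of_mul hm
  have ht : t ≠ 0 := right_ne_zero_of_mul hm
  have : (l * t).divisors.filter (fun d => l ∣ d) = t.divisors.image (fun e => l * e) := by
    ext d; simp only [Finset.mem_filter, Finset.mem_image, Nat.mem_divisors]
    constructor
    · rintro ⟨⟨h1, _⟩, e, rfl⟩
      exact ⟨e, ⟨Nat.dvd_of_mul_dvd_mul_left (Nat.pos_of_ne_zero hl) h1, ht⟩, rfl⟩
    · rintro ⟨e, ⟨h1, _⟩, rfl⟩
      exact ⟨⟨Nat.mul_dvd_mul_left _ h1, hm⟩, dvd_mul_right _ _⟩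
  rw [this, Finset.sum_image (fun x _ y _ h => Nat.eq_of_mul_eq_mul_left (Nat.pos_of_ne_zero hl) h)]
  have h2 : ∀ e ∈ t.divisors, (ArithmeticFunction.moebius (l * t / (l * e)) : ℝ) =
      (fun k => (ArithmeticFunction.moebius k : ℝ)) (t / e) := by
    intro e _
    simp only [Nat.mul_div_mul_left _ _ (Nat.pos_of_ne_zero hl)]
  rw [Finset.sum_congr rfl h2, Nat.sum_div_divisors t (fun k => (ArithmeticFunction.moebius k : ℝ))]
  have h3 := ArithmeticFunction.coe_mul_zeta_apply (f := ArithmeticFunction.moebius) (x := t)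
  rw [ArithmeticFunction.moebius_mul_coe_zeta, ArithmeticFunction.one_apply] at h3
  have h4 : (∑ k ∈ t.divisors, (ArithmeticFunction.moebius k : ℝ)) = ((if t = 1 then 1 else 0 : ℤ) : ℝ) := by
    rw [h3]; push_cast; rfl
  rw [h4]
  have : l = l * t ↔ t = 1 := by
    constructor
    · intro h; exact Nat.eq_of_mul_eq_mul_left (Nat.pos_of_ne_zero hl) (by omega)
    · rintro rfl; simp
  simp [this]

/-- squarefree numbers below w -/
noncomputable def svS (w : ℕ) : Finset ℕ := (Finset.range w).filter Squarefree

lemma svS_mem {w d : ℕ} : d ∈ svS w ↔ d < w ∧ Squarefree d := by simp [svS]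

lemma svS_pos {w d : ℕ} (h : d ∈ svS w) : 0 < d :=
  Nat.pos_of_ne_zero (svS_mem.1 h).2.ne_zero

noncomputable def svG (w : ℕ) : ℝ := ∑ l ∈ svS w, 1 / (Nat.totient l : ℝ)

lemma svG_log (w : ℕ) (hw : 2 ≤ w) : Real.log w / 2 ≤ svG w := by
  have h1 : ∑ l ∈ svS w, 1 / (l : ℝ) ≤ svG w := by
    apply Finset.sum_le_sum
    intro l hl
    have := Nat.totient_pos.2 (svS_pos hl)
    apply one_div_le_one_div_of_le (by exact_mod_cast this)
    exact_mod_cast Nat.totient_le l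
  have h2 : Real.log w ≤ ∑ n ∈ Finset.Icc 1 (w - 1), 1 / (n : ℝ) := by
    have := log_add_one_le_harmonic (w - 1)
    rw [harmonic_eq_sum_Icc] at this
    push_cast at this
    have e : ((w - 1 : ℕ) : ℝ) + 1 = w := by rw [Nat.cast_sub (by omega)]; simp
    rw [e] at this
    simpa [one_div] using this
  have h3 : ∑ n ∈ Finset.Icc 1 (w - 1), 1 / (n : ℝ) ≤
      ∑ x ∈ svS w ×ˢ Finset.Icc 1 w, 1 / (x.1 : ℝ) * (1 / (x.2 : ℝ) ^ 2) := by
    have hch : ∀ n : ℕ, ∃ x : ℕ × ℕ, x.2 ^ 2 * x.1 = n ∧ Squarefree x.1 := by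
      intro n
      obtain ⟨a, b, h, hs⟩ := Nat.sq_mul_squarefree n
      exact ⟨(a, b), h, hs⟩
    choose f hf hs using hch
    have hinj : Set.InjOn f (Finset.Icc 1 (w - 1) : Finset ℕ) := by
      intro x _ y _ hxy
      rw [← hf x, ← hf y, hxy]
    rw [show ∑ n ∈ Finset.Icc 1 (w - 1), 1 / (n : ℝ) =
      ∑ x ∈ (Finset.Icc 1 (w-1)).image f, 1 / (x.1 : ℝ) * (1 / (x.2 : ℝ) ^ 2) by
        rw [Finset.sum_image hinj]
        apply Finset.sum_congr rfl
        intro n _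
        have hc : (n : ℝ) = ((f n).1 : ℝ) * ((f n).2 : ℝ) ^ 2 := by
          have := (hf n).symm
          rw [mul_comm] at this
          exact_mod_cast this
        rw [one_div_mul_one_div, ← hc]]
    apply Finset.sum_le_sum_of_subset_of_nonneg
    · intro x hx
      rw [Finset.mem_image] at hx
      obtain ⟨n, hn, rfl⟩ := hx
      rw [Finset.mem_Icc] at hn
      have h := hf n
      have p2 : 0 < (f n).2 := by
        rcases Nat.eq_zero_or_pos (f n).2 with h0 | h0
        · rw [h0] at h; simp at h; omega
        · exact h0
      have p1 : 0 < (f n).1 := Nat.pos_of_ne_zero (hs n).ne_zero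
      rw [Finset.mem_product, svS_mem, Finset.mem_Icc]
      refine ⟨⟨?_, hs n⟩, p2, ?_⟩
      · have : (f n).1 ≤ n := by conv_rhs => rw [← h]
                                 exact Nat.le_mul_of_pos_left _ (by positivity)
        omega
      · have : (f n).2 ≤ n := by
          conv_rhs => rw [← h]
          nlinarith [Nat.mul_le_mul p1 p2]
        omega
    · intros; positivity
  rw [Finset.sum_product, ] at h3
  have h4 : ∑ k ∈ Finset.Icc 1 w, (1 / (k:ℝ) ^ 2) ≤ 2 := by
    have := sum_Ioo_inv_sq_le (α := ℝ) 0 (w+1)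
    simp at this
    have e : Finset.Icc 1 w = Finset.Ioo 0 (w+1) := by ext; simp; omega
    rw [e]; simpa using this
  have h5 : ∑ x ∈ svS w, ∑ y ∈ Finset.Icc 1 w, 1 / (x : ℝ) * (1 / (y : ℝ) ^ 2) ≤ ∑ x ∈ svS w, 1 / (x:ℝ) * 2 := by
    apply Finset.sum_le_sum
    intro x _
    rw [← Finset.mul_sum]
    exact mul_le_mul_of_nonneg_left h4 (by positivity)
  rw [← Finset.sum_mul] at h5
  linarith

noncomputable def svY (w l : ℕ) : ℝ := (ArithmeticFunction.moebius l : ℝ) / (Nat.totient l * svG w)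

noncomputable def svL (w d : ℕ) : ℝ :=
  d * ∑ m ∈ (svS w).filter (fun m => d ∣ m), (ArithmeticFunction.moebius (m / d) : ℝ) * svY w m

lemma svG_pos (w : ℕ) (hw : 2 ≤ w) : 0 < svG w := by
  have := svG_log w hw
  have h : 0 < Real.log w := Real.log_pos (by exact_mod_cast hw)
  linarith

lemma sv_mu_sq {l : ℕ} (hl : Squarefree l) : (ArithmeticFunction.moebius l : ℝ) * ArithmeticFunction.moebius l = 1 := by
  have := ArithmeticFunction.moebius_sq_eq_one_of_squarefree hl
  rw [sq] at this
  exact_mod_cast this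

lemma svL_one (w : ℕ) (hw : 2 ≤ w) : svL w 1 = 1 := by
  unfold svL
  have hG := svG_pos w hw
  have : ∀ m ∈ (svS w).filter (fun m => 1 ∣ m), (ArithmeticFunction.moebius (m / 1) : ℝ) * svY w m =
      1 / (Nat.totient m : ℝ) * (1 / svG w) := by
    intro m hm
    rw [Finset.mem_filter] at hm
    rw [Nat.div_one, svY, ← mul_div_assoc, sv_mu_sq (svS_mem.1 hm.1).2, one_div_mul_one_div]
  rw [Finset.sum_congr rfl this, ← Finset.sum_mul]
  simp only [one_dvd, Finset.filter_true, Nat.cast_one, one_mul]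
  change svG w * _ = 1
  field_simp

lemma svL_abs (w : ℕ) (hw : 2 ≤ w) (d : ℕ) : |svL w d| ≤ d := by
  unfold svL
  have hG := svG_pos w hw
  rw [abs_mul, Nat.abs_cast]
  have : |∑ m ∈ (svS w).filter (fun m => d ∣ m), (ArithmeticFunction.moebius (m / d) : ℝ) * svY w m| ≤ 1 := by
    calc _ ≤ ∑ m ∈ (svS w).filter (fun m => d ∣ m), |(ArithmeticFunction.moebius (m / d) : ℝ) * svY w m| :=
          Finset.abs_sum_le_sum_abs _ _
      _ ≤ ∑ m ∈ (svS w).filter (fun m => d ∣ m), 1 / (Nat.totient m : ℝ) * (1 / svG w) := by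
          apply Finset.sum_le_sum
          intro m hm
          have a1 : |(ArithmeticFunction.moebius (m/d) : ℝ)| ≤ 1 := by
            exact_mod_cast ArithmeticFunction.abs_moebius_le_one (n := m / d)
          have a2 : |(ArithmeticFunction.moebius m : ℝ)| ≤ 1 := by
            exact_mod_cast ArithmeticFunction.abs_moebius_le_one (n := m)
          rw [svY, abs_mul, abs_div, one_div_mul_one_div,
            abs_of_nonneg (by positivity : 0 ≤ (Nat.totient m : ℝ) * svG w)]
          calc _ ≤ 1 * (1 / ((Nat.totient m : ℝ) * svG w)) := by gcongr
            _ = _ := one_mul _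
      _ ≤ ∑ m ∈ svS w, 1 / (Nat.totient m : ℝ) * (1 / svG w) := by
          apply Finset.sum_le_sum_of_subset_of_nonneg (Finset.filter_subset _ _)
          intros; positivity
      _ = 1 := by
          rw [← Finset.sum_mul]; change svG w * _ = 1
          field_simp
  calc _ ≤ (d : ℝ) * 1 := by gcongr
    _ = d := mul_one _

lemma svL_inv (w l : ℕ) (hl : l ∈ svS w) :
    ∑ d ∈ (svS w).filter (fun d => l ∣ d), svL w d / d = svY w l := by
  have e1 : ∀ d ∈ (svS w).filter (fun d => l ∣ d), svL w d / d =
      ∑ m ∈ svS w, if d ∣ m then (ArithmeticFunction.moebius (m / d) : ℝ) * svY w m else 0 := by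
    intro d hd
    rw [Finset.mem_filter] at hd
    have : (d : ℝ) ≠ 0 := by exact_mod_cast (svS_pos hd.1).ne'
    rw [svL, mul_div_cancel_left₀ _ this, Finset.sum_filter]
  rw [Finset.sum_congr rfl e1, Finset.sum_comm]
  have e2 : ∀ m ∈ svS w, (∑ d ∈ (svS w).filter (fun d => l ∣ d),
      if d ∣ m then (ArithmeticFunction.moebius (m / d) : ℝ) * svY w m else 0) =
      if l = m then svY w m else 0 := by
    intro m hm
    have hm0 : m ≠ 0 := (svS_pos hm).ne'
    rw [← Finset.sum_filter]
    have e3 : ((svS w).filter (fun d => l ∣ d)).filter (fun d => d ∣ m) = m.divisors.filter (fun d => l ∣ d) := by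
      ext d; simp only [Finset.mem_filter, Nat.mem_divisors]
      constructor
      · rintro ⟨⟨h1, h2⟩, h3⟩; exact ⟨⟨h3, hm0⟩, h2⟩
      · rintro ⟨⟨h3, _⟩, h2⟩
        refine ⟨⟨svS_mem.2 ⟨?_, ?_⟩, h2⟩, h3⟩
        · exact lt_of_le_of_lt (Nat.le_of_dvd (svS_pos hm) h3) (svS_mem.1 hm).1
        · exact (svS_mem.1 hm).2.squarefree_of_dvd h3
    rw [e3, ← Finset.sum_mul]
    by_cases hlm : l ∣ m
    · rw [sv_moebius_sum l m hm0 hlm]; split_ifs <;> simp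
    · have : m.divisors.filter (fun d => l ∣ d) = ∅ := by
        rw [Finset.filter_eq_empty_iff]
        intro d hd hld
        exact hlm (hld.trans (Nat.dvd_of_mem_divisors hd))
      rw [this]
      have : l ≠ m := by rintro rfl; exact hlm dvd_rfl
      simp [this]
  rw [Finset.sum_congr rfl e2, Finset.sum_ite_eq, if_pos hl]

lemma sv_quad (w : ℕ) (hw : 2 ≤ w) :
    ∑ d ∈ svS w, ∑ e ∈ svS w, svL w d * svL w e / (Nat.lcm d e : ℝ) = 1 / svG w := by
  have hG := svG_pos w hw
  have e1 : ∀ d ∈ svS w, ∀ e ∈ svS w, svL w d * svL w e / (Nat.lcm d e : ℝ) =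
      ∑ l ∈ svS w, (Nat.totient l : ℝ) * ((if l ∣ d then svL w d / d else 0) * (if l ∣ e then svL w e / e else 0)) := by
    intro d hd e he
    have hd0 : (d : ℝ) ≠ 0 := by exact_mod_cast (svS_pos hd).ne'
    have he0 : (e : ℝ) ≠ 0 := by exact_mod_cast (svS_pos he).ne'
    have hg : 0 < Nat.gcd d e := Nat.gcd_pos_of_pos_left _ (svS_pos hd)
    have hgl : (Nat.gcd d e : ℝ) * Nat.lcm d e = d * e := by exact_mod_cast Nat.gcd_mul_lcm d e
    have hl0 : (Nat.lcm d e : ℝ) ≠ 0 := by exact_mod_cast (Nat.lcm_pos (svS_pos hd) (svS_pos he)).ne'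
    have hs := Nat.sum_totient (Nat.gcd d e)
    have hset : (Nat.gcd d e).divisors = (svS w).filter (fun l => l ∣ d ∧ l ∣ e) := by
      ext l; simp only [Finset.mem_filter, Nat.mem_divisors, Nat.dvd_gcd_iff]
      constructor
      · rintro ⟨h, _⟩
        refine ⟨svS_mem.2 ⟨?_, ?_⟩, h⟩
        · exact lt_of_le_of_lt (Nat.le_of_dvd (svS_pos hd) h.1) (svS_mem.1 hd).1
        · exact (svS_mem.1 hd).2.squarefree_of_dvd h.1
      · rintro ⟨_, h⟩; exact ⟨h, hg.ne'⟩
    rw [hset] at hs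
    have hs' : ∑ l ∈ (svS w).filter (fun l => l ∣ d ∧ l ∣ e), (Nat.totient l : ℝ) = Nat.gcd d e := by
      exact_mod_cast hs
    have : ∀ l ∈ svS w, (Nat.totient l : ℝ) * ((if l ∣ d then svL w d / d else 0) * (if l ∣ e then svL w e / e else 0))
       = (if l ∣ d ∧ l ∣ e then (Nat.totient l : ℝ) else 0) * (svL w d / d * (svL w e / e)) := by
      intro l _
      by_cases h1 : l ∣ d <;> by_cases h2 : l ∣ e <;> simp [h1, h2]
    rw [Finset.sum_congr rfl this, ← Finset.sum_mul, ← Finset.sum_filter, hs']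
    field_simp
    linear_combination (-svL w d * svL w e) * hgl
  rw [Finset.sum_congr rfl (fun d hd => Finset.sum_congr rfl (e1 d hd))]
  have e2 : ∑ d ∈ svS w, ∑ e ∈ svS w, ∑ l ∈ svS w, (Nat.totient l : ℝ) * ((if l ∣ d then svL w d / d else 0) * (if l ∣ e then svL w e / e else 0))
      = ∑ l ∈ svS w, (Nat.totient l : ℝ) * ((∑ d ∈ svS w, if l ∣ d then svL w d / d else 0) * (∑ e ∈ svS w, if l ∣ e then svL w e / e else 0)) := by
    simp_rw [Finset.sum_mul_sum, Finset.mul_sum]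
    rw [Finset.sum_congr rfl (fun d _ => Finset.sum_comm), Finset.sum_comm]
  rw [e2]
  have e3 : ∀ l ∈ svS w, (Nat.totient l : ℝ) * ((∑ d ∈ svS w, if l ∣ d then svL w d / d else 0) * (∑ e ∈ svS w, if l ∣ e then svL w e / e else 0))
      = 1 / (Nat.totient l : ℝ) * (1 / svG w ^ 2) := by
    intro l hl
    rw [← Finset.sum_filter, svL_inv w l hl, svY]
    have ht : (Nat.totient l : ℝ) ≠ 0 := by exact_mod_cast (Nat.totient_pos.2 (svS_pos hl)).ne'
    have := sv_mu_sq (svS_mem.1 hl).2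
    field_simp
    rw [sq, this]
  rw [Finset.sum_congr rfl e3, ← Finset.sum_mul]
  change svG w * _ = _
  field_simp

open scoped Classical in
theorem sieve_bound (w : ℕ) (hw : 2 ≤ w) (a b : ℕ) (hab : a ≤ b) :
    (((Finset.Ioc a b).filter (fun n => ∀ p, p.Prime → p ∣ n → w ≤ p)).card : ℝ)
      ≤ 2 * ((b:ℝ) - a) / Real.log w + (w:ℝ) ^ 4 := by
  classical
  have hG := svG_pos w hw
  have hlog : 0 < Real.log w := Real.log_pos (by exact_mod_cast hw)
  have hab' : (0:ℝ) ≤ (b:ℝ) - a := by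
    have : (a:ℝ) ≤ b := by exact_mod_cast hab
    linarith
  have s1 : (((Finset.Ioc a b).filter (fun n => ∀ p, p.Prime → p ∣ n → w ≤ p)).card : ℝ) ≤
      ∑ n ∈ Finset.Ioc a b, (∑ d ∈ svS w, if d ∣ n then svL w d else 0) ^ 2 := by
    rw [Finset.card_eq_sum_ones, Nat.cast_sum, Finset.sum_filter]
    apply Finset.sum_le_sum
    intro n hn
    split_ifs with h
    · have : (∑ d ∈ svS w, if d ∣ n then svL w d else 0) = 1 := by
        rw [Finset.sum_eq_single 1]
        · simp [svL_one w hw]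
        · intro d hd hd1
          rw [if_neg]
          intro hdn
          have := h _ (Nat.minFac_prime hd1) ((Nat.minFac_dvd d).trans hdn)
          have h2 := Nat.minFac_le (svS_pos hd)
          have h3 := (svS_mem.1 hd).1
          omega
        · intro h1
          exact absurd (svS_mem.2 ⟨by omega, squarefree_one⟩) h1
      rw [this]; simp
    · positivity
  have s2 : ∑ n ∈ Finset.Ioc a b, (∑ d ∈ svS w, if d ∣ n then svL w d else 0) ^ 2 =
      ∑ d ∈ svS w, ∑ e ∈ svS w, svL w d * svL w e * (((Finset.Ioc a b).filter (fun n => Nat.lcm d e ∣ n)).card : ℝ) := by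
    simp_rw [sq, Finset.sum_mul_sum]
    rw [Finset.sum_comm]
    apply Finset.sum_congr rfl; intro d _
    rw [Finset.sum_comm]
    apply Finset.sum_congr rfl; intro e _
    rw [Finset.card_eq_sum_ones, Nat.cast_sum, Finset.mul_sum, Finset.sum_filter]
    apply Finset.sum_congr rfl; intro n _
    by_cases h1 : d ∣ n <;> by_cases h2 : e ∣ n <;> simp [h1, h2, Nat.lcm_dvd_iff]
  have s3 : ∑ d ∈ svS w, ∑ e ∈ svS w, svL w d * svL w e * (((Finset.Ioc a b).filter (fun n => Nat.lcm d e ∣ n)).card : ℝ)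
      ≤ ∑ d ∈ svS w, ∑ e ∈ svS w, (((b:ℝ) - a) * (svL w d * svL w e / (Nat.lcm d e : ℝ)) + (w:ℝ)^2) := by
    apply Finset.sum_le_sum; intro d hd
    apply Finset.sum_le_sum; intro e he
    have hc := sv_mult_count a b (Nat.lcm d e) hab (Nat.lcm_pos (svS_pos hd) (svS_pos he))
    set c := (((Finset.Ioc a b).filter (fun n => Nat.lcm d e ∣ n)).card : ℝ)
    have hd1 : |svL w d| ≤ w := (svL_abs w hw d).trans (by exact_mod_cast (svS_mem.1 hd).1.le)
    have he1 : |svL w e| ≤ w := (svL_abs w hw e).trans (by exact_mod_cast (svS_mem.1 he).1.le)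
    have : svL w d * svL w e * (c - ((b:ℝ) - a) / (Nat.lcm d e : ℝ)) ≤ (w:ℝ)^2 := by
      calc _ ≤ |svL w d * svL w e * (c - ((b:ℝ) - a) / (Nat.lcm d e : ℝ))| := le_abs_self _
        _ = |svL w d| * |svL w e| * |c - ((b:ℝ) - a) / (Nat.lcm d e : ℝ)| := by rw [abs_mul, abs_mul]
        _ ≤ w * w * 1 := by gcongr
        _ = (w:ℝ)^2 := by ring
    have e : svL w d * svL w e * c = svL w d * svL w e * (c - ((b:ℝ) - a) / (Nat.lcm d e : ℝ)) + ((b:ℝ) - a) * (svL w d * svL w e / (Nat.lcm d e : ℝ)) := by ring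
    rw [e]; linarith
  have s4 : ∑ d ∈ svS w, ∑ e ∈ svS w, (((b:ℝ) - a) * (svL w d * svL w e / (Nat.lcm d e : ℝ)) + (w:ℝ)^2)
     = ((b:ℝ) - a) * (1 / svG w) + ((svS w).card : ℝ)^2 * (w:ℝ)^2 := by
    simp_rw [Finset.sum_add_distrib, ← Finset.mul_sum]
    rw [sv_quad w hw]
    simp; ring
  have hcard : ((svS w).card : ℝ) ≤ w := by
    have : (svS w).card ≤ w := by
      refine (Finset.card_filter_le _ _).trans ?_
      simp
    exact_mod_cast this
  have s5 : ((b:ℝ) - a) * (1 / svG w) ≤ 2 * ((b:ℝ) - a) / Real.log w := by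
    have := svG_log w hw
    rw [mul_one_div, div_le_div_iff₀ hG hlog]
    nlinarith
  have s6 : ((svS w).card : ℝ)^2 * (w:ℝ)^2 ≤ (w:ℝ)^4 := by
    calc _ ≤ (w:ℝ)^2 * (w:ℝ)^2 := by gcongr
      _ = _ := by ring
  linarith

lemma mertens_upper (y : ℕ) (hy : 2 ≤ y) :
    ∑ p ∈ Nat.primesBelow y, Real.log p / p ≤ 3 * Real.log y := by
  have hy0 : (0:ℝ) < y := by positivity
  have hdvd : ∏ p ∈ Nat.primesBelow y, p ^ (y / p) ∣ y.factorial := by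
    apply Finset.prod_dvd_of_isRelPrime
    · intro p hp q hq hpq
      have hp' := (Nat.mem_primesBelow.1 hp).2
      have hq' := (Nat.mem_primesBelow.1 hq).2
      exact Nat.coprime_iff_isRelPrime.1 (Nat.Coprime.pow _ _ ((Nat.coprime_primes hp' hq').2 hpq))
    · intro p hp
      have hp' := (Nat.mem_primesBelow.1 hp).2
      rw [hp'.pow_dvd_factorial_iff (b := Nat.log p y + 2) (by omega)]
      have := Finset.single_le_sum (f := fun i => y / p ^ i) (s := Finset.Ico 1 (Nat.log p y + 2))
        (fun i _ => Nat.zero_le _) (Finset.mem_Ico.2 ⟨le_refl 1, by omega⟩)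
      simpa using this
  have hle : ((∏ p ∈ Nat.primesBelow y, p ^ (y / p) : ℕ) : ℝ) ≤ (y:ℝ) ^ y := by
    have h1 := Nat.le_of_dvd (Nat.factorial_pos y) hdvd
    have h2 := Nat.factorial_le_pow y
    exact_mod_cast h1.trans h2
  have hpos : (0:ℝ) < ((∏ p ∈ Nat.primesBelow y, p ^ (y / p) : ℕ) : ℝ) := by
    have : 0 < ∏ p ∈ Nat.primesBelow y, p ^ (y / p) := by
      apply Finset.prod_pos
      intro p hp
      exact pow_pos (Nat.mem_primesBelow.1 hp).2.pos _
    exact_mod_cast this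
  have hlog := Real.log_le_log hpos hle
  rw [Real.log_pow] at hlog
  push_cast at hlog
  rw [Real.log_prod (fun p hp => by
    have := (Nat.mem_primesBelow.1 hp).2.pos
    positivity)] at hlog
  simp_rw [Real.log_pow] at hlog
  have htheta : ∑ p ∈ Nat.primesBelow y, Real.log p ≤ Real.log 4 * y := by
    have h1 := Chebyshev.theta_le_log4_mul_x (x := (y:ℝ)) hy0.le
    rw [Chebyshev.theta_eq_sum_primesLE_log] at h1
    refine le_trans ?_ h1
    apply Finset.sum_le_sum_of_subset_of_nonneg
    · intro p hp
      rw [Nat.mem_primesLE]; rw [Nat.mem_primesBelow] at hp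
      exact ⟨hp.1.le, hp.2⟩
    · intro p hp _
      exact Real.log_natCast_nonneg p
  have hterm : ∑ p ∈ Nat.primesBelow y, ((y:ℝ) * (Real.log p / p) - Real.log p) ≤
      ∑ p ∈ Nat.primesBelow y, ((y / p : ℕ) : ℝ) * Real.log p := by
    apply Finset.sum_le_sum
    intro p hp
    have hp' := (Nat.mem_primesBelow.1 hp).2.pos
    have hpp : (0:ℝ) < p := by exact_mod_cast hp'
    have e3 : (y : ℝ) / p < ((y / p : ℕ) : ℝ) + 1 := by
      rw [div_lt_iff₀ hpp]
      have := Nat.lt_div_mul_add (a := y) hp'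
      have h2 : y < (y / p + 1) * p := by rw [add_mul, one_mul]; exact this
      exact_mod_cast h2
    have hl := Real.log_natCast_nonneg p
    have : (y:ℝ) * (Real.log p / p) - Real.log p = ((y:ℝ) / p - 1) * Real.log p := by ring
    rw [this]
    apply mul_le_mul_of_nonneg_right _ hl
    linarith
  rw [Finset.sum_sub_distrib, ← Finset.mul_sum] at hterm
  have h4 : Real.log 4 ≤ 2 * Real.log y := by
    have : Real.log 4 = 2 * Real.log 2 := by
      rw [show (4:ℝ) = 2 ^ 2 by norm_num, Real.log_pow]; norm_num
    rw [this]
    have := Real.log_le_log (by norm_num : (0:ℝ) < 2) (by exact_mod_cast hy : (2:ℝ) ≤ y)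
    linarith
  have : (y:ℝ) * ∑ p ∈ Nat.primesBelow y, Real.log p / p ≤ y * (3 * Real.log y) := by
    nlinarith
  exact le_of_mul_le_mul_left this hy0

structure MF (F : ℕ → ℝ) (K B : ℝ) : Prop where
  nonneg : ∀ n, 0 ≤ F n
  one : F 1 = 1
  mul : ∀ m n, Nat.Coprime m n → F (m * n) = F m * F n
  hK : 1 ≤ K
  pp : ∀ p a : ℕ, p.Prime → F (p ^ a) ≤ K * (a + 1)
  p2 : ∀ p : ℕ, p.Prime → F p ≤ 2
  mert : ∀ y : ℕ, 2 ≤ y → Real.exp (∑ p ∈ Nat.primesBelow y, F p / p) ≤ B * Real.log y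

lemma MF.fac {F : ℕ → ℝ} {K B : ℝ} (h : MF F K B) (n : ℕ) (hn : n ≠ 0) :
    F n = ∏ p ∈ n.primeFactors, F (p ^ n.factorization p) := by
  rw [Nat.multiplicative_factorization F h.mul h.one hn]
  rfl

lemma MF.pp_pow {F : ℕ → ℝ} {K B : ℝ} (h : MF F K B) (p a : ℕ) (hp : p.Prime) :
    F (p ^ a) ≤ (2 * K) ^ a := by
  rcases Nat.eq_zero_or_pos a with rfl | ha
  · simp [h.one]
  · refine (h.pp p a hp).trans ?_
    have h1 : ((a:ℝ) + 1) ≤ 2 ^ a := by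
      have := Nat.lt_two_pow_self (n := a)
      exact_mod_cast this
    have h2 : K ≤ K ^ a := by
      simpa using pow_le_pow_right₀ h.hK ha
    have := h.hK
    rw [mul_pow]
    calc K * ((a:ℝ) + 1) ≤ K ^ a * 2 ^ a := by gcongr
      _ = _ := by ring

lemma MF.rough {F : ℕ → ℝ} {K B : ℝ} (h : MF F K B) (w c t : ℕ) (hw : 2 ≤ w) (hc : c ≠ 0)
    (hr : ∀ p, p.Prime → p ∣ c → w ≤ p) (hct : c ≤ w ^ t) : F c ≤ (2 * K) ^ t := by
  have hK := h.hK
  have h1 : F c ≤ (2 * K) ^ (∑ p ∈ c.primeFactors, c.factorization p) := by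
    rw [h.fac c hc, ← Finset.prod_pow_eq_pow_sum]
    apply Finset.prod_le_prod
    · intro p _; exact h.nonneg _
    · intro p hp; exact h.pp_pow p _ (Nat.prime_of_mem_primeFactors hp)
  have h2 : w ^ (∑ p ∈ c.primeFactors, c.factorization p) ≤ c := by
    conv_rhs => rw [← Nat.prod_factorization_pow_eq_self hc]
    rw [← Finset.prod_pow_eq_pow_sum]
    apply Finset.prod_le_prod'
    intro p hp
    exact Nat.pow_le_pow_left (hr p (Nat.prime_of_mem_primeFactors hp) (Nat.dvd_of_mem_primeFactors hp)) _
  have h3 : ∑ p ∈ c.primeFactors, c.factorization p ≤ t :=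
    (Nat.pow_le_pow_iff_right (by omega)).1 (h2.trans hct)
  exact h1.trans (pow_le_pow_right₀ (by linarith) h3)

lemma MF.eps {F : ℕ → ℝ} {K B : ℝ} (h : MF F K B) (ε : ℝ) (hε : 0 < ε) :
    ∃ C : ℝ, 1 ≤ C ∧ ∀ n : ℕ, n ≠ 0 → F n ≤ C * (n:ℝ) ^ ε := by
  have hK := h.hK
  have hl2 : 0 < Real.log 2 := Real.log_pos (by norm_num)
  obtain ⟨P0, hP0⟩ := exists_nat_ge ((2 * K) ^ (1 / ε))
  set C0 : ℝ := K * (1 + 1 / (ε * Real.log 2)) with hC0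
  have hC01 : 1 ≤ C0 := by
    have : 0 < 1 / (ε * Real.log 2) := by positivity
    rw [hC0]; nlinarith
  refine ⟨C0 ^ P0, one_le_pow₀ hC01, ?_⟩
  intro n hn
  have key : ∀ p ∈ n.primeFactors, F (p ^ n.factorization p) ≤
      (if p < P0 then C0 else 1) * ((p:ℝ) ^ (n.factorization p)) ^ ε := by
    intro p hp
    have hpp := Nat.prime_of_mem_primeFactors hp
    set a := n.factorization p
    have hp2 : (2:ℝ) ≤ p := by exact_mod_cast hpp.two_le
    have hcomm : ((p:ℝ) ^ a) ^ ε = ((p:ℝ) ^ ε) ^ a := by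
      rw [← Real.rpow_natCast, ← Real.rpow_natCast, ← Real.rpow_mul (by positivity),
        ← Real.rpow_mul (by positivity), mul_comm]
    split_ifs with hlt
    · refine (h.pp p a hpp).trans ?_
      have e1 : 1 + ε * Real.log 2 * a ≤ ((p:ℝ) ^ a) ^ ε := by
        calc 1 + ε * Real.log 2 * a ≤ Real.exp (ε * Real.log 2 * a) := by
              have := Real.add_one_le_exp (ε * Real.log 2 * a); linarith
          _ = ((2:ℝ) ^ ε) ^ a := by
              rw [Real.rpow_def_of_pos (by norm_num), ← Real.exp_nat_mul]; congr 1; ring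
          _ ≤ ((p:ℝ) ^ ε) ^ a := by gcongr
          _ = _ := hcomm.symm
      calc K * ((a:ℝ) + 1) ≤ K * ((1 + 1 / (ε * Real.log 2)) * (1 + ε * Real.log 2 * a)) := by
            gcongr
            have : (1 + 1 / (ε * Real.log 2)) * (1 + ε * Real.log 2 * a) =
              1 + a + 1 / (ε * Real.log 2) + ε * Real.log 2 * a := by field_simp; ring
            rw [this]
            have : 0 < 1 / (ε * Real.log 2) := by positivity
            have : 0 ≤ ε * Real.log 2 * a := by positivity
            linarith
        _ = C0 * (1 + ε * Real.log 2 * a) := by rw [hC0]; ring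
        _ ≤ _ := by gcongr
    · rw [one_mul, hcomm]
      refine (h.pp_pow p a hpp).trans ?_
      gcongr
      have : (2 * K) ^ (1 / ε) ≤ p := hP0.trans (by exact_mod_cast not_lt.1 hlt)
      calc 2 * K = ((2 * K) ^ (1 / ε)) ^ ε := by
            rw [← Real.rpow_mul (by positivity), one_div_mul_cancel hε.ne', Real.rpow_one]
        _ ≤ _ := by gcongr
  rw [h.fac n hn]
  calc _ ≤ ∏ p ∈ n.primeFactors, (if p < P0 then C0 else 1) * ((p:ℝ) ^ (n.factorization p)) ^ ε :=
        Finset.prod_le_prod (fun p _ => h.nonneg _) key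
    _ = (∏ p ∈ n.primeFactors, (if p < P0 then C0 else 1)) * (n:ℝ) ^ ε := by
        rw [Finset.prod_mul_distrib]
        congr 1
        rw [Real.finsetProd_rpow _ _ (fun p _ => by positivity)]
        congr 1
        conv_rhs => rw [← Nat.prod_factorization_pow_eq_self hn]
        simp [Finsupp.prod]
    _ ≤ C0 ^ P0 * (n:ℝ) ^ ε := by
        gcongr
        rw [Finset.prod_ite, Finset.prod_const, Finset.prod_const_one, mul_one]
        apply pow_le_pow_right₀ hC01
        calc _ ≤ (Finset.range P0).card := by
              apply Finset.card_le_card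
              intro p hp; rw [Finset.mem_filter] at hp; simpa using hp.2
          _ = P0 := by simp

lemma MF.rankin {F : ℕ → ℝ} {K B : ℝ} (h : MF F K B) (κ : ℝ) (hκ : 0 ≤ κ) :
    ∃ C : ℝ, 0 < C ∧ ∀ y : ℕ, 2 ≤ y → ∀ σ : ℝ, 0 ≤ σ → σ ≤ 1 / 4 → σ * Real.log y ≤ κ →
      ∀ T : Finset ℕ, (∀ b ∈ T, b ∈ Nat.smoothNumbers y) →
        ∑ b ∈ T, F b * (b:ℝ) ^ (σ - 1) ≤ C * Real.log y := by
  have hK := h.hK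
  set x0 : ℝ := (2:ℝ) ^ (-(3/4) : ℝ) with hx0
  have hx0p : 0 < x0 := by positivity
  have hx01 : x0 < 1 := Real.rpow_lt_one_of_one_lt_of_neg (by norm_num) (by norm_num)
  have hS1 : Summable (fun a : ℕ => ((a:ℝ) + 3) * x0 ^ a) := by
    have s1 := summable_pow_mul_geometric_of_norm_lt_one (R := ℝ) 1 (r := x0) (by
      rw [Real.norm_of_nonneg hx0p.le]; exact hx01)
    have s2 := (summable_geometric_of_lt_one hx0p.le hx01).mul_left 3
    refine (s1.add s2).congr ?_
    intro a; simp; ring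
  have hS0 : Summable (fun a : ℕ => K * ((a:ℝ) + 1) * x0 ^ a) := by
    refine Summable.of_nonneg_of_le (fun a => by positivity) (fun a => ?_) (hS1.mul_left K)
    rw [mul_assoc]; gcongr; norm_num
  set S := ∑' a : ℕ, ((a:ℝ) + 3) * x0 ^ a with hS
  have hSnn : 0 ≤ S := tsum_nonneg (fun a => by positivity)
  have hZ : Summable (fun n : ℕ => (n:ℝ) ^ (-(3/2) : ℝ)) := Real.summable_nat_rpow.2 (by norm_num)
  set Z := ∑' n : ℕ, (n:ℝ) ^ (-(3/2) : ℝ) with hZd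
  have hB : 0 < B := by
    have := h.mert 2 le_rfl
    have e := Real.exp_pos (∑ p ∈ Nat.primesBelow 2, F p / p)
    have l2 : 0 < Real.log ((2:ℕ):ℝ) := Real.log_pos (by norm_num)
    by_contra hb
    have : B * Real.log ((2:ℕ):ℝ) ≤ 0 := mul_nonpos_of_nonpos_of_nonneg (not_lt.1 hb) l2.le
    exact absurd (lt_of_lt_of_le e (h.mert 2 le_rfl)) (not_lt.2 this)
  refine ⟨B * Real.exp (6 * κ * Real.exp κ + K * S * Z), by positivity, ?_⟩
  intro y hy σ hσ0 hσ1 hσy T hT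
  have hly : 0 < Real.log y := Real.log_pos (by exact_mod_cast hy)
  set f : ℕ → ℝ := fun n => F n * (n:ℝ) ^ (σ - 1) with hf
  have hfnn : ∀ n, 0 ≤ f n := fun n => mul_nonneg (h.nonneg n) (by positivity)
  have hf1 : f 1 = 1 := by simp [hf, h.one]
  have hfm : ∀ {m n : ℕ}, Nat.Coprime m n → f (m * n) = f m * f n := by
    intro m n hmn
    simp only [hf]
    rw [h.mul m n hmn]; push_cast
    rw [Real.mul_rpow (by positivity) (by positivity)]; ring
  have hfp : ∀ p a : ℕ, f (p ^ a) = F (p ^ a) * ((p:ℝ) ^ (σ - 1)) ^ a := by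
    intro p a
    simp only [hf]; push_cast
    congr 1
    rw [← Real.rpow_natCast, ← Real.rpow_natCast, ← Real.rpow_mul (by positivity),
        ← Real.rpow_mul (by positivity), mul_comm]
  have hx : ∀ p : ℕ, p.Prime → (p:ℝ) ^ (σ - 1) ≤ x0 := by
    intro p hp
    have hp2 : (2:ℝ) ≤ p := by exact_mod_cast hp.two_le
    calc (p:ℝ) ^ (σ - 1) ≤ (p:ℝ) ^ (-(3/4) : ℝ) :=
          Real.rpow_le_rpow_of_exponent_le (by linarith) (by linarith)
      _ ≤ x0 := Real.rpow_le_rpow_of_nonpos (by norm_num) hp2 (by norm_num)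
  have hsump : ∀ {p : ℕ}, p.Prime → Summable (fun a : ℕ => f (p ^ a)) := by
    intro p hp
    refine Summable.of_nonneg_of_le (fun a => hfnn _) (fun a => ?_) hS0
    rw [hfp]
    have := h.pp p a hp
    have := hx p hp
    have := h.nonneg (p ^ a)
    gcongr
  have hsum : ∀ {p : ℕ}, p.Prime → Summable (fun a : ℕ => ‖f (p ^ a)‖) := by
    intro p hp
    refine (hsump hp).congr (fun a => ?_)
    rw [Real.norm_of_nonneg (hfnn _)]
  obtain ⟨-, hE⟩ := EulerProduct.summable_and_hasSum_smoothNumbers_prod_primesBelow_tsum hf1 hfm hsum y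
  have step1 : ∑ b ∈ T, f b ≤ ∏ p ∈ y.primesBelow, ∑' a : ℕ, f (p ^ a) := by
    have : ∑ b ∈ T, f b = ∑ b ∈ T.subtype (fun b => b ∈ Nat.smoothNumbers y), f b := by
      rw [Finset.sum_subtype_of_mem f hT]
    rw [this]
    exact sum_le_hasSum _ (fun b _ => hfnn b) hE
  have step2 : ∀ p ∈ y.primesBelow, ∑' a : ℕ, f (p ^ a) ≤
      Real.exp (F p / p + 2 * σ * Real.exp κ * (Real.log p / p) + K * S * (p:ℝ) ^ (-(3/2) : ℝ)) := by
    intro p hp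
    obtain ⟨hpy, hpp⟩ := Nat.mem_primesBelow.1 hp
    have hp2 : (2:ℝ) ≤ p := by exact_mod_cast hpp.two_le
    have hp0 : (0:ℝ) < p := by linarith
    rw [← (hsump hpp).sum_add_tsum_nat_add 2, Finset.sum_range_succ, Finset.sum_range_one]
    have t0 : f (p ^ 0) = 1 := by rw [pow_zero, hf1]
    have t1 : f (p ^ 1) ≤ F p / p + 2 * σ * Real.exp κ * (Real.log p / p) := by
      rw [pow_one]; simp only [hf]
      rw [Real.rpow_sub_one hp0.ne']
      have hlp : 0 ≤ Real.log p := Real.log_natCast_nonneg p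
      have hlpy : Real.log p ≤ Real.log y := Real.log_le_log hp0 (by exact_mod_cast hpy.le)
      set t := σ * Real.log p with ht
      have ht0 : 0 ≤ t := mul_nonneg hσ0 hlp
      have htκ : t ≤ κ := (mul_le_mul_of_nonneg_left hlpy hσ0).trans hσy
      have hpe : (p:ℝ) ^ σ = Real.exp t := by rw [Real.rpow_def_of_pos hp0, ht, mul_comm]
      have he : Real.exp t ≤ 1 + t * Real.exp κ := by
        have h1 : Real.exp t * (1 - t) ≤ 1 := by
          have h2 := Real.add_one_le_exp (-t)
          calc Real.exp t * (1 - t) ≤ Real.exp t * Real.exp (-t) := by gcongr; linarith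
            _ = 1 := by rw [← Real.exp_add]; simp
        have h3 : t * Real.exp t ≤ t * Real.exp κ := by gcongr
        nlinarith
      have hF2 := h.p2 p hpp
      have hF0 := h.nonneg p
      calc F p * ((p:ℝ) ^ σ / p) ≤ F p * ((1 + t * Real.exp κ) / p) := by rw [hpe]; gcongr
        _ = F p / p + F p * (t * Real.exp κ / p) := by ring
        _ ≤ F p / p + 2 * (t * Real.exp κ / p) := by gcongr
        _ = _ := by rw [ht]; ring
    have t2 : ∑' a : ℕ, f (p ^ (a + 2)) ≤ K * S * (p:ℝ) ^ (-(3/2) : ℝ) := by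
      have hle : ∀ a : ℕ, f (p ^ (a + 2)) ≤ (K * (p:ℝ) ^ (-(3/2) : ℝ)) * (((a:ℝ) + 3) * x0 ^ a) := by
        intro a
        rw [hfp, pow_add ((p:ℝ) ^ (σ - 1)) a 2]
        have hsq : ((p:ℝ) ^ (σ - 1)) ^ 2 ≤ (p:ℝ) ^ (-(3/2) : ℝ) := by
          rw [← Real.rpow_natCast, ← Real.rpow_mul (by positivity)]
          apply Real.rpow_le_rpow_of_exponent_le (by linarith)
          push_cast; linarith
        have h1 := h.pp p (a + 2) hpp
        push_cast at h1
        have h2 : ((p:ℝ) ^ (σ - 1)) ^ a ≤ x0 ^ a := by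
          have := hx p hpp
          gcongr
        calc F (p ^ (a + 2)) * (((p:ℝ) ^ (σ - 1)) ^ a * ((p:ℝ) ^ (σ - 1)) ^ 2)
            ≤ (K * ((a:ℝ) + 2 + 1)) * (x0 ^ a * (p:ℝ) ^ (-(3/2) : ℝ)) := by
              gcongr
          _ = _ := by ring
      have hs2 := (summable_nat_add_iff 2).2 (hsump hpp)
      calc _ ≤ ∑' a : ℕ, (K * (p:ℝ) ^ (-(3/2) : ℝ)) * (((a:ℝ) + 3) * x0 ^ a) :=
            hs2.tsum_le_tsum hle (hS1.mul_left _)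
        _ = _ := by rw [tsum_mul_left]; ring
    rw [t0]
    refine le_trans ?_ (Real.add_one_le_exp _)
    linarith
  have step3 : ∏ p ∈ y.primesBelow, ∑' a : ℕ, f (p ^ a) ≤
      Real.exp (∑ p ∈ y.primesBelow, (F p / p + 2 * σ * Real.exp κ * (Real.log p / p) + K * S * (p:ℝ) ^ (-(3/2) : ℝ))) := by
    rw [Real.exp_sum]
    exact Finset.prod_le_prod (fun p _ => tsum_nonneg (fun a => hfnn _)) step2
  rw [Finset.sum_add_distrib, Finset.sum_add_distrib, ← Finset.mul_sum, ← Finset.mul_sum] at step3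
  have m1 := mertens_upper y hy
  have m2 : ∑ p ∈ y.primesBelow, (p:ℝ) ^ (-(3/2) : ℝ) ≤ Z :=
    hZ.sum_le_tsum _ (fun n _ => by positivity)
  have m3 : 2 * σ * Real.exp κ * ∑ p ∈ y.primesBelow, Real.log p / p ≤ 6 * κ * Real.exp κ := by
    calc _ ≤ 2 * σ * Real.exp κ * (3 * Real.log y) := by gcongr
      _ = 6 * (σ * Real.log y) * Real.exp κ := by ring
      _ ≤ _ := by gcongr
  have m4 : K * S * ∑ p ∈ y.primesBelow, (p:ℝ) ^ (-(3/2) : ℝ) ≤ K * S * Z := by gcongr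
  calc _ ≤ _ := step1.trans step3
    _ ≤ Real.exp (∑ p ∈ y.primesBelow, F p / p + (6 * κ * Real.exp κ + K * S * Z)) := by
        apply Real.exp_le_exp.2; linarith
    _ = Real.exp (∑ p ∈ y.primesBelow, F p / p) * Real.exp (6 * κ * Real.exp κ + K * S * Z) := Real.exp_add _ _
    _ ≤ (B * Real.log y) * Real.exp (6 * κ * Real.exp κ + K * S * Z) := by
        have := h.mert y hy
        gcongr
    _ = _ := by ring

lemma shiu_decomp (m z : ℕ) (hz : 1 ≤ z) (hzm : z < m) :
    ∃ b c q : ℕ, m = b * c ∧ Nat.Coprime b c ∧ 1 ≤ b ∧ b ≤ z ∧ b ∈ Nat.smoothNumbers q ∧ q.Prime ∧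
      (∀ p, p.Prime → p ∣ c → q ≤ p) ∧ ∃ a, q ^ a ∣ c ∧ z < b * q ^ a := by
  have hm : m ≠ 0 := by omega
  set Bt : ℕ → ℕ := fun t => ∏ p ∈ m.primeFactors.filter (fun p => p < t), p ^ m.factorization p with hB
  set Dt : ℕ → ℕ := fun t => ∏ p ∈ m.primeFactors.filter (fun p => ¬ p < t), p ^ m.factorization p with hD
  have hBD : ∀ t, Bt t * Dt t = m := by
    intro t
    simp only [hB, hD]
    rw [Finset.prod_filter_mul_prod_filter_not]
    exact Nat.prod_factorization_pow_eq_self hm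
  have hex : ∃ t, z < Bt t := by
    refine ⟨m + 1, ?_⟩
    have : Bt (m + 1) = m := by
      simp only [hB]
      rw [Finset.filter_true_of_mem]
      · exact Nat.prod_factorization_pow_eq_self hm
      · intro p hp
        have := Nat.le_of_mem_primeFactors hp
        omega
    rw [this]; exact hzm
  classical
  set t0 := Nat.find hex with ht0
  have h1 : z < Bt t0 := Nat.find_spec hex
  have h0 : t0 ≠ 0 := by
    intro h
    rw [h] at h1
    simp [hB] at h1
    omega
  obtain ⟨q, hq⟩ := Nat.exists_eq_succ_of_ne_zero h0
  have h2 : Bt q ≤ z := not_lt.1 (Nat.find_min hex (by omega))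
  rw [hq] at h1
  have hqm : q ∈ m.primeFactors := by
    by_contra hn
    have : Bt q.succ = Bt q := by
      simp only [hB]
      congr 1
      ext p; simp only [Finset.mem_filter]
      constructor
      · rintro ⟨h3, h4⟩
        refine ⟨h3, ?_⟩
        have : p ≠ q := by rintro rfl; exact hn h3
        omega
      · rintro ⟨h3, h4⟩; exact ⟨h3, by omega⟩
    omega
  have hqs : Bt q.succ = Bt q * q ^ m.factorization q := by
    simp only [hB]
    have : m.primeFactors.filter (fun p => p < q.succ) = insert q (m.primeFactors.filter (fun p => p < q)) := by
      ext p; simp only [Finset.mem_filter, Finset.mem_insert]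
      constructor
      · rintro ⟨h3, h4⟩
        by_cases p = q
        · left; assumption
        · right; exact ⟨h3, by omega⟩
      · rintro (rfl | ⟨h3, h4⟩)
        · exact ⟨hqm, by omega⟩
        · exact ⟨h3, by omega⟩
    rw [this, Finset.prod_insert (by simp), mul_comm]
  have hqp := Nat.prime_of_mem_primeFactors hqm
  have hBpos : 0 < Bt q := by
    rcases Nat.eq_zero_or_pos (Bt q) with h | h
    · have := hBD q; rw [h] at this; omega
    · exact h
  have hbp : ∀ p, p.Prime → p ∣ Bt q → p < q := by
    intro p hp hd
    simp only [hB] at hd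
    obtain ⟨r, hr, hd⟩ := (Prime.dvd_finset_prod_iff hp.prime _).1 hd
    rw [Finset.mem_filter] at hr
    have := (Nat.prime_dvd_prime_iff_eq hp (Nat.prime_of_mem_primeFactors hr.1)).1 (hp.dvd_of_dvd_pow hd)
    omega
  have hcp : ∀ p, p.Prime → p ∣ Dt q → q ≤ p := by
    intro p hp hd
    simp only [hD] at hd
    obtain ⟨r, hr, hd⟩ := (Prime.dvd_finset_prod_iff hp.prime _).1 hd
    rw [Finset.mem_filter] at hr
    have := (Nat.prime_dvd_prime_iff_eq hp (Nat.prime_of_mem_primeFactors hr.1)).1 (hp.dvd_of_dvd_pow hd)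
    omega
  refine ⟨Bt q, Dt q, q, (hBD q).symm, ?_, hBpos, h2, ?_, hqp, hcp, m.factorization q, ?_, ?_⟩
  · apply Nat.coprime_of_dvd
    intro p hp h3 h4
    have := hbp p hp h3
    have := hcp p hp h4
    omega
  · exact Nat.mem_smoothNumbers'.2 hbp
  · simp only [hD]
    exact Finset.dvd_prod_of_mem (fun p => p ^ m.factorization p) (Finset.mem_filter.2 ⟨hqm, lt_irrefl q⟩)
  · rw [← hqs]; exact h1

lemma count_dvd (M H d : ℕ) (hd : 0 < d) (hdH : d ≤ H) :
    (((Finset.Ioc M (M + H)).filter (fun m => d ∣ m)).card : ℝ) ≤ 2 * (H / d) := by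
  have h := sv_mult_count M (M + H) d (by omega) hd
  have hd' : (0:ℝ) < d := by exact_mod_cast hd
  have h1 : (1:ℝ) ≤ H / d := by
    rw [le_div_iff₀ hd', one_mul]; exact_mod_cast hdH
  have := (abs_le.1 h).2
  push_cast at this
  have e : ((M:ℝ) + H - M) / d = H / d := by ring
  rw [e] at this
  linarith

open scoped Classical in
lemma count_rough (M H b w z : ℕ) (hb : 1 ≤ b) (hbz : b ≤ z) (hw : 2 ≤ w) (hwz : w ≤ z) (hH : z ^ 8 ≤ H) :
    (((Finset.Ioc M (M + H)).filter (fun m => b ∣ m ∧ ∀ p, p.Prime → p ∣ m / b → w ≤ p)).card : ℝ)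
      ≤ 5 * (H / b) / Real.log w := by
  have hb' : (0:ℝ) < b := by exact_mod_cast hb
  have hlog : 0 < Real.log w := Real.log_pos (by exact_mod_cast hw)
  have hle : M / b ≤ (M + H) / b := Nat.div_le_div_right (by omega)
  have h1 : ((Finset.Ioc M (M + H)).filter (fun m => b ∣ m ∧ ∀ p, p.Prime → p ∣ m / b → w ≤ p)).card ≤
      ((Finset.Ioc (M / b) ((M + H) / b)).filter (fun n => ∀ p, p.Prime → p ∣ n → w ≤ p)).card := by
    apply Finset.card_le_card_of_injOn (fun m => m / b)
    · intro m hm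
      simp only [Finset.coe_filter, Finset.mem_Ioc, Set.mem_setOf_eq] at hm ⊢
      obtain ⟨⟨h2, h3⟩, ⟨n, rfl⟩, h5⟩ := hm
      refine ⟨⟨?_, Nat.div_le_div_right h3⟩, h5⟩
      rw [Nat.mul_div_cancel_left _ hb]
      rw [Nat.div_lt_iff_lt_mul hb, mul_comm]; exact h2
    · intro m hm n hn hmn
      simp only [Finset.coe_filter, Finset.mem_Ioc, Set.mem_setOf_eq] at hm hn hmn
      rw [← Nat.mul_div_cancel' hm.2.1, ← Nat.mul_div_cancel' hn.2.1, hmn]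
  have h2 := sieve_bound w hw _ _ hle
  have h3 : (((M + H) / b : ℕ) : ℝ) - ((M / b : ℕ) : ℝ) ≤ H / b + 1 := by
    have e1 : (((M + H) / b : ℕ) : ℝ) ≤ ((M + H : ℕ) : ℝ) / b := Nat.cast_div_le
    have e4 : (M : ℝ) / b < ((M / b : ℕ) : ℝ) + 1 := by
      rw [div_lt_iff₀ hb']
      have := Nat.lt_div_mul_add (a := M) hb
      have h2 : M < (M / b + 1) * b := by rw [add_mul, one_mul]; exact this
      exact_mod_cast h2
    push_cast at e1
    rw [add_div] at e1
    linarith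
  have hz7 : (z:ℝ) ^ 7 ≤ H / b := by
    rw [le_div_iff₀ hb']
    calc (z:ℝ) ^ 7 * b ≤ (z:ℝ) ^ 7 * z := by gcongr
      _ = (z:ℝ) ^ 8 := by ring
      _ ≤ H := by exact_mod_cast hH
  have hz1 : (1:ℝ) ≤ z := by exact_mod_cast (by omega : 1 ≤ z)
  have hw1 : (1:ℝ) ≤ w := by exact_mod_cast (by omega : 1 ≤ w)
  have hz71 : (1:ℝ) ≤ (z:ℝ) ^ 7 := one_le_pow₀ hz1
  have hw4 : (w:ℝ) ^ 4 * Real.log w ≤ H / b := by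
    have : Real.log w ≤ w := (Real.log_le_sub_one_of_pos (by linarith)).trans (by linarith)
    calc (w:ℝ) ^ 4 * Real.log w ≤ (w:ℝ) ^ 4 * w := by gcongr
      _ = (w:ℝ) ^ 5 := by ring
      _ ≤ (z:ℝ) ^ 5 := by gcongr
      _ ≤ (z:ℝ) ^ 7 := pow_le_pow_right₀ hz1 (by norm_num)
      _ ≤ _ := hz7
  calc _ ≤ _ := (Nat.cast_le (α := ℝ)).2 h1
    _ ≤ _ := h2
    _ ≤ 2 * (H / b + 1) / Real.log w + (w:ℝ) ^ 4 := by gcongr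
    _ = (2 * (H / b + 1) + (w:ℝ) ^ 4 * Real.log w) / Real.log w := by field_simp
    _ ≤ _ := by
        gcongr
        linarith

open scoped Classical in
lemma class_sum {F : ℕ → ℝ} {K B : ℝ} (h : MF F K B) (M H w z t : ℕ) (T : Finset ℕ)
    (hT : ∀ b ∈ T, 1 ≤ b ∧ b ≤ z) (hw : 2 ≤ w) (hwz : w ≤ z) (hH : z ^ 8 ≤ H) (ht : M + H ≤ w ^ t) :
    ∑ m ∈ (Finset.Ioc M (M + H)).filter (fun m => ∃ b ∈ T, ∃ c, m = b * c ∧ Nat.Coprime b c ∧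
      ∀ p, p.Prime → p ∣ c → w ≤ p), F m ≤ (2 * K) ^ t * (5 * H / Real.log w) * ∑ b ∈ T, F b / b := by
  have hK := h.hK
  have hlog : 0 < Real.log w := Real.log_pos (by exact_mod_cast hw)
  calc _ ≤ ∑ m ∈ Finset.Ioc M (M + H), ∑ b ∈ T,
        if (b ∣ m ∧ ∀ p, p.Prime → p ∣ m / b → w ≤ p) then F b * (2 * K) ^ t else 0 := by
        rw [Finset.sum_filter]
        apply Finset.sum_le_sum
        intro m hm
        have hnn : ∀ b ∈ T, 0 ≤ if (b ∣ m ∧ ∀ p, p.Prime → p ∣ m / b → w ≤ p) then F b * (2 * K) ^ t else 0 := by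
          intro b _
          split_ifs
          · exact mul_nonneg (h.nonneg b) (by positivity)
          · exact le_rfl
        split_ifs with hc
        · obtain ⟨b, hbT, c, rfl, hco, hr⟩ := hc
          have hb1 := (hT b hbT).1
          refine le_trans ?_ (Finset.single_le_sum hnn hbT)
          rw [if_pos ⟨dvd_mul_right _ _, by rw [Nat.mul_div_cancel_left _ hb1]; exact hr⟩]
          rw [h.mul b c hco]
          rw [Finset.mem_Ioc] at hm
          have hc0 : c ≠ 0 := by rintro rfl; simp at hm
          apply mul_le_mul_of_nonneg_left _ (h.nonneg b)
          apply h.rough w c t hw hc0 hr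
          calc c ≤ b * c := Nat.le_mul_of_pos_left _ hb1
            _ ≤ _ := hm.2.trans ht
        · exact Finset.sum_nonneg hnn
    _ = ∑ b ∈ T, (((Finset.Ioc M (M + H)).filter (fun m => b ∣ m ∧ ∀ p, p.Prime → p ∣ m / b → w ≤ p)).card : ℝ) * (F b * (2 * K) ^ t) := by
        rw [Finset.sum_comm]
        apply Finset.sum_congr rfl
        intro b _
        rw [← Finset.sum_filter, Finset.sum_const, nsmul_eq_mul]
    _ ≤ ∑ b ∈ T, (5 * (H / b) / Real.log w) * (F b * (2 * K) ^ t) := by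
        apply Finset.sum_le_sum
        intro b hb
        apply mul_le_mul_of_nonneg_right _ (mul_nonneg (h.nonneg b) (by positivity))
        exact count_rough M H b w z (hT b hb).1 (hT b hb).2 hw hwz hH
    _ = _ := by
        rw [Finset.mul_sum]
        apply Finset.sum_congr rfl
        intro b _
        ring

open scoped Classical in
lemma class_one {F : ℕ → ℝ} {K B : ℝ} (h : MF F K B) (E : ℕ) :
    ∃ C : ℝ, 0 < C ∧ ∀ M H s : ℕ, 2 ≤ s → (s ^ 2) ^ 8 ≤ H → M + H ≤ (s ^ 2) ^ E →
    ∑ m ∈ (Finset.Ioc M (M + H)).filter (fun m => ∃ b ∈ Finset.Icc 1 (s ^ 2), ∃ c, m = b * c ∧ Nat.Coprime b c ∧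
      ∀ p, p.Prime → p ∣ c → s ≤ p), F m ≤ C * H := by
  obtain ⟨C, hC, hr⟩ := h.rankin 0 le_rfl
  have hK := h.hK
  refine ⟨(2 * K) ^ (2 * E) * 20 * C, by positivity, ?_⟩
  intro M H s hs hH hE
  have hlog : 0 < Real.log s := Real.log_pos (by exact_mod_cast hs)
  have h1 := class_sum h M H s (s ^ 2) (2 * E) (Finset.Icc 1 (s ^ 2)) (fun b hb => Finset.mem_Icc.1 hb) hs
    (by nlinarith) hH (by rw [pow_mul]; exact hE)
  refine le_trans (le_of_eq (by congr!)) (h1.trans ?_)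
  have h2 := hr ((s ^ 2) ^ 2) (by have : 2 ≤ s ^ 2 := by nlinarith
                                  nlinarith) 0 le_rfl (by norm_num) (by simp) (Finset.Icc 1 (s ^ 2)) (by
    intro b hb
    have := Finset.mem_Icc.1 hb
    apply Nat.mem_smoothNumbers_of_lt (by omega)
    have : 2 ≤ s ^ 2 := by nlinarith
    nlinarith)
  have h3 : ∑ b ∈ Finset.Icc 1 (s ^ 2), F b / b ≤ C * (4 * Real.log s) := by
    convert h2 using 1
    · apply Finset.sum_congr rfl
      intro b _
      rw [zero_sub, Real.rpow_neg_one]; rfl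
    · push_cast
      rw [Real.log_pow, Real.log_pow]; push_cast; ring
  calc _ ≤ (2 * K) ^ (2 * E) * (5 * H / Real.log s) * (C * (4 * Real.log s)) := by gcongr
    _ = _ := by field_simp; ring

open scoped Classical in
lemma class_four {F : ℕ → ℝ} {K B : ℝ} (h : MF F K B) (E : ℕ) :
    ∃ C : ℝ, 0 < C ∧ ∃ W0 : ℕ, ∀ M H W P : ℕ, W0 ≤ W → 1 ≤ W → 1 ≤ P → (2 ^ (4 * W * P)) ^ 8 ≤ H →
      M + H ≤ (2 ^ (4 * W * P)) ^ E →
    ∑ m ∈ (Finset.Ioc M (M + H)).filter (fun m => ∃ b ∈ (Finset.Icc 1 (2 ^ (4 * W * P))).filter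
      (fun b => b ∈ Nat.smoothNumbers (2 ^ (2 * W)) ∧ 2 ^ (2 * W * P) < b), ∃ c, m = b * c ∧ Nat.Coprime b c ∧
      ∀ p, p.Prime → p ∣ c → 2 ^ W ≤ p), F m ≤ C * H * (1 / 2) ^ P := by
  have hK := h.hK
  obtain ⟨α, hα⟩ := pow_unbounded_of_one_lt (2 * K) (one_lt_two (α := ℝ))
  set κ : ℕ := 4 * α * E + 1 with hκ
  obtain ⟨C, hC, hr⟩ := h.rankin κ (by positivity)
  refine ⟨10 * C, by positivity, 2 * κ, ?_⟩
  intro M H W P hW0 hW hP hH hE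
  have hWr : (0:ℝ) < W := by exact_mod_cast hW
  have l2 : 0 < Real.log 2 := Real.log_pos (by norm_num)
  have hw2 : 2 ≤ 2 ^ W := by
    calc 2 = 2 ^ 1 := by norm_num
      _ ≤ 2 ^ W := Nat.pow_le_pow_right (by norm_num) hW
  set T := (Finset.Icc 1 (2 ^ (4 * W * P))).filter
      (fun b => b ∈ Nat.smoothNumbers (2 ^ (2 * W)) ∧ 2 ^ (2 * W * P) < b) with hT
  have h1 := class_sum h M H (2 ^ W) (2 ^ (4 * W * P)) (4 * P * E) T
    (fun b hb => Finset.mem_Icc.1 (Finset.mem_filter.1 hb).1) hw2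
    (Nat.pow_le_pow_right (by norm_num) (by nlinarith)) hH (by
      rw [← pow_mul] at hE ⊢
      convert hE using 2; ring)
  refine le_trans (le_of_eq (by congr!)) (h1.trans ?_)
  set σ : ℝ := κ / (2 * W) with hσ
  have hσ0 : 0 ≤ σ := by positivity
  have h2 := hr (2 ^ (2 * W)) (by
      calc 2 ≤ 2 ^ W := hw2
        _ ≤ _ := Nat.pow_le_pow_right (by norm_num) (by omega)) σ hσ0 (by
      rw [hσ, div_le_iff₀ (by positivity)]
      have : ((2 * κ : ℕ):ℝ) ≤ W := by exact_mod_cast hW0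
      push_cast at this ⊢
      linarith) (by
      push_cast
      rw [Real.log_pow, hσ]; push_cast
      have : Real.log 2 ≤ 1 := by linarith [Real.log_two_lt_d9]
      have e : (κ:ℝ) / (2 * W) * (2 * W * Real.log 2) = κ * Real.log 2 := by field_simp
      have : (0:ℝ) ≤ κ := by positivity
      rw [e]; nlinarith) T (fun b hb => (Finset.mem_filter.1 hb).2.1)
  have h3 : ∑ b ∈ T, F b / b ≤ (1/2:ℝ) ^ (κ * P) * (C * (2 * W * Real.log 2)) := by
    have e : Real.log ((2 ^ (2 * W) : ℕ) : ℝ) = 2 * W * Real.log 2 := by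
      push_cast; rw [Real.log_pow]; push_cast; ring
    rw [← e]
    refine le_trans ?_ (mul_le_mul_of_nonneg_left h2 (by positivity))
    rw [Finset.mul_sum]
    apply Finset.sum_le_sum
    intro b hb
    have hb' := (Finset.mem_filter.1 hb).2.2
    have hb0 : (0:ℝ) < b := by
      have : 0 < b := lt_of_le_of_lt (Nat.zero_le _) hb'
      exact_mod_cast this
    have hge : (2:ℝ) ^ (κ * P) ≤ (b:ℝ) ^ σ := by
      have h5 : ((2:ℝ) ^ (2 * W * P)) ^ σ ≤ (b:ℝ) ^ σ := by
        apply Real.rpow_le_rpow (by positivity) _ hσ0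
        exact_mod_cast hb'.le
      refine le_trans (le_of_eq ?_) h5
      rw [← Real.rpow_natCast, ← Real.rpow_natCast, ← Real.rpow_mul (by norm_num)]
      congr 1
      rw [hσ]; push_cast; field_simp
    rw [Real.rpow_sub hb0, Real.rpow_one]
    have hFb := h.nonneg b
    have e2 : (1/2:ℝ) ^ (κ * P) * (F b * ((b:ℝ) ^ σ / b)) = F b / b * ((1/2:ℝ) ^ (κ * P) * (b:ℝ) ^ σ) := by
      field_simp
    rw [e2]
    have : 1 ≤ (1/2:ℝ) ^ (κ * P) * (b:ℝ) ^ σ := by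
      calc (1:ℝ) = (1/2:ℝ) ^ (κ * P) * 2 ^ (κ * P) := by rw [← mul_pow]; norm_num
        _ ≤ _ := by gcongr
    have h6 : 0 ≤ F b / b := by positivity
    nlinarith
  have h4 : (2 * K) ^ (4 * P * E) ≤ (2:ℝ) ^ (α * (4 * P * E)) := by
    rw [pow_mul (2:ℝ) α]
    exact pow_le_pow_left₀ (by positivity) hα.le _
  have e3 : Real.log ((2 ^ W : ℕ) : ℝ) = W * Real.log 2 := by push_cast; rw [Real.log_pow]
  calc _ ≤ (2:ℝ) ^ (α * (4 * P * E)) * (5 * H / (W * Real.log 2)) * ((1/2:ℝ) ^ (κ * P) * (C * (2 * W * Real.log 2))) := by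
        rw [e3]; gcongr
        exact Finset.sum_nonneg (fun b _ => div_nonneg (h.nonneg b) (by positivity))
    _ = 10 * C * H * ((2:ℝ) ^ (α * (4 * P * E)) * (1/2:ℝ) ^ (κ * P)) := by field_simp; ring
    _ = _ := by
      congr 1
      have : κ * P = α * (4 * P * E) + P := by rw [hκ]; ring
      rw [this, pow_add, ← mul_assoc, ← mul_pow]; norm_num

lemma class_two (M H s : ℕ) (hs : 2 ≤ s) (hH : s ^ 2 ≤ H) :
    (((Finset.Ioc M (M + H)).filter (fun m => ∃ q ∈ Finset.Icc 2 s, q ^ (Nat.log q s + 1) ∣ m)).card : ℝ) ≤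
      2 * (∑' n : ℕ, (n:ℝ) ^ (-(3/2) : ℝ)) * H * (s:ℝ) ^ (-(1/4):ℝ) := by
  have hZ : Summable (fun n : ℕ => (n:ℝ) ^ (-(3/2) : ℝ)) := Real.summable_nat_rpow.2 (by norm_num)
  have h1 : ((Finset.Ioc M (M + H)).filter (fun m => ∃ q ∈ Finset.Icc 2 s, q ^ (Nat.log q s + 1) ∣ m)) ⊆
      (Finset.Icc 2 s).biUnion (fun q => (Finset.Ioc M (M + H)).filter (fun m => q ^ (Nat.log q s + 1) ∣ m)) := by
    intro m hm
    simp only [Finset.mem_filter, Finset.mem_biUnion] at hm ⊢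
    obtain ⟨h1, q, h2, h3⟩ := hm
    exact ⟨q, h2, h1, h3⟩
  have h2 := (Finset.card_le_card h1).trans Finset.card_biUnion_le
  have h3 : (((Finset.Ioc M (M + H)).filter (fun m => ∃ q ∈ Finset.Icc 2 s, q ^ (Nat.log q s + 1) ∣ m)).card : ℝ) ≤
      ∑ q ∈ Finset.Icc 2 s, (((Finset.Ioc M (M + H)).filter (fun m => q ^ (Nat.log q s + 1) ∣ m)).card : ℝ) := by
    exact_mod_cast h2
  refine h3.trans ?_
  have h4 : ∀ q ∈ Finset.Icc 2 s, (((Finset.Ioc M (M + H)).filter (fun m => q ^ (Nat.log q s + 1) ∣ m)).card : ℝ) ≤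
      2 * H * (s:ℝ) ^ (-(1/4):ℝ) * (q:ℝ) ^ (-(3/2) : ℝ) := by
    intro q hq
    obtain ⟨hq2, hqs⟩ := Finset.mem_Icc.1 hq
    have hlt : s < q ^ (Nat.log q s + 1) := Nat.lt_pow_succ_log_self (by omega) s
    have hle : q ^ (Nat.log q s) ≤ s := Nat.pow_log_le_self q (by omega)
    have hlog : 1 ≤ Nat.log q s := Nat.log_pos (by omega) hqs
    have hle2 : q ^ 2 ≤ q ^ (Nat.log q s + 1) := Nat.pow_le_pow_right (by omega) (by omega)
    have hle3 : q ^ (Nat.log q s + 1) ≤ H := by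
      rw [pow_succ]
      calc _ ≤ s * s := Nat.mul_le_mul hle hqs
        _ ≤ H := by nlinarith
    refine (count_dvd M H _ (by omega) hle3).trans ?_
    set d := q ^ (Nat.log q s + 1) with hd
    have hd0 : (0:ℝ) < d := by
      have : 0 < d := by omega
      exact_mod_cast this
    have hs0 : (0:ℝ) < s := by positivity
    have hq0 : (0:ℝ) < q := by positivity
    have e : (H:ℝ) / d = H * ((d:ℝ) ^ (-(1/4):ℝ) * (d:ℝ) ^ (-(3/4):ℝ)) := by
      rw [← Real.rpow_add hd0]; norm_num [Real.rpow_neg_one]; rfl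
    have i1 : (d:ℝ) ^ (-(1/4):ℝ) ≤ (s:ℝ) ^ (-(1/4):ℝ) :=
      Real.rpow_le_rpow_of_nonpos hs0 (by exact_mod_cast hlt.le) (by norm_num)
    have i2 : (d:ℝ) ^ (-(3/4):ℝ) ≤ (q:ℝ) ^ (-(3/2):ℝ) := by
      have : ((q:ℝ)^2) ^ (-(3/4):ℝ) = (q:ℝ) ^ (-(3/2):ℝ) := by
        rw [← Real.rpow_natCast, ← Real.rpow_mul hq0.le]; norm_num
      rw [← this]
      exact Real.rpow_le_rpow_of_nonpos (by positivity) (by exact_mod_cast hle2) (by norm_num)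
    rw [e]
    calc 2 * ((H:ℝ) * ((d:ℝ) ^ (-(1/4):ℝ) * (d:ℝ) ^ (-(3/4):ℝ))) ≤ 2 * ((H:ℝ) * ((s:ℝ) ^ (-(1/4):ℝ) * (q:ℝ) ^ (-(3/2):ℝ))) := by gcongr
      _ = _ := by ring
  refine (Finset.sum_le_sum h4).trans ?_
  rw [← Finset.mul_sum]
  have := hZ.sum_le_tsum (Finset.Icc 2 s) (fun n _ => by positivity)
  calc _ ≤ 2 * H * (s:ℝ) ^ (-(1/4):ℝ) * (∑' n : ℕ, (n:ℝ) ^ (-(3/2) : ℝ)) := by gcongr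
    _ = _ := by ring

lemma smooth_sum (Q : ℕ) : ∃ C : ℝ, 0 < C ∧ ∀ T : Finset ℕ, (∀ b ∈ T, b ∈ Nat.smoothNumbers Q) →
    ∑ b ∈ T, (b:ℝ) ^ (-(3/4):ℝ) ≤ C := by
  let f : ℕ →* ℝ :=
    { toFun := fun n => (n:ℝ) ^ (-(3/4):ℝ)
      map_one' := by norm_num
      map_mul' := fun a b => by push_cast; rw [Real.mul_rpow (by positivity) (by positivity)] }
  have hs := (EulerProduct.summable_and_hasSum_smoothNumbers_prod_primesBelow_geometric (f := f) (by
    intro p hp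
    show ‖(p:ℝ) ^ (-(3/4):ℝ)‖ < 1
    rw [Real.norm_of_nonneg (by positivity)]
    exact Real.rpow_lt_one_of_one_lt_of_neg (by exact_mod_cast hp.one_lt) (by norm_num)) Q).1
  refine ⟨∑' m : Nat.smoothNumbers Q, ‖f m‖ + 1, by positivity, ?_⟩
  intro T hT
  have := hs.sum_le_tsum (T.subtype (fun b => b ∈ Nat.smoothNumbers Q)) (fun n _ => by positivity)
  rw [Finset.sum_subtype_eq_sum_filter (f := fun b => ‖f b‖), Finset.filter_true_of_mem hT] at this
  have h2 : ∀ b ∈ T, (b:ℝ) ^ (-(3/4):ℝ) = ‖f b‖ := by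
    intro b _
    show _ = ‖(b:ℝ) ^ (-(3/4):ℝ)‖
    rw [Real.norm_of_nonneg (by positivity)]
  rw [Finset.sum_congr rfl h2]
  linarith

open scoped Classical in
lemma class_three (Q : ℕ) : ∃ C : ℝ, 0 < C ∧ ∀ M H s : ℕ, 2 ≤ s → s ^ 2 ≤ H → 
    (((Finset.Ioc M (M + H)).filter (fun m => ∃ b ∈ (Finset.Icc 1 (s ^ 2)).filter
      (fun b => b ∈ Nat.smoothNumbers Q ∧ s < b), b ∣ m)).card : ℝ) ≤
      C * H * (s:ℝ) ^ (-(1/4):ℝ) := by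
  obtain ⟨C, hC, hs⟩ := smooth_sum Q
  refine ⟨2 * C, by positivity, ?_⟩
  intro M H s hs2 hH
  set T := (Finset.Icc 1 (s ^ 2)).filter (fun b => b ∈ Nat.smoothNumbers Q ∧ s < b) with hT
  have h1 : ((Finset.Ioc M (M + H)).filter (fun m => ∃ b ∈ T, b ∣ m)) ⊆
      T.biUnion (fun b => (Finset.Ioc M (M + H)).filter (fun m => b ∣ m)) := by
    intro m hm
    simp only [Finset.mem_filter (s := Finset.Ioc M (M + H)), Finset.mem_biUnion] at hm ⊢
    obtain ⟨h1, q, h2, h3⟩ := hm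
    exact ⟨q, h2, h1, h3⟩
  have h2 := (Finset.card_le_card h1).trans Finset.card_biUnion_le
  have h3 : (((Finset.Ioc M (M + H)).filter (fun m => ∃ b ∈ T, b ∣ m)).card : ℝ) ≤
      ∑ b ∈ T, (((Finset.Ioc M (M + H)).filter (fun m => b ∣ m)).card : ℝ) := by
    exact_mod_cast h2
  refine le_trans (le_of_eq (by congr!)) (h3.trans ?_)
  have h4 : ∀ b ∈ T, (((Finset.Ioc M (M + H)).filter (fun m => b ∣ m)).card : ℝ) ≤
      2 * H * (s:ℝ) ^ (-(1/4):ℝ) * (b:ℝ) ^ (-(3/4) : ℝ) := by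
    intro d hd
    obtain ⟨hd1, _, hlt⟩ := Finset.mem_filter.1 hd
    obtain ⟨hd2, hd3⟩ := Finset.mem_Icc.1 hd1
    refine (count_dvd M H _ (by omega) (by omega)).trans ?_
    have hd0 : (0:ℝ) < d := by
      have : 0 < d := by omega
      exact_mod_cast this
    have hs0 : (0:ℝ) < s := by positivity
    have e : (H:ℝ) / d = H * ((d:ℝ) ^ (-(1/4):ℝ) * (d:ℝ) ^ (-(3/4):ℝ)) := by
      rw [← Real.rpow_add hd0]; norm_num [Real.rpow_neg_one]; rfl
    have i1 : (d:ℝ) ^ (-(1/4):ℝ) ≤ (s:ℝ) ^ (-(1/4):ℝ) :=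
      Real.rpow_le_rpow_of_nonpos hs0 (by exact_mod_cast hlt.le) (by norm_num)
    rw [e]
    calc 2 * ((H:ℝ) * ((d:ℝ) ^ (-(1/4):ℝ) * (d:ℝ) ^ (-(3/4):ℝ))) ≤ 2 * ((H:ℝ) * ((s:ℝ) ^ (-(1/4):ℝ) * (d:ℝ) ^ (-(3/4):ℝ))) := by gcongr
      _ = _ := by ring
  refine (Finset.sum_le_sum h4).trans ?_
  rw [← Finset.mul_sum]
  have := hs T (fun b hb => (Finset.mem_filter.1 hb).2.1)
  calc _ ≤ 2 * H * (s:ℝ) ^ (-(1/4):ℝ) * C := by gcongr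
    _ = _ := by ring

lemma memf {S : Finset ℕ} {p : ℕ → Prop} (i : DecidablePred p) {m : ℕ} :
    m ∈ @Finset.filter _ p i S ↔ m ∈ S ∧ p m := Finset.mem_filter

lemma sum_union_le' {F : ℕ → ℝ} (hF : ∀ n, 0 ≤ F n) (A B : Finset ℕ) :
    ∑ m ∈ A ∪ B, F m ≤ ∑ m ∈ A, F m + ∑ m ∈ B, F m := by
  rw [← Finset.sum_union_inter]
  have : 0 ≤ ∑ m ∈ A ∩ B, F m := Finset.sum_nonneg (fun n _ => hF n)
  linarith

lemma sum_biUnion_le' {F : ℕ → ℝ} (hF : ∀ n, 0 ≤ F n) (I : Finset ℕ) (A : ℕ → Finset ℕ) :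
    ∑ m ∈ I.biUnion A, F m ≤ ∑ i ∈ I, ∑ m ∈ A i, F m := by
  classical
  induction I using Finset.induction_on with
  | empty => simp
  | insert a s ha ih =>
    rw [Finset.biUnion_insert, Finset.sum_insert ha]
    exact (sum_union_le' hF _ _).trans (by linarith)

lemma MF.crude {F : ℕ → ℝ} {K B : ℝ} (h : MF F K B) (E : ℕ) :
    ∃ C : ℝ, 0 < C ∧ ∀ s m : ℕ, 2 ≤ s → 0 < m → m ≤ (s ^ 2) ^ E → F m ≤ C * (s:ℝ) ^ (1/4:ℝ) := by
  obtain ⟨C, hC, hF⟩ := h.eps (1 / (8 * (E + 1))) (by positivity)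
  refine ⟨C, by linarith, ?_⟩
  intro s m hs hm hmE
  refine (hF m (by omega)).trans ?_
  have hs1 : (1:ℝ) ≤ s := by exact_mod_cast (by omega : 1 ≤ s)
  gcongr
  calc (m:ℝ) ^ (1 / (8 * (E + 1)) : ℝ) ≤ ((s:ℝ) ^ (2 * E)) ^ (1 / (8 * (E + 1)) : ℝ) := by
        apply Real.rpow_le_rpow (by positivity) _ (by positivity)
        rw [pow_mul]; exact_mod_cast hmE
    _ = (s:ℝ) ^ (((2 * E : ℕ):ℝ) * (1 / (8 * (E + 1)) : ℝ)) := by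
        rw [← Real.rpow_natCast, ← Real.rpow_mul (by positivity)]
    _ ≤ _ := by
        apply Real.rpow_le_rpow_of_exponent_le hs1
        rw [mul_one_div, div_le_div_iff₀ (by positivity) (by norm_num)]
        push_cast
        have : (0:ℝ) ≤ E := by positivity
        linarith

open scoped Classical in
theorem shiu_core {F : ℕ → ℝ} {K B : ℝ} (h : MF F K B) (E : ℕ) :
    ∃ C : ℝ, 0 < C ∧ ∀ J M H : ℕ, 1 ≤ J → (2 ^ 2 ^ J) ^ 8 ≤ H → M + H ≤ (2 ^ 2 ^ J) ^ E → 2 ^ 2 ^ J ≤ M →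
      ∑ m ∈ Finset.Ioc M (M + H), F m ≤ C * H := by
  obtain ⟨C1, hC1, h1⟩ := class_one h E
  obtain ⟨C4, hC4, W0, h4⟩ := class_four h E
  obtain ⟨C3, hC3, h3⟩ := class_three (2 ^ 2 ^ W0)
  obtain ⟨C0, hC0, h0⟩ := h.crude E
  set Z := ∑' n : ℕ, (n:ℝ) ^ (-(3/2) : ℝ) with hZd
  have hZ : 0 ≤ Z := tsum_nonneg (fun n => by positivity)
  refine ⟨C1 + 2 * Z * C0 + C3 * C0 + C4 * 2, by positivity, ?_⟩
  intro J M H hJ hH hE hM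
  obtain ⟨J', rfl⟩ : ∃ J', J = J' + 1 := ⟨J - 1, by omega⟩
  set s := 2 ^ 2 ^ J' with hs
  have hz : 2 ^ 2 ^ (J' + 1) = s ^ 2 := by rw [hs, ← pow_mul, pow_succ]
  rw [hz] at hH hE hM
  have hs2 : 2 ≤ s := by
    calc 2 = 2 ^ 1 := by norm_num
      _ ≤ s := Nat.pow_le_pow_right (by norm_num) Nat.one_le_two_pow
  have hHs : s ^ 2 ≤ H := (Nat.le_self_pow (by norm_num) _).trans hH
  set S1 := (Finset.Ioc M (M + H)).filter (fun m => ∃ b ∈ Finset.Icc 1 (s ^ 2), ∃ c, m = b * c ∧ Nat.Coprime b c ∧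
      ∀ p, p.Prime → p ∣ c → s ≤ p) with hS1
  set S2 := ((Finset.Ioc M (M + H)).filter (fun m => ∃ q ∈ Finset.Icc 2 s, q ^ (Nat.log q s + 1) ∣ m)) with hS2
  set S3 := ((Finset.Ioc M (M + H)).filter (fun m => ∃ b ∈ (Finset.Icc 1 (s ^ 2)).filter
      (fun b => b ∈ Nat.smoothNumbers (2 ^ 2 ^ W0) ∧ s < b), b ∣ m)) with hS3
  set S4 : ℕ → Finset ℕ := fun j => (Finset.Ioc M (M + H)).filter (fun m => ∃ b ∈ (Finset.Icc 1 (2 ^ (4 * 2 ^ j * 2 ^ (J' - 1 - j)))).filter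
      (fun b => b ∈ Nat.smoothNumbers (2 ^ (2 * 2 ^ j)) ∧ 2 ^ (2 * 2 ^ j * 2 ^ (J' - 1 - j)) < b), ∃ c, m = b * c ∧ Nat.Coprime b c ∧
      ∀ p, p.Prime → p ∣ c → 2 ^ 2 ^ j ≤ p) with hS4
  have key : ∀ j < J', 2 * 2 ^ j * 2 ^ (J' - 1 - j) = 2 ^ J' := by
    intro j hj
    rw [← pow_succ', ← pow_add]; congr 1; omega
  have keyz : ∀ j < J', 2 ^ (4 * 2 ^ j * 2 ^ (J' - 1 - j)) = s ^ 2 := by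
    intro j hj
    rw [← hz]; congr 1
    rw [pow_succ, ← key j hj]; ring
  have cover : Finset.Ioc M (M + H) ⊆ ((S1 ∪ S2) ∪ S3) ∪ ((Finset.range J').filter (fun j => W0 ≤ j)).biUnion S4 := by
    intro m hm
    have hm' := Finset.mem_Ioc.1 hm
    obtain ⟨b, c, q, e, hco, hb1, hbz, hbs, hq, hc, a, ha, hza⟩ := shiu_decomp m (s ^ 2) (by nlinarith) (by omega)
    simp only [Finset.mem_union, Finset.mem_biUnion]
    by_cases hqs : s ≤ q
    · left; left; left
      refine (memf _).2 ?_
      exact ⟨hm, b, Finset.mem_Icc.2 ⟨hb1, hbz⟩, c, e, hco, fun p hp hpc => hqs.trans (hc p hp hpc)⟩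
    push Not at hqs
    by_cases hbs' : b ≤ s
    · left; left; right
      rw [hS2, Finset.mem_filter]
      refine ⟨hm, q, Finset.mem_Icc.2 ⟨hq.two_le, hqs.le⟩, ?_⟩
      have hlt : s < q ^ a := by
        by_contra hcon
        push Not at hcon
        have := Nat.mul_le_mul hbs' hcon
        nlinarith
      have hla : Nat.log q s < a := Nat.log_lt_of_lt_pow (by omega) hlt
      rw [e]
      exact ((pow_dvd_pow q hla).trans ha).trans (dvd_mul_left _ _)
    push Not at hbs'
    by_cases hqQ : q < 2 ^ 2 ^ W0
    · left; right
      refine (memf _).2 ?_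
      refine ⟨hm, b, ?_, by rw [e]; exact dvd_mul_right _ _⟩
      rw [Finset.mem_filter]
      exact ⟨Finset.mem_Icc.2 ⟨hb1, hbz⟩, Nat.smoothNumbers_mono hqQ.le hbs, hbs'⟩
    push Not at hqQ
    right
    set j := Nat.log 2 (Nat.log 2 q) with hj
    have hl1 : 1 ≤ Nat.log 2 q := Nat.log_pos (by norm_num) hq.two_le
    have hj1 : 2 ^ j ≤ Nat.log 2 q := Nat.pow_log_le_self 2 (by omega)
    have hj2 : Nat.log 2 q < 2 ^ (j + 1) := Nat.lt_pow_succ_log_self (by norm_num) _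
    have hq1 : 2 ^ 2 ^ j ≤ q := (Nat.pow_le_pow_right (by norm_num) hj1).trans (Nat.pow_log_le_self 2 hq.ne_zero)
    have hq2 : q < 2 ^ 2 ^ (j + 1) := (Nat.lt_pow_succ_log_self (by norm_num) q).trans_le
      (Nat.pow_le_pow_right (by norm_num) hj2)
    have hjJ : j < J' := by
      have := hq1.trans_lt hqs
      rw [hs] at this
      exact (Nat.pow_lt_pow_iff_right (by norm_num)).1 ((Nat.pow_lt_pow_iff_right (by norm_num)).1 this)
    have hjW : W0 ≤ j := by
      have := hqQ.trans_lt hq2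
      have := (Nat.pow_lt_pow_iff_right (by norm_num)).1 ((Nat.pow_lt_pow_iff_right (by norm_num)).1 this)
      omega
    refine ⟨j, Finset.mem_filter.2 ⟨Finset.mem_range.2 hjJ, hjW⟩, ?_⟩
    rw [hS4, Finset.mem_filter]
    refine ⟨hm, b, ?_, c, e, hco, fun p hp hpc => hq1.trans (hc p hp hpc)⟩
    rw [keyz j hjJ, key j hjJ, Finset.mem_filter]
    refine ⟨Finset.mem_Icc.2 ⟨hb1, hbz⟩, Nat.smoothNumbers_mono ?_ hbs, hbs'⟩
    rw [← pow_succ']; exact hq2.le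
  have hsum := Finset.sum_le_sum_of_subset_of_nonneg (f := F) cover (fun n _ _ => h.nonneg n)
  have hu1 := sum_union_le' h.nonneg ((S1 ∪ S2) ∪ S3) (((Finset.range J').filter (fun j => W0 ≤ j)).biUnion S4)
  have hu2 := sum_union_le' h.nonneg (S1 ∪ S2) S3
  have hu3 := sum_union_le' h.nonneg S1 S2
  have hu4 := sum_biUnion_le' h.nonneg ((Finset.range J').filter (fun j => W0 ≤ j)) S4
  have b1 : ∑ m ∈ S1, F m ≤ C1 * H := by
    refine le_trans (le_of_eq (by congr!)) (h1 M H s hs2 hH hE)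
  have hsr : (0:ℝ) < s := by positivity
  have hss : (s:ℝ) ^ (-(1/4):ℝ) * (s:ℝ) ^ (1/4:ℝ) = 1 := by
    rw [← Real.rpow_add hsr]; norm_num
  have crude : ∀ S ⊆ Finset.Ioc M (M + H), ∀ D : ℝ, (S.card : ℝ) ≤ D * H * (s:ℝ) ^ (-(1/4):ℝ) →
      ∑ m ∈ S, F m ≤ D * C0 * H := by
    intro S hS D hD
    calc ∑ m ∈ S, F m ≤ ∑ m ∈ S, C0 * (s:ℝ) ^ (1/4:ℝ) := by
          apply Finset.sum_le_sum
          intro m hm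
          have := Finset.mem_Ioc.1 (hS hm)
          exact h0 s m hs2 (by omega) (by omega)
      _ = S.card * (C0 * (s:ℝ) ^ (1/4:ℝ)) := by rw [Finset.sum_const, nsmul_eq_mul]
      _ ≤ (D * H * (s:ℝ) ^ (-(1/4):ℝ)) * (C0 * (s:ℝ) ^ (1/4:ℝ)) := by gcongr
      _ = D * C0 * H * ((s:ℝ) ^ (-(1/4):ℝ) * (s:ℝ) ^ (1/4:ℝ)) := by ring
      _ = _ := by rw [hss, mul_one]
  have b2 : ∑ m ∈ S2, F m ≤ 2 * Z * C0 * H := crude S2 (Finset.filter_subset _ _) _ (by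
    refine le_trans (le_of_eq (by congr!)) (class_two M H s hs2 hHs))
  have b3 : ∑ m ∈ S3, F m ≤ C3 * C0 * H := crude S3 (fun x hx => ((memf _).1 hx).1) _ (by
    refine le_trans (le_of_eq (by congr!)) (h3 M H s hs2 hHs))
  have b4 : ∑ j ∈ (Finset.range J').filter (fun j => W0 ≤ j), ∑ m ∈ S4 j, F m ≤ C4 * 2 * H := by
    calc _ ≤ ∑ j ∈ (Finset.range J').filter (fun j => W0 ≤ j), C4 * H * (1/2:ℝ) ^ (J' - 1 - j) := by
          apply Finset.sum_le_sum
          intro j hj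
          obtain ⟨hj1, hj2⟩ := Finset.mem_filter.1 hj
          have hj1 := Finset.mem_range.1 hj1
          have := h4 M H (2 ^ j) (2 ^ (J' - 1 - j)) (hj2.trans (Nat.lt_two_pow_self).le) Nat.one_le_two_pow
            Nat.one_le_two_pow (by rw [keyz j hj1]; exact hH) (by rw [keyz j hj1]; exact hE)
          refine le_trans (le_of_eq (by rw [hS4]; congr!)) (this.trans ?_)
          gcongr ?_ * ?_
          exact pow_le_pow_of_le_one (by norm_num) (by norm_num) (Nat.lt_two_pow_self).le
      _ ≤ ∑ j ∈ Finset.range J', C4 * H * (1/2:ℝ) ^ (J' - 1 - j) := by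
          apply Finset.sum_le_sum_of_subset_of_nonneg (Finset.filter_subset _ _)
          intros; positivity
      _ = C4 * H * ∑ j ∈ Finset.range J', (1/2:ℝ) ^ j := by
          rw [← Finset.mul_sum, Finset.sum_range_reflect (fun j => (1/2:ℝ) ^ j)]
      _ ≤ C4 * H * 2 := by
          gcongr
          have := Summable.sum_le_tsum (Finset.range J') (fun n _ => by positivity) summable_geometric_two
          rwa [tsum_geometric_two] at this
      _ = _ := by ring
  linarith

theorem shiu_interval {F : ℕ → ℝ} {K B : ℝ} (h : MF F K B) (n : ℕ) :
    ∃ C : ℝ, 0 < C ∧ ∀ M H : ℕ, 2 ^ 16 ≤ H → H ≤ M → M ≤ H ^ n →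
      ∑ m ∈ Finset.Ioc M (M + H), F m ≤ C * H := by
  obtain ⟨C, hC, hs⟩ := shiu_core h (16 * n + 1)
  refine ⟨C, hC, ?_⟩
  intro M H h16 hHM hMH
  set l := Nat.log 2 H with hl
  have hl16 : 16 ≤ l := by
    rw [hl]; exact (Nat.le_log_iff_pow_le (by norm_num) (by omega)).2 h16
  set L := Nat.log 2 l with hL
  have hL4 : 4 ≤ L := by
    rw [hL]; exact (Nat.le_log_iff_pow_le (by norm_num) (by omega)).2 (by omega)
  obtain ⟨J, hJ⟩ : ∃ J, L = J + 3 := ⟨L - 3, by omega⟩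
  have e1 : 2 ^ L ≤ l := Nat.pow_log_le_self 2 (by omega)
  have e2 : l < 2 ^ (L + 1) := Nat.lt_pow_succ_log_self (by norm_num) _
  have f1 : 2 ^ l ≤ H := Nat.pow_log_le_self 2 (by omega)
  have f2 : H < 2 ^ (l + 1) := Nat.lt_pow_succ_log_self (by norm_num) _
  set z := 2 ^ 2 ^ J with hz
  have z2 : 2 ≤ z := by
    calc 2 = 2 ^ 1 := by norm_num
      _ ≤ z := Nat.pow_le_pow_right (by norm_num) Nat.one_le_two_pow
  have g1 : z ^ 8 ≤ H := by
    refine le_trans ?_ f1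
    rw [hz, ← pow_mul]
    apply Nat.pow_le_pow_right (by norm_num)
    rw [hJ, pow_add] at e1; omega
  have g2 : H ≤ z ^ 16 := by
    refine f2.le.trans ?_
    rw [hz, ← pow_mul]
    apply Nat.pow_le_pow_right (by norm_num)
    rw [hJ, pow_add, pow_add] at e2; omega
  refine hs J M H (by omega) g1 ?_ ?_
  · rw [pow_succ, pow_mul]
    calc M + H ≤ M * 2 := by omega
      _ ≤ (z ^ 16) ^ n * z := Nat.mul_le_mul (hMH.trans (Nat.pow_le_pow_left g2 n)) z2
  · exact ((Nat.le_self_pow (by norm_num) z).trans g1).trans hHM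

/-- number of square roots of `-D` modulo `n` -/
def rho (D n : ℕ) : ℕ := ((Finset.range n).filter (fun v => n ∣ v ^ 2 + D)).card

lemma rho_zero (D : ℕ) : rho D 0 = 0 := by simp [rho]
lemma rho_one (D : ℕ) : rho D 1 = 1 := by simp [rho]

lemma dvd_mod_iff (D m v : ℕ) : m ∣ (v % m) ^ 2 + D ↔ m ∣ v ^ 2 + D :=
  (((Nat.mod_modEq v m).pow 2).add_right D).dvd_iff dvd_rfl

lemma rho_mul (D m n : ℕ) (hmn : Nat.Coprime m n) : rho D (m * n) = rho D m * rho D n := by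
  rcases Nat.eq_zero_or_pos m with rfl | hm
  · simp [rho_zero]
  rcases Nat.eq_zero_or_pos n with rfl | hn
  · simp [rho_zero]
  unfold rho
  rw [← Finset.card_product]
  apply Finset.card_bij (fun v _ => (v % m, v % n))
  · intro v hv
    simp only [Finset.mem_filter, Finset.mem_product, Finset.mem_range] at hv ⊢
    exact ⟨⟨Nat.mod_lt _ hm, (dvd_mod_iff D m v).2 ((dvd_mul_right _ _).trans hv.2)⟩,
      ⟨Nat.mod_lt _ hn, (dvd_mod_iff D n v).2 ((dvd_mul_left _ _).trans hv.2)⟩⟩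
  · intro a ha b hb hab
    simp only [Finset.mem_filter, Finset.mem_range, Prod.mk.injEq] at ha hb hab
    have := (Nat.modEq_and_modEq_iff_modEq_mul hmn).1 hab
    exact this.eq_of_lt_of_lt ha.1 hb.1
  · rintro ⟨a, b⟩ hab
    simp only [Finset.mem_filter, Finset.mem_product, Finset.mem_range] at hab
    obtain ⟨⟨ha, ha2⟩, ⟨hb, hb2⟩⟩ := hab
    obtain ⟨c, hc1, hc2⟩ := Nat.chineseRemainder hmn a b
    have k1 : c % (m * n) % m = a := by
      rw [Nat.mod_mul_right_mod, hc1, Nat.mod_eq_of_lt ha]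
    have k2 : c % (m * n) % n = b := by
      rw [Nat.mod_mul_left_mod, hc2, Nat.mod_eq_of_lt hb]
    refine ⟨c % (m * n), ?_, by rw [k1, k2]⟩
    simp only [Finset.mem_filter, Finset.mem_range]
    refine ⟨Nat.mod_lt _ (by positivity), hmn.mul_dvd_of_dvd_of_dvd ?_ ?_⟩
    · rw [← dvd_mod_iff, k1]; exact ha2
    · rw [← dvd_mod_iff, k2]; exact hb2

lemma rho_prime (D p : ℕ) (hp : p.Prime) : rho D p ≤ 2 := by
  unfold rho
  rcases Finset.eq_empty_or_nonempty ((Finset.range p).filter (fun v => p ∣ v ^ 2 + D)) with h | ⟨x, hx⟩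
  · rw [h]; simp
  · simp only [Finset.mem_filter, Finset.mem_range] at hx
    have : ((Finset.range p).filter (fun v => p ∣ v ^ 2 + D)) ⊆ {x, (p - x) % p} := by
      intro y hy
      simp only [Finset.mem_filter, Finset.mem_range, Finset.mem_insert, Finset.mem_singleton] at hy ⊢
      have h1 : (p:ℤ) ∣ ((x:ℤ) - y) * (x + y) := by
        have a1 : (p:ℤ) ∣ (x:ℤ) ^ 2 + D := by exact_mod_cast hx.2
        have a2 : (p:ℤ) ∣ (y:ℤ) ^ 2 + D := by exact_mod_cast hy.2
        have := Int.dvd_sub a1 a2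
        convert this using 1; ring
      rcases (Nat.prime_iff_prime_int.1 hp).dvd_or_dvd h1 with h2 | h2
      · left
        obtain ⟨c, hc⟩ := h2
        have hc0 : c = 0 := by
          have hx1 := hx.1
          have hy1 := hy.1
          have hp0 := hp.pos
          by_contra hne
          rcases lt_or_gt_of_ne hne with h | h
          · have : (p:ℤ) * c ≤ -p := by nlinarith
            omega
          · have : (p:ℤ) * c ≥ p := by nlinarith
            omega
        subst hc0
        omega
      · right
        have h3 : p ∣ x + y := by exact_mod_cast h2
        have : y ≡ p - x [MOD p] := by
          apply Nat.ModEq.add_left_cancel' x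
          rw [Nat.add_sub_cancel' hx.1.le]
          rw [Nat.ModEq, Nat.mod_self]; exact Nat.mod_eq_zero_of_dvd h3
        rw [← this, Nat.mod_eq_of_lt hy.1]
    exact (Finset.card_le_card this).trans Finset.card_le_two

lemma count_class (p b e c : ℕ) (hp : 0 < p) :
    ((Finset.range (p ^ b)).filter (fun y : ℕ => ((p ^ (b - e) : ℕ) : ℤ) ∣ (c:ℤ) - y)).card ≤ p ^ e := by
  have hcard : (Finset.range (p ^ e)).card = p ^ e := Finset.card_range _
  rw [← hcard]
  have hq : 0 < p ^ (b - e) := by positivity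
  apply Finset.card_le_card_of_injOn (fun y => y / p ^ (b - e))
  · intro y hy
    simp only [Finset.coe_filter, Finset.mem_range, Set.mem_ofPred_eq, Finset.coe_range, Set.mem_Iio] at hy ⊢
    rw [Nat.div_lt_iff_lt_mul hq, ← pow_add]
    exact hy.1.trans_le (Nat.pow_le_pow_right hp (by omega))
  · intro y hy y' hy' hyy
    simp only [Finset.coe_filter, Finset.mem_range, Set.mem_ofPred_eq] at hy hy' hyy
    have h1 : (y:ℤ) ≡ y' [ZMOD ((p ^ (b - e) : ℕ) : ℤ)] := by
      rw [Int.modEq_iff_dvd]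
      have := Int.dvd_sub hy.2 hy'.2
      convert this using 1; ring
    have h2 : y % p ^ (b - e) = y' % p ^ (b - e) := (Int.natCast_modEq_iff.1 h1)
    rw [← Nat.div_add_mod y (p ^ (b - e)), ← Nat.div_add_mod y' (p ^ (b - e)), hyy, h2]

lemma prime_pow_split {p : ℤ} (hp : Prime p) {i : ℕ} {u v : ℤ} (hu : ¬ p ^ (i + 1) ∣ u) (j : ℕ)
    (h : p ^ (i + j) ∣ u * v) : p ^ j ∣ v := by
  classical
  have hex : ∃ k, ¬ p ^ (k + 1) ∣ u := ⟨i, hu⟩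
  set k := Nat.find hex with hk
  have hk1 : ¬ p ^ (k + 1) ∣ u := Nat.find_spec hex
  have hki : k ≤ i := Nat.find_min' hex hu
  have hk2 : p ^ k ∣ u := by
    rcases Nat.eq_zero_or_pos k with h0 | h0
    · rw [h0]; simp
    · have := Nat.find_min hex (m := k - 1) (by omega)
      rw [not_not, Nat.sub_add_cancel h0] at this
      exact this
  induction j with
  | zero => simp
  | succ j ih =>
    have h1 := ih ((pow_dvd_pow p (by omega)).trans h)
    exact (succ_dvd_or_succ_dvd_of_succ_sum_dvd_mul hp hk2 h1
      ((pow_dvd_pow p (by omega)).trans h)).resolve_left hk1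

lemma rho_pp (D p a : ℕ) (hD : 1 ≤ D) (hp : p.Prime) : rho D (p ^ a) ≤ 8 * D := by
  unfold rho
  rcases Finset.eq_empty_or_nonempty ((Finset.range (p ^ a)).filter (fun v => p ^ a ∣ v ^ 2 + D)) with h | ⟨x, hx⟩
  · rw [h]; simp
  simp only [Finset.mem_filter, Finset.mem_range] at hx
  set e := (4 * D).factorization p with he
  have hpe : p ^ e ≤ 4 * D := Nat.le_of_dvd (by omega) (Nat.ordProj_dvd _ _)
  have hne : ¬ p ^ (e + 1) ∣ 4 * D := Nat.pow_succ_factorization_not_dvd (by omega) hp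
  have hsub : ((Finset.range (p ^ a)).filter (fun v => p ^ a ∣ v ^ 2 + D)) ⊆
     ((Finset.range (p ^ a)).filter (fun y : ℕ => ((p ^ (a - e) : ℕ) : ℤ) ∣ (x:ℤ) - y)) ∪
     ((Finset.range (p ^ a)).filter (fun y : ℕ => ((p ^ (a - e) : ℕ) : ℤ) ∣ (((p ^ a - x : ℕ)):ℤ) - y)) := by
    intro y hy
    simp only [Finset.mem_filter, Finset.mem_range, Finset.mem_union] at hy ⊢
    by_contra hcon
    push Not at hcon
    have n1 := hcon.1 hy.1
    have n2 := hcon.2 hy.1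
    have n2' : ¬ ((p ^ (a - e) : ℕ) : ℤ) ∣ (x:ℤ) + y := by
      intro hd
      apply n2
      rw [Nat.cast_sub hx.1.le]
      have h3 : ((p ^ (a - e) : ℕ) : ℤ) ∣ ((p ^ a : ℕ) : ℤ) := by
        exact_mod_cast pow_dvd_pow p (Nat.sub_le a e)
      have := Int.dvd_sub h3 hd
      convert this using 1; ring
    have hea : e < a := by
      by_contra hh
      apply n1
      rw [Nat.sub_eq_zero_of_le (by omega)]; simp
    have a1 : (p:ℤ) ^ a ∣ (x:ℤ) ^ 2 + D := by exact_mod_cast hx.2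
    have a2 : (p:ℤ) ^ a ∣ (y:ℤ) ^ 2 + D := by exact_mod_cast hy.2
    have h1 : (p:ℤ) ^ a ∣ ((x:ℤ) - y) * (x + y) := by
      have := Int.dvd_sub a1 a2
      convert this using 1; ring
    have hpp := Nat.prime_iff_prime_int.1 hp
    push_cast at n1 n2'
    have m1 : (p:ℤ) ^ (e + 1) ∣ (x:ℤ) - y := by
      refine prime_pow_split hpp (i := a - e - 1) (u := (x:ℤ) + y) ?_ (e + 1) ?_
      · rwa [show a - e - 1 + 1 = a - e by omega]
      · rw [show a - e - 1 + (e + 1) = a by omega, mul_comm]; exact h1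
    have m2 : (p:ℤ) ^ (e + 1) ∣ (x:ℤ) + y := by
      refine prime_pow_split hpp (i := a - e - 1) (u := (x:ℤ) - y) ?_ (e + 1) ?_
      · rwa [show a - e - 1 + 1 = a - e by omega]
      · rw [show a - e - 1 + (e + 1) = a by omega]; exact h1
    have m3 : (p:ℤ) ^ (e + 1) ∣ 2 * x := by
      have := Int.dvd_add m1 m2
      convert this using 1; ring
    have m4 : (p:ℤ) ^ (e + 1) ∣ 4 * D := by
      have t1 : (p:ℤ) ^ (e + 1) ∣ 4 * ((x:ℤ) ^ 2 + D) := ((pow_dvd_pow _ hea).trans a1).mul_left 4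
      have t2 : (p:ℤ) ^ (e + 1) ∣ (2 * x) * (2 * x) := m3.mul_right _
      have := Int.dvd_sub t1 t2
      convert this using 1; ring
    exact hne (by exact_mod_cast m4)
  calc _ ≤ _ := Finset.card_le_card hsub
    _ ≤ _ := Finset.card_union_le _ _
    _ ≤ p ^ e + p ^ e := Nat.add_le_add (count_class p a e _ hp.pos) (count_class p a e _ hp.pos)
    _ ≤ _ := by omega

lemma thue (n v : ℕ) (hn : 1 ≤ n) : ∃ X Y : ℤ, (X, Y) ≠ (0, 0) ∧ |X| ≤ Nat.sqrt n ∧ |Y| ≤ Nat.sqrt n ∧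
    (n:ℤ) ∣ X - v * Y := by
  set r := Nat.sqrt n with hr
  have hlt : n < (r + 1) * (r + 1) := Nat.lt_succ_sqrt n
  have hcard : (Finset.range n).card < (Finset.range (r + 1) ×ˢ Finset.range (r + 1)).card := by
    rw [Finset.card_product]; simpa using hlt
  obtain ⟨⟨a, b⟩, hab, ⟨c, d⟩, hcd, hne, heq⟩ := Finset.exists_ne_map_eq_of_card_lt_of_maps_to hcard
    (f := fun w : ℕ × ℕ => (((w.1:ℤ) - v * w.2) % n).toNat) (by
      intro w hw
      simp only [Finset.coe_range, Set.mem_Iio]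
      have h1 := Int.emod_nonneg ((w.1:ℤ) - v * w.2) (by omega : (n:ℤ) ≠ 0)
      have h2 := Int.emod_lt_of_pos ((w.1:ℤ) - v * w.2) (by omega : (0:ℤ) < n)
      omega)
  simp only [Finset.mem_product, Finset.mem_range] at hab hcd heq
  refine ⟨(a:ℤ) - c, (b:ℤ) - d, ?_, ?_, ?_, ?_⟩
  · intro h
    apply hne
    simp only [Prod.mk.injEq] at h ⊢
    omega
  · rw [abs_le]; omega
  · rw [abs_le]; omega
  · have h1 := Int.emod_nonneg ((a:ℤ) - v * b) (by omega : (n:ℤ) ≠ 0)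
    have h2 := Int.emod_nonneg ((c:ℤ) - v * d) (by omega : (n:ℤ) ≠ 0)
    have h3 : ((a:ℤ) - v * b) % n = ((c:ℤ) - v * d) % n := by omega
    have h4 := Int.ModEq.dvd (show ((c:ℤ) - v * d) ≡ ((a:ℤ) - v * b) [ZMOD n] from h3.symm)
    convert h4 using 1; ring

lemma rho_avg (D : ℕ) (hD : 1 ≤ D) (N : ℕ) :
    ∑ n ∈ Finset.Icc 1 N, rho D n ≤ 9 * (D + 2) ^ 2 * N := by
  have hT : ∀ n v : ℕ, ∃ X Y : ℤ, 1 ≤ n → (X, Y) ≠ (0, 0) ∧ |X| ≤ Nat.sqrt n ∧ |Y| ≤ Nat.sqrt n ∧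
    (n:ℤ) ∣ X - v * Y := by
    intro n v
    by_cases hn : 1 ≤ n
    · obtain ⟨X, Y, h⟩ := thue n v hn
      exact ⟨X, Y, fun _ => h⟩
    · exact ⟨0, 0, fun h => absurd h hn⟩
  choose X Y hXY using hT
  set r := Nat.sqrt N with hr
  rcases Nat.eq_zero_or_pos N with rfl | hN
  · simp
  have hr1 : 1 ≤ r := Nat.sqrt_pos.2 hN
  have hrN : r * r ≤ N := Nat.sqrt_le N
  set S := (Finset.Icc 1 N).sigma (fun n => (Finset.range n).filter (fun v => n ∣ v ^ 2 + D)) with hS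
  have hSc : ∑ n ∈ Finset.Icc 1 N, rho D n = S.card := by
    rw [hS, Finset.card_sigma]; rfl
  set Bx := (Finset.Icc (-(r:ℤ)) r ×ˢ Finset.Icc (-(r:ℤ)) r) ×ˢ (Finset.range (D + 2) ×ˢ Finset.range (D + 1)) with hBx
  have key : ∀ n v : ℕ, 1 ≤ n → n ∣ v ^ 2 + D → ∃ j : ℕ, (X n v) ^ 2 + D * (Y n v) ^ 2 = j * n ∧ 1 ≤ j ∧ j ≤ D + 1
      ∧ Int.gcd (Y n v) n ≤ D + 1 := by
    intro n v hn hv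
    obtain ⟨h1, h2, h3, h4⟩ := hXY n v hn
    set x := X n v
    set y := Y n v
    have hnZ : (0:ℤ) < n := by omega
    have hsq : (Nat.sqrt n : ℤ) ^ 2 ≤ n := by
      have := Nat.sqrt_le' n
      exact_mod_cast this
    have hx2 : x ^ 2 ≤ n := by
      rw [← sq_abs]; nlinarith [abs_nonneg x]
    have hy2 : y ^ 2 ≤ n := by
      rw [← sq_abs]; nlinarith [abs_nonneg y]
    have hDZ : (1:ℤ) ≤ D := by exact_mod_cast hD
    have hpos : 0 < x ^ 2 + D * y ^ 2 := by
      by_contra hc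
      have hx0 : x ^ 2 = 0 := by nlinarith [sq_nonneg x, sq_nonneg y]
      have hy0 : y ^ 2 = 0 := by nlinarith [sq_nonneg x, sq_nonneg y]
      apply h1
      rw [pow_eq_zero_iff (by norm_num)] at hx0 hy0
      rw [hx0, hy0]
    have hle : x ^ 2 + D * y ^ 2 ≤ (D + 1) * n := by nlinarith
    have hvZ : (n:ℤ) ∣ (v:ℤ) ^ 2 + D := by exact_mod_cast hv
    have hdvd : ∀ (n' x' y' : ℤ), n' ∣ x' - v * y' → n' ∣ (v:ℤ) ^ 2 + D → n' ∣ x' ^ 2 + D * y' ^ 2 := by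
      intro n' x' y' ha hb
      have t := Int.dvd_add (Dvd.dvd.mul_right ha (x' + v * y')) (Dvd.dvd.mul_right hb (y' ^ 2))
      have e : x' ^ 2 + D * y' ^ 2 = (x' - v * y') * (x' + v * y') + ((v:ℤ) ^ 2 + D) * y' ^ 2 := by ring
      rw [e]; exact t
    obtain ⟨j, hj⟩ := hdvd n x y h4 hvZ
    have hj0 : 0 < j := by
      by_contra hc
      push Not at hc
      nlinarith
    have hjD : j ≤ D + 1 := by
      by_contra hc
      push Not at hc
      nlinarith
    refine ⟨j.toNat, ?_, by omega, by omega, ?_⟩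
    · rw [hj, Int.toNat_of_nonneg hj0.le]; ring
    · set e := Int.gcd y n with he
      have he0 : 0 < e := Int.gcd_pos_of_ne_zero_right _ (by omega)
      obtain ⟨y', hy'⟩ : (e:ℤ) ∣ y := Int.gcd_dvd_left ..
      obtain ⟨n', hn'⟩ : (e:ℤ) ∣ n := Int.gcd_dvd_right ..
      obtain ⟨x', hx'⟩ : (e:ℤ) ∣ x := by
        have t1 : (e:ℤ) ∣ x - v * y := (Dvd.intro _ hn'.symm).trans h4
        have t2 : (e:ℤ) ∣ v * y := Dvd.dvd.mul_left ⟨y', hy'⟩ _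
        have := Int.dvd_add t1 t2
        simpa using this
      have heZ : (0:ℤ) < e := by exact_mod_cast he0
      have hn'0 : 0 < n' := by
        by_contra hc
        push Not at hc
        nlinarith
      have q1 : n' ∣ x' - v * y' := by
        rw [hx', hy', hn'] at h4
        have : (e:ℤ) * n' ∣ e * (x' - v * y') := by
          convert h4 using 1; ring
        exact (mul_dvd_mul_iff_left heZ.ne').1 this
      have q2 := hdvd n' x' y' q1 ((Dvd.intro_left _ hn'.symm).trans hvZ)
      have q3 : 0 < x' ^ 2 + D * y' ^ 2 := by
        rw [hx', hy'] at hpos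
        have : (e:ℤ) ^ 2 * (x' ^ 2 + D * y' ^ 2) > 0 := by nlinarith
        exact (mul_pos_iff_of_pos_left (by positivity)).1 this
      have q4 := Int.le_of_dvd q3 q2
      have q5 : (e:ℤ) * n ≤ (D + 1) * n := by
        calc (e:ℤ) * n = e ^ 2 * n' := by rw [hn']; ring
          _ ≤ e ^ 2 * (x' ^ 2 + D * y' ^ 2) := by gcongr
          _ = x ^ 2 + D * y ^ 2 := by rw [hx', hy']; ring
          _ ≤ _ := hle
      have := le_of_mul_le_mul_right q5 hnZ
      exact_mod_cast this
  have hinj : S.card ≤ Bx.card := by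
    apply Finset.card_le_card_of_injOn (fun w => ((X w.1 w.2, Y w.1 w.2),
      ((((X w.1 w.2) ^ 2 + D * (Y w.1 w.2) ^ 2) / w.1).toNat, w.2 / (w.1 / Int.gcd (Y w.1 w.2) w.1))))
    · rintro ⟨n, v⟩ hw
      simp only [hS, Finset.coe_sigma, Set.mem_sigma_iff, Finset.coe_Icc, Set.mem_Icc, Finset.coe_filter, Finset.mem_range, Set.mem_ofPred_eq] at hw
      obtain ⟨⟨hn, hnN⟩, hvn, hv⟩ := hw
      obtain ⟨j, hj, hj1, hjD, hg⟩ := key n v hn hv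
      obtain ⟨h1, h2, h3, h4⟩ := hXY n v hn
      have hsr : (Nat.sqrt n : ℤ) ≤ r := by exact_mod_cast Nat.sqrt_le_sqrt hnN
      have h2' := abs_le.1 (h2.trans hsr)
      have h3' := abs_le.1 (h3.trans hsr)
      simp only [hBx, Finset.coe_product, Set.mem_prod, Finset.coe_Icc, Set.mem_Icc, Finset.coe_range, Set.mem_Iio]
      refine ⟨⟨h2', h3'⟩, ?_, ?_⟩
      · rw [hj, Int.mul_ediv_cancel _ (by omega)]; omega
      · set e := Int.gcd (Y n v) n with he
        have he0 : 0 < e := Int.gcd_pos_of_ne_zero_right _ (by omega)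
        have hen : e ∣ n := by
          have : (e:ℤ) ∣ n := Int.gcd_dvd_right ..
          exact_mod_cast this
        obtain ⟨n', hn'⟩ := hen
        have hn'0 : 0 < n' := Nat.pos_of_ne_zero (by rintro rfl; omega)
        have : n / e = n' := by rw [hn']; exact Nat.mul_div_cancel_left _ he0
        rw [this, Nat.div_lt_iff_lt_mul hn'0]
        calc v < n := hvn
          _ = e * n' := hn'
          _ ≤ _ := Nat.mul_le_mul_right _ hg
    · rintro ⟨n, v⟩ hw ⟨n2, v2⟩ hw2 heq
      simp only [hS, Finset.coe_sigma, Set.mem_sigma_iff, Finset.coe_Icc, Set.mem_Icc, Finset.coe_filter, Finset.mem_range, Set.mem_ofPred_eq] at hw hw2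
      obtain ⟨⟨hn, hnN⟩, hvn, hv⟩ := hw
      obtain ⟨⟨hn2, hnN2⟩, hvn2, hv2⟩ := hw2
      obtain ⟨j, hj, hj1, hjD, hg⟩ := key n v hn hv
      obtain ⟨j2, hj2, hj12, hjD2, hg2⟩ := key n2 v2 hn2 hv2
      obtain ⟨h1, h2, h3, h4⟩ := hXY n v hn
      obtain ⟨_, _, _, h42⟩ := hXY n2 v2 hn2
      simp only [Prod.mk.injEq] at heq
      obtain ⟨⟨eX, eY⟩, ej, ed⟩ := heq
      rw [hj, hj2, Int.mul_ediv_cancel _ (by omega), Int.mul_ediv_cancel _ (by omega)] at ej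
      have ejj : j = j2 := by omega
      have en : n = n2 := by
        rw [← eX, ← eY, hj, ← ejj] at hj2
        have hj0 : (j:ℤ) ≠ 0 := by omega
        exact_mod_cast mul_left_cancel₀ hj0 hj2
      subst en
      rw [← eX, ← eY] at h42
      rw [← eY] at ed
      set y := Y n v
      set e := Int.gcd y n with he
      have he0 : 0 < e := Int.gcd_pos_of_ne_zero_right _ (by omega)
      have hmod : (v:ℤ) ≡ v2 [ZMOD ((n / e : ℕ) : ℤ)] := by
        have t1 : (n:ℤ) ∣ ((v2:ℤ) - v) * y := by
          have := Int.dvd_sub h4 h42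
          convert this using 1; ring
        rw [Int.modEq_iff_dvd]
        have hd : (e:ℤ) ∣ n := Int.gcd_dvd_right ..
        have hdy : (e:ℤ) ∣ y := Int.gcd_dvd_left ..
        obtain ⟨n', hn'⟩ := hd
        obtain ⟨y', hy'⟩ := hdy
        have heZ : (e:ℤ) ≠ 0 := by exact_mod_cast he0.ne'
        have hcop : IsCoprime n' y' := by
          rw [Int.isCoprime_iff_gcd_eq_one]
          have : Int.gcd ((e:ℤ) * y') (e * n') = e := by rw [← hn', ← hy']
          rw [Int.gcd_mul_left] at this
          have h5 : e * Int.gcd y' n' = e * 1 := by simpa using this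
          rw [Int.gcd_comm]
          exact Nat.eq_of_mul_eq_mul_left he0 h5
        have e3 : ((n / e : ℕ) : ℤ) = n' := by
          rw [Int.natCast_div, hn']; exact Int.mul_ediv_cancel_left _ heZ
        rw [e3]
        have : (e:ℤ) * n' ∣ e * ((v2 - v) * y') := by
          rw [hn', hy'] at t1
          convert t1 using 1; ring
        exact hcop.dvd_of_dvd_mul_right ((mul_dvd_mul_iff_left heZ).1 this)
      have hmod' : v % (n / e) = v2 % (n / e) := Int.natCast_modEq_iff.1 hmod
      have : v = v2 := by
        rw [← Nat.div_add_mod v (n / e), ← Nat.div_add_mod v2 (n / e), ed, hmod']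
      rw [this]
  rw [hSc]
  refine hinj.trans ?_
  rw [hBx]
  simp only [Finset.card_product, Int.card_Icc, Finset.card_range]
  have : ((r:ℤ) + 1 - -r).toNat = 2 * r + 1 := by omega
  rw [this]
  have h3 : (2 * r + 1) * (2 * r + 1) ≤ 9 * N := by nlinarith
  calc _ ≤ 9 * N * ((D + 2) * (D + 2)) := Nat.mul_le_mul h3 (Nat.mul_le_mul_left _ (by omega))
    _ = _ := by ring

lemma abel_major (a w : ℕ → ℝ) (B : ℝ) (hA : ∀ N, ∑ n ∈ Finset.Icc 1 N, a n ≤ B * N)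
    (hw : ∀ n, 1 ≤ n → w (n + 1) ≤ w n) (hw0 : ∀ n, 0 ≤ w n) (N : ℕ) :
    ∑ n ∈ Finset.Icc 1 N, a n * w n ≤ B * ∑ n ∈ Finset.Icc 1 N, w n := by
  have key : ∀ N, ∑ n ∈ Finset.Icc 1 (N + 1), a n * w n ≤ B * ∑ n ∈ Finset.Icc 1 (N + 1), w n
      - (B * (N + 1 : ℕ) - ∑ n ∈ Finset.Icc 1 (N + 1), a n) * w (N + 1) := by
    intro N
    induction N with
    | zero => simp; try linarith
    | succ N ih =>
      rw [Finset.sum_Icc_succ_top (by omega), Finset.sum_Icc_succ_top (by omega) w, Finset.sum_Icc_succ_top (by omega) a]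
      have h1 := hA (N + 1)
      have h2 := hw (N + 1) (by omega)
      have h3 : 0 ≤ (B * (N + 1 : ℕ) - ∑ n ∈ Finset.Icc 1 (N + 1), a n) * (w (N + 1) - w (N + 1 + 1)) :=
        mul_nonneg (by linarith) (by linarith)
      push_cast at *
      nlinarith
  rcases Nat.eq_zero_or_pos N with rfl | hN
  · simp
  · obtain ⟨M, rfl⟩ : ∃ M, N = M + 1 := ⟨N - 1, by omega⟩
    have h1 := key M
    have h2 := hA (M + 1)
    have h3 : 0 ≤ (B * (M + 1 : ℕ) - ∑ n ∈ Finset.Icc 1 (M + 1), a n) * w (M + 1) :=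
      mul_nonneg (by linarith) (hw0 _)
    linarith

lemma zeta_partial (η : ℝ) (hη : 0 < η) (N : ℕ) :
    ∑ n ∈ Finset.Icc 1 N, (n:ℝ) ^ (-(1 + η)) ≤ 1 + 1 / η := by
  have key : ∀ N : ℕ, ∑ n ∈ Finset.Icc 1 (N + 1), (n:ℝ) ^ (-(1 + η)) ≤ 1 + (1 - ((N:ℝ) + 1) ^ (-η)) / η := by
    intro N
    induction N with
    | zero => simp; try linarith
    | succ N ih =>
      rw [Finset.sum_Icc_succ_top (by omega)]
      set x : ℝ := (N:ℝ) + 1 with hx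
      have hx0 : 0 < x := by positivity
      have hc : ((N + 1 + 1 : ℕ) : ℝ) = x + 1 := by push_cast; ring
      have hc2 : ((N + 1 : ℕ) : ℝ) + 1 = x + 1 := by push_cast; ring
      rw [hc, hc2]
      have h1 : (x + 1) ^ (-(1 + η)) = (x + 1) ^ (-η) / (x + 1) := by
        rw [show -(1 + η) = -η - 1 by ring, Real.rpow_sub (by positivity), Real.rpow_one]
      have h2 : (x + 1) ^ (-η) * (1 + η / (x + 1)) ≤ x ^ (-η) := by
        have e1 : x = (x + 1) * (x / (x + 1)) := by field_simp
        have e2 : x ^ (-η) = (x + 1) ^ (-η) * (x / (x + 1)) ^ (-η) := by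
          conv_lhs => rw [e1]
          rw [Real.mul_rpow (by positivity) (by positivity)]
        rw [e2]
        gcongr
        rw [Real.rpow_def_of_pos (by positivity)]
        have l1 : Real.log (x / (x + 1)) ≤ x / (x + 1) - 1 := Real.log_le_sub_one_of_pos (by positivity)
        have l2 : x / (x + 1) - 1 = - (1 / (x + 1)) := by field_simp; ring
        rw [l2] at l1
        have l3 := Real.add_one_le_exp (Real.log (x / (x + 1)) * -η)
        have l4 : η / (x + 1) = 1 / (x + 1) * η := by ring
        nlinarith
      rw [h1]
      have h3 : (x + 1) ^ (-η) / (x + 1) ≤ (x ^ (-η) - (x + 1) ^ (-η)) / η := by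
        rw [le_div_iff₀ hη]
        have : (x + 1) ^ (-η) / (x + 1) * η = (x + 1) ^ (-η) * (1 + η / (x + 1)) - (x + 1) ^ (-η) := by ring
        rw [this]; linarith
      have h4 : (1 - (x + 1) ^ (-η)) / η = (1 - x ^ (-η)) / η + (x ^ (-η) - (x + 1) ^ (-η)) / η := by ring
      rw [h4]; linarith
  rcases Nat.eq_zero_or_pos N with rfl | hN
  · simp; positivity
  · obtain ⟨M, rfl⟩ : ∃ M, N = M + 1 := ⟨N - 1, by omega⟩
    refine (key M).trans ?_
    gcongr
    have : (0:ℝ) ≤ ((M:ℝ) + 1) ^ (-η) := by positivity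
    linarith

lemma rho_prod (D : ℕ) (S : Finset ℕ) (hS : ∀ p ∈ S, p.Prime) : rho D (∏ p ∈ S, p) = ∏ p ∈ S, rho D p := by
  classical
  induction S using Finset.induction_on with
  | empty => simp [rho_one]
  | insert a s ha ih =>
    rw [Finset.prod_insert ha, Finset.prod_insert ha, rho_mul, ih (fun p hp => hS p (Finset.mem_insert_of_mem hp))]
    apply Nat.Coprime.prod_right
    intro p hp
    rw [Nat.coprime_primes (hS a (Finset.mem_insert_self _ _)) (hS p (Finset.mem_insert_of_mem hp))]
    rintro rfl; exact ha hp

lemma rho_mert (D : ℕ) (hD : 1 ≤ D) : ∃ B : ℝ, ∀ y : ℕ, 2 ≤ y →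
    Real.exp (∑ p ∈ Nat.primesBelow y, (rho D p : ℝ) / p) ≤ B * Real.log y := by
  set Z := ∑' n : ℕ, ((n:ℝ) ^ 2)⁻¹ with hZ
  have hZs : Summable (fun n : ℕ => ((n:ℝ) ^ 2)⁻¹) := Real.summable_nat_pow_inv.2 (by norm_num)
  set B0 : ℝ := 9 * (D + 2) ^ 2 with hB0
  refine ⟨Real.exp (6 + 4 * Z) * (B0 * 3), ?_⟩
  intro y hy
  set P := Nat.primesBelow y with hP
  have hPp : ∀ p ∈ P, p.Prime := fun p hp => (Nat.mem_primesBelow.1 hp).2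
  have hyr : (2:ℝ) ≤ y := by exact_mod_cast hy
  have hlog : 1/2 ≤ Real.log y := by
    have := Real.log_le_log (by norm_num) hyr
    linarith [Real.log_two_gt_d9]
  set η := 1 / Real.log y with hη
  have hη0 : 0 < η := by positivity
  set w : ℕ → ℝ := fun n => (n:ℝ) ^ (-(1 + η)) with hw
  have hw0 : ∀ n, 0 ≤ w n := fun n => by positivity
  -- the product bound
  have hprod : ∏ p ∈ P, (1 + (rho D p : ℝ) * w p) ≤ B0 * (1 + Real.log y) := by
    rw [Finset.prod_one_add]
    have e1 : ∀ S ∈ P.powerset, ∏ p ∈ S, ((rho D p : ℝ) * w p) = (rho D (∏ p ∈ S, p) : ℝ) * w (∏ p ∈ S, p) := by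
      intro S hS
      have hS' := Finset.mem_powerset.1 hS
      rw [rho_prod D S (fun p hp => hPp p (hS' hp)), Finset.prod_mul_distrib]
      push_cast
      congr 1
      simp only [hw]
      push_cast
      rw [Real.finsetProd_rpow _ _ (fun i _ => by positivity)]
    rw [Finset.sum_congr rfl e1]
    set N := ∏ p ∈ P, p with hN
    have hinj : Set.InjOn (fun S : Finset ℕ => ∏ p ∈ S, p) (P.powerset : Set (Finset ℕ)) := by
      intro S hS S' hS' h
      have hS := Finset.mem_powerset.1 (Finset.mem_coe.1 hS)
      have hS' := Finset.mem_powerset.1 (Finset.mem_coe.1 hS')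
      have h1 := Nat.primeFactors_prod (s := S) (fun p hp => hPp p (hS hp))
      have h2 := Nat.primeFactors_prod (s := S') (fun p hp => hPp p (hS' hp))
      simp only at h
      rw [← h1, ← h2, h]
    rw [← Finset.sum_image (f := fun n : ℕ => (rho D n : ℝ) * w n) hinj]
    calc _ ≤ ∑ n ∈ Finset.Icc 1 N, (rho D n : ℝ) * w n := by
          apply Finset.sum_le_sum_of_subset_of_nonneg
          · intro n hn
            obtain ⟨S, hS, rfl⟩ := Finset.mem_image.1 hn
            have hS' := Finset.mem_powerset.1 hS
            rw [Finset.mem_Icc]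
            refine ⟨Finset.prod_pos (fun p hp => (hPp p (hS' hp)).pos), ?_⟩
            exact Finset.prod_le_prod_of_subset_of_one_le' hS' (fun p hp _ => (hPp p hp).one_lt.le)
          · intro n _ _
            have := hw0 n
            positivity
      _ ≤ B0 * ∑ n ∈ Finset.Icc 1 N, w n := by
          apply abel_major
          · intro M
            have := rho_avg D hD M
            rw [hB0]
            exact_mod_cast this
          · intro n hn
            apply Real.rpow_le_rpow_of_nonpos (by exact_mod_cast hn) (by push_cast; linarith) (by linarith)
          · exact hw0
      _ ≤ B0 * (1 + 1 / η) := by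
          gcongr
          exact zeta_partial η hη0 N
      _ = _ := by rw [hη, one_div_one_div]
  have hterm : ∀ p ∈ P, (rho D p : ℝ) / p ≤ Real.log (1 + (rho D p : ℝ) * w p) + 4 * ((p:ℝ) ^ 2)⁻¹ +
      2 * η * (Real.log p / p) := by
    intro p hp
    have hpp := hPp p hp
    have hp2 : (2:ℝ) ≤ p := by exact_mod_cast hpp.two_le
    have hp0 : (0:ℝ) < p := by linarith
    have hr2 : (rho D p : ℝ) ≤ 2 := by exact_mod_cast rho_prime D p hpp
    have hr0 : (0:ℝ) ≤ rho D p := by positivity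
    have hlp : 0 ≤ Real.log p := Real.log_nonneg (by linarith)
    have hwp : w p = (p:ℝ) ^ (-η) / p := by
      simp only [hw]
      rw [show -(1 + η) = -η - 1 by ring, Real.rpow_sub hp0, Real.rpow_one]
    have hlow : 1 - η * Real.log p ≤ (p:ℝ) ^ (-η) := by
      rw [Real.rpow_def_of_pos hp0]
      have := Real.add_one_le_exp (Real.log p * -η)
      linarith
    have hup : (p:ℝ) ^ (-η) ≤ 1 := Real.rpow_le_one_of_one_le_of_nonpos (by linarith) (by linarith)
    set x := (rho D p : ℝ) * w p with hx
    have hx0 : 0 ≤ x := mul_nonneg hr0 (hw0 p)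
    have hwle : w p ≤ 1 / p := by rw [hwp]; gcongr
    have hxle : x ≤ 2 * (1 / p) := mul_le_mul hr2 hwle (hw0 p) (by norm_num)
    have hx2 : x ^ 2 ≤ 4 * ((p:ℝ) ^ 2)⁻¹ := by
      calc x ^ 2 ≤ (2 * (1 / p)) ^ 2 := by gcongr
        _ = _ := by field_simp; norm_num
    have hl : x - x ^ 2 ≤ Real.log (1 + x) := by
      have h1 := Real.one_sub_inv_le_log_of_pos (show 0 < 1 + x by linarith)
      have h2 : x - x ^ 2 ≤ 1 - (1 + x)⁻¹ := by
        have : 1 - (1 + x)⁻¹ = x / (1 + x) := by field_simp; ring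
        rw [this, le_div_iff₀ (by linarith)]
        have : 0 ≤ x ^ 3 := by positivity
        nlinarith
      linarith
    have hxlow : (rho D p : ℝ) / p - 2 * η * (Real.log p / p) ≤ x := by
      rw [hx, hwp]
      have h1 : (rho D p : ℝ) * ((p:ℝ) ^ (-η) / p) = (rho D p : ℝ) / p * (p:ℝ) ^ (-η) := by ring
      rw [h1]
      have h2 : (rho D p : ℝ) / p * (1 - η * Real.log p) ≤ (rho D p : ℝ) / p * (p:ℝ) ^ (-η) := by gcongr
      have h3 : (rho D p : ℝ) * (η * (Real.log p / p)) ≤ 2 * (η * (Real.log p / p)) := by gcongr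
      have h4 : (rho D p : ℝ) / p * (1 - η * Real.log p) = (rho D p : ℝ) / p - (rho D p : ℝ) * (η * (Real.log p / p)) := by ring
      linarith
    linarith
  have hsum : ∑ p ∈ P, (rho D p : ℝ) / p ≤ Real.log (∏ p ∈ P, (1 + (rho D p : ℝ) * w p)) + 4 * Z + 6 := by
    refine (Finset.sum_le_sum hterm).trans ?_
    rw [Finset.sum_add_distrib, Finset.sum_add_distrib, ← Finset.mul_sum, ← Finset.mul_sum, Real.log_prod]
    · have h1 := hZs.sum_le_tsum P (fun n _ => by positivity)
      have h2 := mertens_upper y hy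
      have h3 : 2 * η * ∑ p ∈ P, Real.log p / p ≤ 6 := by
        calc _ ≤ 2 * η * (3 * Real.log y) := by gcongr
          _ = 6 := by rw [hη]; field_simp; norm_num
      linarith
    · intro p _
      have := mul_nonneg (Nat.cast_nonneg (α := ℝ) (rho D p)) (hw0 p)
      linarith
  have hpos : 0 < ∏ p ∈ P, (1 + (rho D p : ℝ) * w p) := by
    apply Finset.prod_pos
    intro p _
    have := mul_nonneg (Nat.cast_nonneg (α := ℝ) (rho D p)) (hw0 p)
    linarith
  calc _ ≤ Real.exp (Real.log (∏ p ∈ P, (1 + (rho D p : ℝ) * w p)) + (6 + 4 * Z)) := by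
        apply Real.exp_le_exp.2; linarith
    _ = Real.exp (6 + 4 * Z) * ∏ p ∈ P, (1 + (rho D p : ℝ) * w p) := by
        rw [Real.exp_add, Real.exp_log hpos, mul_comm]
    _ ≤ Real.exp (6 + 4 * Z) * (B0 * (1 + Real.log y)) := by gcongr
    _ ≤ Real.exp (6 + 4 * Z) * (B0 * (3 * Real.log y)) := by gcongr; linarith
    _ = _ := by ring

def rhoA (D : ℕ) : ArithmeticFunction ℕ := ⟨rho D, rho_zero D⟩

def sqA : ArithmeticFunction ℕ := ⟨fun n => if 0 < n ∧ IsSquare n then 1 else 0, by simp⟩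

lemma sqA_le (n : ℕ) : sqA n ≤ 1 := by
  show (if 0 < n ∧ IsSquare n then 1 else 0) ≤ 1
  split_ifs <;> simp

lemma sq_of_coprime (m n : ℕ) (h : Nat.Coprime m n) (k : IsSquare (m * n)) : IsSquare m := by
  obtain ⟨r, hr⟩ := k
  obtain ⟨d, hd⟩ := exists_eq_pow_of_mul_eq_pow (a := m) (b := n) (c := r) (k := 2)
    (by rw [show gcd m n = 1 from h]; exact isUnit_one) (by rw [hr, sq])
  exact ⟨d, by rw [hd, sq]⟩

lemma sqA_mult : sqA.IsMultiplicative := by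
  constructor
  · show (if 0 < 1 ∧ IsSquare 1 then 1 else 0) = 1
    simp
  · intro m n h
    show (if 0 < m * n ∧ IsSquare (m * n) then 1 else 0) = (if 0 < m ∧ IsSquare m then 1 else 0) * (if 0 < n ∧ IsSquare n then 1 else 0)
    have : (0 < m * n ∧ IsSquare (m * n)) ↔ (0 < m ∧ IsSquare m) ∧ (0 < n ∧ IsSquare n) := by
      constructor
      · rintro ⟨h1, h2⟩
        have hm : 0 < m := Nat.pos_of_mul_pos_right h1
        have hn : 0 < n := Nat.pos_of_mul_pos_left h1
        exact ⟨⟨hm, sq_of_coprime m n h h2⟩, hn, sq_of_coprime n m h.symm (by rwa [mul_comm])⟩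
      · rintro ⟨⟨h1, h2⟩, h3, h4⟩
        exact ⟨Nat.mul_pos h1 h3, h2.mul h4⟩
    simp only [this]
    by_cases h1 : 0 < m ∧ IsSquare m <;> by_cases h2 : 0 < n ∧ IsSquare n <;> simp [h1, h2]

lemma rhoA_mult (D : ℕ) : (rhoA D).IsMultiplicative :=
  ⟨rho_one D, fun {m n} h => rho_mul D m n h⟩

lemma FD_mult (D : ℕ) : (sqA * rhoA D).IsMultiplicative := sqA_mult.mul (rhoA_mult D)

lemma FD_pp (D p a : ℕ) (hD : 1 ≤ D) (hp : p.Prime) : (sqA * rhoA D) (p ^ a) ≤ 8 * D * (a + 1) := by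
  rw [ArithmeticFunction.mul_apply, Nat.sum_divisorsAntidiagonal (fun x y => sqA x * rhoA D y), Nat.sum_divisors_prime_pow hp]
  calc _ ≤ ∑ i ∈ Finset.range (a + 1), 8 * D := by
        apply Finset.sum_le_sum
        intro i hi
        have hi' := Finset.mem_range.1 hi
        rw [Nat.pow_div (by omega) hp.pos]
        calc _ ≤ 1 * (8 * D) := Nat.mul_le_mul (sqA_le _) (rho_pp D p _ hD hp)
          _ = _ := one_mul _
    _ = _ := by simp; ring

lemma FD_p (D p : ℕ) (hp : p.Prime) : (sqA * rhoA D) p = rho D p := by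
  have := Nat.sum_divisors_prime_pow (k := 1) (f := fun x => sqA x * rhoA D (p / x)) hp
  rw [ArithmeticFunction.mul_apply, Nat.sum_divisorsAntidiagonal (fun x y => sqA x * rhoA D y)]
  rw [pow_one] at this
  rw [this, Finset.sum_range_succ, Finset.sum_range_one]
  have h1 : sqA (p ^ 0) = 1 := by rw [pow_zero]; exact sqA_mult.1
  have h2 : sqA (p ^ 1) = 0 := by
    show (if 0 < p ^ 1 ∧ IsSquare (p ^ 1) then 1 else 0) = 0
    rw [if_neg]
    rintro ⟨_, h⟩
    rw [pow_one] at h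
    exact (Nat.prime_iff.1 hp).irreducible.not_isSquare h
  rw [h1, h2]
  simp
  rfl

lemma FD_MF (D : ℕ) (hD : 1 ≤ D) : ∃ K B : ℝ, MF (fun n => (((sqA * rhoA D) n : ℕ) : ℝ)) K B := by
  obtain ⟨B, hB⟩ := rho_mert D hD
  refine ⟨8 * D, B, ?_⟩
  refine ⟨fun n => by positivity, ?_, ?_, ?_, ?_, ?_, ?_⟩
  · rw [(FD_mult D).1]; simp
  · intro m n h
    rw [(FD_mult D).2 h]; push_cast; ring
  · have : (1:ℝ) ≤ D := by exact_mod_cast hD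
    linarith
  · intro p a hp
    exact_mod_cast FD_pp D p a hD hp
  · intro p hp
    rw [FD_p D p hp]; exact_mod_cast rho_prime D p hp
  · intro y hy
    refine le_trans (le_of_eq ?_) (hB y hy)
    congr 1
    apply Finset.sum_congr rfl
    intro p hp
    rw [FD_p D p (Nat.mem_primesBelow.1 hp).2]

/-- primitive representations -/
lemma prim_count (D n : ℕ) (hD : 1 ≤ D) (hn : 1 ≤ n) (S : Finset (ℤ × ℤ))
    (hS : ∀ w ∈ S, Int.gcd w.1 w.2 = 1 ∧ w.1 ^ 2 + D * w.2 ^ 2 = n) : S.card ≤ 9 * rho D n := by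
  have hnZ : (n:ℤ) ≠ 0 := by omega
  have hex : ∀ w : ℤ × ℤ, ∃ v : ℕ, w ∈ S → v < n ∧ (n:ℤ) ∣ w.1 - v * w.2 ∧ n ∣ v ^ 2 + D := by
    intro w
    by_cases hw : w ∈ S
    swap
    · exact ⟨0, fun h => absurd h hw⟩
    obtain ⟨hg, he⟩ := hS w hw
    have hcop : IsCoprime w.2 (n:ℤ) := by
      have h1 : IsCoprime w.1 w.2 := Int.isCoprime_iff_gcd_eq_one.2 hg
      have h2 : IsCoprime (w.2) (w.1 ^ 2) := (h1.pow_left (m := 2)).symm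
      rw [← he]
      have := h2.add_mul_left_right (D * w.2)
      have e : w.1 ^ 2 + D * w.2 ^ 2 = w.1 ^ 2 + w.2 * (D * w.2) := by ring
      rw [e]; exact this
    obtain ⟨a, b, hab⟩ := hcop
    -- a * w.2 + b * n = 1
    have hv0 := Int.emod_nonneg (w.1 * a) hnZ
    have hv1 := Int.emod_lt_of_pos (w.1 * a) (by omega : (0:ℤ) < n)
    refine ⟨((w.1 * a) % n).toNat, fun _ => ⟨by omega, ?_, ?_⟩⟩
    · rw [Int.toNat_of_nonneg hv0, Int.emod_def]
      refine ⟨w.1 * b + (w.1 * a / n) * w.2, ?_⟩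
      have : w.1 = w.1 * (a * w.2 + b * n) := by rw [hab, mul_one]
      linear_combination this
    · have : (n:ℤ) ∣ ((((w.1 * a) % n).toNat : ℕ) : ℤ) ^ 2 + D := by
        rw [Int.toNat_of_nonneg hv0]
        have h1 : (w.1 * a) % n ≡ w.1 * a [ZMOD n] := Int.mod_modEq _ _
        have h2 := (h1.pow 2).add_right (D:ℤ)
        refine (Int.ModEq.dvd_iff h2).2 ?_
        have e : (w.1 * a) ^ 2 + D = a ^ 2 * n + D * (b * n) * (1 + a * w.2) := by
          have e1 : w.1 ^ 2 = n - D * w.2 ^ 2 := by linarith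
          have e2 : b * n = 1 - a * w.2 := by linarith
          rw [e2, mul_pow, e1]; ring
        rw [e]
        exact ⟨a ^ 2 + D * b * (1 + a * w.2), by ring⟩
      exact_mod_cast this
  choose v hv using hex
  unfold rho
  apply Finset.card_le_mul_card_image_of_maps_to (f := v)
  · intro w hw
    obtain ⟨h1, h2, h3⟩ := hv w hw
    exact Finset.mem_filter.2 ⟨Finset.mem_range.2 h1, h3⟩
  · intro u hu
    rcases Finset.eq_empty_or_nonempty (S.filter (fun w => v w = u)) with h0 | ⟨⟨x, y⟩, hxy⟩
    · rw [h0]; simp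
    have hxy' := Finset.mem_filter.1 hxy
    obtain ⟨_, he⟩ := hS _ hxy'.1
    obtain ⟨_, hd, hvd⟩ := hv _ hxy'.1
    rw [hxy'.2] at hd hvd
    simp only at he hd
    have hc : (Finset.Icc (-1:ℤ) 1 ×ˢ Finset.Icc (-1:ℤ) 1).card = 9 := by rfl
    rw [← hc]
    have main : ∀ w ∈ S.filter (fun w => v w = u), (n:ℤ) ∣ x * w.1 + D * y * w.2 ∧ (n:ℤ) ∣ x * w.2 - y * w.1 ∧ w.1 ^ 2 + D * w.2 ^ 2 = n := by
      rintro ⟨x', y'⟩ hw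
      have hw' := Finset.mem_filter.1 hw
      obtain ⟨_, he'⟩ := hS _ hw'.1
      obtain ⟨_, hd', _⟩ := hv _ hw'.1
      rw [hw'.2] at hd'
      simp only at he' hd' ⊢
      have hvZ : (n:ℤ) ∣ (u:ℤ) ^ 2 + D := by exact_mod_cast hvd
      obtain ⟨c, hc⟩ := hd
      obtain ⟨c', hc'⟩ := hd'
      obtain ⟨f, hf⟩ := hvZ
      refine ⟨⟨c * x' + u * y * c' + f * y * y', ?_⟩, ⟨c * y' - y * c', ?_⟩, he'⟩
      · linear_combination x' * hc + u * y * hc' + y * y' * hf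
      · linear_combination y' * hc - y * hc'
    apply Finset.card_le_card_of_injOn (fun w => ((x * w.1 + D * y * w.2) / n, (x * w.2 - y * w.1) / n))
    · intro w hw
      obtain ⟨⟨a, ha⟩, ⟨b, hb⟩, he'⟩ := main w hw
      simp only
      rw [ha, hb, Int.mul_ediv_cancel_left _ hnZ, Int.mul_ediv_cancel_left _ hnZ]
      have hab : a ^ 2 + D * b ^ 2 = 1 := by
        have : (n:ℤ) ^ 2 * (a ^ 2 + D * b ^ 2) = n ^ 2 * 1 := by
          have h1 : (x * w.1 + D * y * w.2) ^ 2 + D * (x * w.2 - y * w.1) ^ 2 = (x ^ 2 + D * y ^ 2) * (w.1 ^ 2 + D * w.2 ^ 2) := by ring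
          rw [ha, hb, he, he'] at h1
          linear_combination h1
        exact mul_left_cancel₀ (by positivity) this
      have hDZ : (1:ℤ) ≤ D := by exact_mod_cast hD
      simp only [Finset.coe_product, Finset.coe_Icc, Set.mem_prod, Set.mem_Icc]
      refine ⟨⟨?_, ?_⟩, ?_, ?_⟩ <;> nlinarith [sq_nonneg a, sq_nonneg b]
    · intro w hw w2 hw2 heq
      obtain ⟨⟨a, ha⟩, ⟨b, hb⟩, he'⟩ := main w hw
      obtain ⟨⟨a2, ha2⟩, ⟨b2, hb2⟩, he2'⟩ := main w2 hw2
      simp only at heq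
      rw [ha, hb, ha2, hb2, Int.mul_ediv_cancel_left _ hnZ, Int.mul_ediv_cancel_left _ hnZ, Int.mul_ediv_cancel_left _ hnZ, Int.mul_ediv_cancel_left _ hnZ, Prod.mk.injEq] at heq
      obtain ⟨rfl, rfl⟩ := heq
      have e1 : (n:ℤ) * (w.1 - w2.1) = 0 := by
        linear_combination (w2.1 - w.1) * he + x * (ha - ha2) - D * y * (hb - hb2)
      have e2 : (n:ℤ) * (w.2 - w2.2) = 0 := by
        linear_combination (w2.2 - w.2) * he + x * (hb - hb2) + y * (ha - ha2)
      have e1' := (mul_eq_zero.1 e1).resolve_left hnZ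
      have e2' := (mul_eq_zero.1 e2).resolve_left hnZ
      ext <;> omega

lemma rep_count (D m : ℕ) (hD : 1 ≤ D) (hm : 1 ≤ m) (S : Finset (ℤ × ℤ))
    (hS : ∀ w ∈ S, w.1 ^ 2 + D * w.2 ^ 2 = m) : S.card ≤ 9 * (sqA * rhoA D) m := by
  rw [ArithmeticFunction.mul_apply, Finset.mul_sum]
  have gpos : ∀ w ∈ S, 0 < Int.gcd w.1 w.2 := by
    intro w hw
    rw [Int.gcd_pos_iff]
    by_contra hc
    push Not at hc
    have := hS w hw
    rw [hc.1, hc.2] at this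
    simp at this
    omega
  have gdvd : ∀ w ∈ S, (Int.gcd w.1 w.2) ^ 2 ∣ m := by
    intro w hw
    have h1 : (Int.gcd w.1 w.2 : ℤ) ∣ w.1 := Int.gcd_dvd_left ..
    have h2 : (Int.gcd w.1 w.2 : ℤ) ∣ w.2 := Int.gcd_dvd_right ..
    have h3 : (Int.gcd w.1 w.2 : ℤ) ^ 2 ∣ m := by
      rw [← hS w hw]
      exact Int.dvd_add (pow_dvd_pow_of_dvd h1 2) (Dvd.dvd.mul_left (pow_dvd_pow_of_dvd h2 2) _)
    exact_mod_cast h3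
  have hmaps : ∀ w ∈ S, (fun w : ℤ × ℤ => ((Int.gcd w.1 w.2) ^ 2, m / (Int.gcd w.1 w.2) ^ 2)) w ∈ m.divisorsAntidiagonal := by
    intro w hw
    rw [Nat.mem_divisorsAntidiagonal]
    exact ⟨Nat.mul_div_cancel' (gdvd w hw), by omega⟩
  rw [Finset.card_eq_sum_card_fiberwise hmaps]
  apply Finset.sum_le_sum
  rintro ⟨d, n⟩ hdn
  obtain ⟨hdn1, hdn2⟩ := Nat.mem_divisorsAntidiagonal.1 hdn
  simp only at hdn1 ⊢
  rcases Finset.eq_empty_or_nonempty (S.filter (fun w => ((Int.gcd w.1 w.2) ^ 2, m / (Int.gcd w.1 w.2) ^ 2) = (d, n))) with h0 | ⟨w0, hw0⟩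
  · rw [h0]; simp
  obtain ⟨hw01, hw02⟩ := Finset.mem_filter.1 hw0
  set g := Int.gcd w0.1 w0.2 with hg
  simp only [Prod.mk.injEq] at hw02
  have hg0 : 0 < g := gpos w0 hw01
  have hsq : sqA d = 1 := by
    show (if 0 < d ∧ IsSquare d then 1 else 0) = 1
    rw [if_pos]
    rw [← hw02.1]
    exact ⟨by positivity, ⟨g, sq g⟩⟩
  rw [hsq, one_mul]
  have hn1 : 1 ≤ n := Nat.pos_of_ne_zero (by rintro rfl; omega)
  have hfib : ∀ w ∈ S.filter (fun w => ((Int.gcd w.1 w.2) ^ 2, m / (Int.gcd w.1 w.2) ^ 2) = (d, n)), w ∈ S ∧ Int.gcd w.1 w.2 = g := by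
    intro w hw
    obtain ⟨h1, h2⟩ := Finset.mem_filter.1 hw
    simp only [Prod.mk.injEq] at h2
    refine ⟨h1, ?_⟩
    exact Nat.pow_left_injective (n := 2) (by norm_num) (h2.1.trans hw02.1.symm)
  have hgZ : (g:ℤ) ≠ 0 := by exact_mod_cast hg0.ne'
  have hdec : ∀ w ∈ S.filter (fun w => ((Int.gcd w.1 w.2) ^ 2, m / (Int.gcd w.1 w.2) ^ 2) = (d, n)),
      w.1 = g * (w.1 / g) ∧ w.2 = g * (w.2 / g) := by
    intro w hw
    have h := (hfib w hw).2
    have h1 : (Int.gcd w.1 w.2 : ℤ) ∣ w.1 := Int.gcd_dvd_left ..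
    have h2 : (Int.gcd w.1 w.2 : ℤ) ∣ w.2 := Int.gcd_dvd_right ..
    rw [h] at h1 h2
    exact ⟨(Int.mul_ediv_cancel' h1).symm, (Int.mul_ediv_cancel' h2).symm⟩
  have hinj : Set.InjOn (fun w : ℤ × ℤ => (w.1 / (g:ℤ), w.2 / (g:ℤ))) (S.filter (fun w => ((Int.gcd w.1 w.2) ^ 2, m / (Int.gcd w.1 w.2) ^ 2) = (d, n)) : Set (ℤ × ℤ)) := by
    intro w hw w2 hw2 h
    simp only [Prod.mk.injEq] at h
    have h1 := hdec w hw
    have h2 := hdec w2 hw2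
    ext
    · rw [h1.1, h2.1, h.1]
    · rw [h1.2, h2.2, h.2]
  rw [← Finset.card_image_of_injOn hinj]
  apply prim_count D n hD hn1
  intro u hu
  obtain ⟨w, hw, rfl⟩ := Finset.mem_image.1 hu
  obtain ⟨h1, h2⟩ := hdec w hw
  obtain ⟨h3, h4⟩ := hfib w hw
  simp only
  constructor
  · rw [h1, h2, Int.gcd_mul_left] at h4
    have : g * Int.gcd (w.1 / g) (w.2 / g) = g * 1 := by simpa using h4
    exact Nat.eq_of_mul_eq_mul_left hg0 this
  · have h5 := hS w h3
    rw [h1, h2, ← hdn1, ← hw02.1] at h5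
    push_cast at h5
    have : (g:ℤ) ^ 2 * ((w.1 / g) ^ 2 + D * (w.2 / g) ^ 2) = g ^ 2 * n := by linear_combination h5
    exact mul_left_cancel₀ (pow_ne_zero 2 hgZ) this

lemma form_trivial (D Q : ℕ) (hD : 1 ≤ D) (S : Finset (ℤ × ℤ)) (hQ : 1 ≤ Q)
    (hS : ∀ w ∈ S, w.1 ^ 2 + D * w.2 ^ 2 ≤ Q) : S.card ≤ 9 * Q := by
  set r := Nat.sqrt Q with hr
  have hr1 : 1 ≤ r := Nat.sqrt_pos.2 hQ
  have hrQ : r * r ≤ Q := Nat.sqrt_le Q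
  have hlt : Q < (r + 1) * (r + 1) := Nat.lt_succ_sqrt Q
  have hltZ : (Q:ℤ) < (r + 1) * (r + 1) := by exact_mod_cast hlt
  have hDZ : (1:ℤ) ≤ D := by exact_mod_cast hD
  have hsub : S ⊆ Finset.Icc (-(r:ℤ)) r ×ˢ Finset.Icc (-(r:ℤ)) r := by
    intro w hw
    have h := hS w hw
    have h1 : w.1 ^ 2 ≤ Q := by nlinarith [sq_nonneg w.2]
    have h2 : w.2 ^ 2 ≤ Q := by nlinarith [sq_nonneg w.2, sq_nonneg w.1]
    have aux : ∀ x : ℤ, x ^ 2 ≤ Q → -(r:ℤ) ≤ x ∧ x ≤ r := by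
      intro x hx
      constructor
      · by_contra hc
        push Not at hc
        nlinarith
      · by_contra hc
        push Not at hc
        nlinarith
    simp only [Finset.mem_product, Finset.mem_Icc]
    exact ⟨aux _ h1, aux _ h2⟩
  refine (Finset.card_le_card hsub).trans ?_
  simp only [Finset.card_product, Int.card_Icc]
  have : ((r:ℤ) + 1 - -r).toNat = 2 * r + 1 := by omega
  rw [this]
  nlinarith

lemma form_short (D : ℕ) (hD : 1 ≤ D) (δ : ℝ) (hδ : 0 < δ) :
    ∃ C : ℝ, 0 < C ∧ ∀ (a h T : ℝ) (S : Finset (ℤ × ℤ)), a ≤ T → 1 ≤ T → 0 ≤ h →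
      (∀ w ∈ S, a < (w.1:ℝ) ^ 2 + D * (w.2:ℝ) ^ 2 ∧ (w.1:ℝ) ^ 2 + D * (w.2:ℝ) ^ 2 ≤ a + h) →
      (S.card : ℝ) ≤ C * (h + T ^ δ) := by
  obtain ⟨K, B, hMF⟩ := FD_MF D hD
  set n := ⌈1 / δ⌉₊ with hn
  obtain ⟨C, hC, hs⟩ := shiu_interval hMF n
  refine ⟨(9 * C + 18) * (2 ^ 16 + 4), by positivity, ?_⟩
  intro a h T S haT hT hh hS
  have hTd : 1 ≤ T ^ δ := Real.one_le_rpow hT hδ.le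
  obtain ⟨q, hq⟩ : ∃ q : ℕ, q = 2 ^ 16 := ⟨_, rfl⟩
  have hqR : (2:ℝ) ^ 16 = q := by rw [hq]; norm_num
  rw [hqR]
  obtain ⟨H, hH⟩ : ∃ H : ℕ, H = ⌈h⌉₊ + ⌈T ^ δ⌉₊ + q + 1 := ⟨_, rfl⟩
  have hHq : 2 ^ 16 ≤ H := by rw [← hq]; omega
  have hH1 : 1 ≤ H := by omega
  have hHle : (H:ℝ) ≤ ((q:ℝ) + 4) * (h + T ^ δ) := by
    have h1 := (Nat.ceil_lt_add_one hh).le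
    have h2 := (Nat.ceil_lt_add_one (zero_le_one.trans hTd)).le
    rw [hH]; push_cast
    have hq0 : (0:ℝ) ≤ q := by positivity
    have h3 : (q:ℝ) * 1 ≤ q * (h + T ^ δ) := mul_le_mul_of_nonneg_left (by linarith) hq0
    linarith
  have hHh : h + 1 ≤ H := by
    have := Nat.le_ceil h
    rw [hH]; push_cast
    have hq0 : (0:ℝ) ≤ q := by positivity
    have : (0:ℝ) ≤ ⌈T ^ δ⌉₊ := by positivity
    linarith
  have hHT : T ^ δ ≤ H := by
    have := Nat.le_ceil (T ^ δ)
    rw [hH]; push_cast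
    have hq0 : (0:ℝ) ≤ q := by positivity
    have : (0:ℝ) ≤ ⌈h⌉₊ := by positivity
    linarith
  clear hH
  suffices hmain : (S.card : ℝ) ≤ (9 * C + 18) * H by
    calc _ ≤ (9 * C + 18) * H := hmain
      _ ≤ (9 * C + 18) * (((q:ℝ) + 4) * (h + T ^ δ)) := by gcongr
      _ = _ := by ring
  set M := ⌊a⌋₊ with hM
  have haM : a < M + 1 := Nat.lt_floor_add_one a
  have hup : ∀ w ∈ S, w.1 ^ 2 + D * w.2 ^ 2 ≤ ((M + H : ℕ) : ℤ) := by
    intro w hw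
    have h1 := (hS w hw).2
    have h2 : (w.1:ℝ) ^ 2 + D * (w.2:ℝ) ^ 2 ≤ ((M + H : ℕ) : ℝ) := by push_cast; linarith
    exact_mod_cast h2
  by_cases hHM : H ≤ M
  · have hM1 : 1 ≤ M := by omega
    have ha0 : 0 ≤ a := by
      by_contra hc
      push Not at hc
      have : M = 0 := Nat.floor_of_nonpos hc.le
      omega
    have hMa : (M:ℝ) ≤ a := Nat.floor_le ha0
    have hlow : ∀ w ∈ S, (M:ℤ) < w.1 ^ 2 + D * w.2 ^ 2 := by
      intro w hw
      have h1 := (hS w hw).1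
      have h2 : (M:ℝ) < (w.1:ℝ) ^ 2 + D * (w.2:ℝ) ^ 2 := by linarith
      exact_mod_cast h2
    have hMn : M ≤ H ^ n := by
      have : (M:ℝ) ≤ (H:ℝ) ^ n := by
        calc (M:ℝ) ≤ T := hMa.trans haT
          _ = (T ^ δ) ^ (1 / δ) := by
            rw [← Real.rpow_mul (by linarith), mul_one_div_cancel hδ.ne', Real.rpow_one]
          _ ≤ (T ^ δ) ^ (n:ℝ) := Real.rpow_le_rpow_of_exponent_le hTd (Nat.le_ceil _)
          _ = (T ^ δ) ^ n := Real.rpow_natCast _ _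
          _ ≤ (H:ℝ) ^ n := by gcongr
      exact_mod_cast this
    have hmaps : ∀ w ∈ S, (w.1 ^ 2 + D * w.2 ^ 2).toNat ∈ Finset.Ioc M (M + H) := by
      intro w hw
      have h1 := hlow w hw
      have h2 := hup w hw
      rw [Finset.mem_Ioc]; omega
    rw [Finset.card_eq_sum_card_fiberwise hmaps]
    push_cast
    calc _ ≤ ∑ m ∈ Finset.Ioc M (M + H), 9 * (((sqA * rhoA D) m : ℕ) : ℝ) := by
          apply Finset.sum_le_sum
          intro m hm
          have hm' := Finset.mem_Ioc.1 hm
          have := rep_count D m hD (by omega) (S.filter (fun w => (w.1 ^ 2 + D * w.2 ^ 2).toNat = m)) (by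
            intro w hw
            obtain ⟨hw1, hw2⟩ := Finset.mem_filter.1 hw
            have := hlow w hw1
            omega)
          exact_mod_cast this
      _ = 9 * ∑ m ∈ Finset.Ioc M (M + H), (((sqA * rhoA D) m : ℕ) : ℝ) := by rw [Finset.mul_sum]
      _ ≤ 9 * (C * H) := by
          gcongr
          exact hs M H hHq hHM hMn
      _ ≤ _ := by
          have : (0:ℝ) ≤ H := by positivity
          nlinarith
  · push Not at hHM
    have := form_trivial D (M + H) hD S (by omega) hup
    have h2 : S.card ≤ 18 * H := by omega
    have h3 : (S.card : ℝ) ≤ 18 * H := by exact_mod_cast h2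
    have : 0 ≤ C * H := by positivity
    linarith

/-- For every `k ∈ ℤ³ \ {0}` and every real `γ > 131/208` there is `C > 0`
such that for all `R ≥ 1` and all `s ∈ ℤ`, the number of lattice points `p ∈ ℤ³` with
`|p| > R ≥ |p - k|` and `p · k = s` is at most `C(|s| + R^γ)`. -/
theorem lattice_slice_count_bound (k : Fin 3 → ℤ) (hk : k ≠ 0)
    (γ : ℝ) (hγ : 131 / 208 < γ) :
    ∃ C : ℝ, 0 < C ∧ ∀ R : ℝ, 1 ≤ R → ∀ s : ℤ,
      (Set.ncard {p : Fin 3 → ℤ | R < latNorm p ∧ latNorm (p - k) ≤ R ∧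
          (∑ i, p i * k i) = s} : ℝ)
        ≤ C * (|(s : ℝ)| + R ^ γ) := by
  have hγ0 : 0 < γ := by linarith
  obtain ⟨i, hi⟩ : ∃ i, k i ≠ 0 := by
    by_contra hc
    push Not at hc
    exact hk (funext hc)
  obtain ⟨σ, hσ⟩ : ∃ σ : Equiv.Perm (Fin 3), k (σ 2) ≠ 0 := ⟨Equiv.swap 2 i, by simpa using hi⟩
  have hsumZ : ∀ f : Fin 3 → ℤ, ∑ i, f i = f (σ 0) + f (σ 1) + f (σ 2) := by
    intro f
    rw [← Equiv.sum_comp σ, Fin.sum_univ_three]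
  have hsumR : ∀ f : Fin 3 → ℝ, ∑ i, f i = f (σ 0) + f (σ 1) + f (σ 2) := by
    intro f
    rw [← Equiv.sum_comp σ, Fin.sum_univ_three]
  set k1 := k (σ 0) with hk1
  set k2 := k (σ 1) with hk2
  set k3 := k (σ 2) with hk3
  have hk3p : 0 < k3 ^ 2 := by positivity
  set N : ℤ := k1 ^ 2 + k2 ^ 2 + k3 ^ 2 with hN
  have hN0 : 0 < N := by positivity
  set A : ℤ := k3 ^ 2 + k1 ^ 2 with hA
  have hA0 : 0 < A := by positivity
  set c : ℤ := N ^ 2 * A * k3 ^ 2 with hc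
  have hc0 : 0 < c := by positivity
  set D : ℕ := (k3 ^ 2 * N).toNat with hD
  have hDZ : (D:ℤ) = k3 ^ 2 * N := Int.toNat_of_nonneg (by positivity)
  have hD1 : 1 ≤ D := by
    have : 0 < k3 ^ 2 * N := by positivity
    omega
  have hcR : (1:ℝ) ≤ c := by exact_mod_cast hc0
  obtain ⟨C, hC, hF⟩ := form_short D hD1 (γ / 2) (by positivity)
  refine ⟨C * (2 * c + (c:ℝ) ^ (γ / 2)), by positivity, ?_⟩
  intro R hR s
  set P := {p : Fin 3 → ℤ | R < latNorm p ∧ latNorm (p - k) ≤ R ∧ (∑ i, p i * k i) = s} with hP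
  have hRHS : 0 ≤ C * (2 * c + (c:ℝ) ^ (γ / 2)) * (|(s : ℝ)| + R ^ γ) := by positivity
  rcases P.eq_empty_or_nonempty with he | ⟨p0, hp0⟩
  · rw [he]; simpa using hRHS
  by_cases hfin : P.Finite
  swap
  · rw [Set.Infinite.ncard hfin]; simpa using hRHS
  have hR0 : 0 ≤ R := by linarith
  have hR2 : 1 ≤ R ^ 2 := by nlinarith
  -- basic inequalities
  have hprop : ∀ p ∈ P, (∑ i, p i * k i) = s ∧
      R ^ 2 < (p (σ 0) : ℝ) ^ 2 + (p (σ 1) : ℝ) ^ 2 + (p (σ 2) : ℝ) ^ 2 ∧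
      (p (σ 0) : ℝ) ^ 2 + (p (σ 1) : ℝ) ^ 2 + (p (σ 2) : ℝ) ^ 2 ≤ R ^ 2 + 2 * s - N := by
    rintro p ⟨h1, h2, h3⟩
    refine ⟨h3, ?_, ?_⟩
    · unfold latNorm at h1
      rw [hsumR] at h1
      exact (Real.lt_sqrt hR0).1 h1
    · unfold latNorm at h2
      rw [hsumR, Real.sqrt_le_left hR0] at h2
      rw [hsumZ] at h3
      have h3' : (p (σ 0) : ℝ) * k1 + p (σ 1) * k2 + p (σ 2) * k3 = s := by exact_mod_cast h3
      simp only [Pi.sub_apply] at h2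
      push_cast at h2 ⊢
      rw [hN]; push_cast
      nlinarith
  have hs0 : (0:ℝ) ≤ s := by
    obtain ⟨_, h1, h2⟩ := hprop p0 hp0
    have : (0:ℝ) < N := by exact_mod_cast hN0
    linarith
  set f : (Fin 3 → ℤ) → ℤ × ℤ := fun p => (N * (A * p (σ 0) + k1 * k2 * p (σ 1) - s * k1), N * p (σ 1) - s * k2) with hf
  have hinj : Set.InjOn f P := by
    intro p hp q hq h
    simp only [hf, Prod.mk.injEq] at h
    obtain ⟨h1, h2⟩ := h
    have hp3 := (hprop p hp).1
    have hq3 := (hprop q hq).1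
    rw [hsumZ] at hp3 hq3
    have e1 : p (σ 1) = q (σ 1) := mul_left_cancel₀ hN0.ne' (by linarith)
    have e0 : p (σ 0) = q (σ 0) := by
      have := mul_left_cancel₀ hN0.ne' h1
      rw [e1] at this
      exact mul_left_cancel₀ hA0.ne' (by linarith)
    have e2 : p (σ 2) = q (σ 2) := by
      rw [e1, e0] at hp3
      exact mul_right_cancel₀ hσ (by linarith)
    funext j
    obtain ⟨j', rfl⟩ := σ.surjective j
    fin_cases j'
    · exact e0
    · exact e1
    · exact e2
  have hcard : P.ncard = (hfin.toFinset.image f).card := by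
    rw [Finset.card_image_of_injOn (by simpa using hinj), Set.ncard_eq_toFinset_card P hfin]
  rw [hcard]
  have hb := hF (c * R ^ 2 - N * k3 ^ 2 * A * s ^ 2) (2 * c * s) (c * R ^ 2) (hfin.toFinset.image f) (by
      have h1 : (0:ℝ) < N := by exact_mod_cast hN0
      have h2 : (0:ℝ) < A := by exact_mod_cast hA0
      have : (0:ℝ) ≤ N * k3 ^ 2 * A * s ^ 2 := by positivity
      linarith) (by nlinarith) (by positivity) (by
      intro w hw
      obtain ⟨p, hp, rfl⟩ := Finset.mem_image.1 hw
      obtain ⟨h3, h1, h2⟩ := hprop p (hfin.mem_toFinset.1 hp)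
      rw [hsumZ] at h3
      have hid : (f p).1 ^ 2 + (D:ℤ) * (f p).2 ^ 2 = c * (p (σ 0) ^ 2 + p (σ 1) ^ 2 + p (σ 2) ^ 2) - N * k3 ^ 2 * A * s ^ 2 := by
        rw [hDZ]
        simp only [hf]
        rw [← h3, hc, hA, hN]
        simp only [← hk1, ← hk2, ← hk3]
        ring
      have hidR : ((f p).1:ℝ) ^ 2 + (D:ℝ) * ((f p).2:ℝ) ^ 2 = c * ((p (σ 0):ℝ) ^ 2 + (p (σ 1):ℝ) ^ 2 + (p (σ 2):ℝ) ^ 2) - N * k3 ^ 2 * A * s ^ 2 := by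
        exact_mod_cast hid
      rw [hidR]
      have hNR : (0:ℝ) < N := by exact_mod_cast hN0
      constructor
      · have := mul_lt_mul_of_pos_left h1 (show (0:ℝ) < c by linarith)
        linarith
      · have := mul_le_mul_of_nonneg_left h2 (show (0:ℝ) ≤ c by linarith)
        have : 0 ≤ (c:ℝ) * N := by positivity
        nlinarith)
  refine hb.trans ?_
  rw [abs_of_nonneg hs0, Real.mul_rpow (by linarith) (by positivity)]
  have e : (R ^ 2) ^ (γ / 2) = R ^ γ := by
    rw [← Real.rpow_natCast, ← Real.rpow_mul hR0]; congr 1; push_cast; ring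
  rw [e, mul_assoc C]
  refine mul_le_mul_of_nonneg_left ?_ hC.le
  have h1 : 0 ≤ R ^ γ := by positivity
  have h2 : 0 ≤ (c:ℝ) ^ (γ / 2) := by positivity
  nlinarith [mul_nonneg h2 hs0, mul_nonneg (zero_le_one.trans hcR) h1]
end

section
/- Let n ≥ 1, let u, v ∈ ℝⁿ with u_α > 0 for all α, let ε > 0 with |v_α| ≤ ε·u_α for all α, and let g > 0. Let d be the diagonal n×n matrix with diagonal entries u_α², and let M := d² + 2g·w wᵀ, where w ∈ ℝⁿ has entries w_α := u_α v_α. Then M is symmetric positive definite, and the matrix L₁ := d^{1/2} M^{−1/2} d^{1/2} − 𝟙 (where d^{1/2} is the diagonal matrix with entries u_α and M^{−1/2} is the inverse of the positive definite square root of M) satisfies |(L₁)_{α,β}| ≤ 2 g ε² · u_α u_β/(u_α² + u_β²) for all α, β; in particular |(L₁)_{α,β}| ≤ 2 g ε² · min{u_α/u_β, u_β/u_α}. -/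
open Matrix

open scoped ComplexOrder in
/-- The positive semidefinite square root of a positive semidefinite matrix
(the definition that Mathlib had under this name, since removed). -/
noncomputable def Matrix.PosSemidef.sqrt {n 𝕜 : Type*} [Fintype n] [RCLike 𝕜] [DecidableEq n]
    {A : Matrix n n 𝕜} (hA : A.PosSemidef) : Matrix n n 𝕜 :=
  hA.1.eigenvectorUnitary.1 * diagonal ((↑) ∘ Real.sqrt ∘ hA.1.eigenvalues) *
  (star hA.1.eigenvectorUnitary : Matrix n n 𝕜)

open MeasureTheory Filter Topology in
theorem aux_int (l : ℝ) (hl : 0 < l) :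
    IntegrableOn (fun t : ℝ => 1 / (l ^ 2 + t ^ 2)) (Set.Ioi 0) ∧
      ∫ t in Set.Ioi (0:ℝ), 1 / (l ^ 2 + t ^ 2) = Real.pi / 2 * (1 / l) := by
  have hd : ∀ x ∈ Set.Ici (0:ℝ), HasDerivAt (fun t : ℝ => (1 / l) * Real.arctan (t / l))
      (1 / (l ^ 2 + x ^ 2)) x := by
    intro x _
    have h1 : HasDerivAt (fun t : ℝ => t / l) (1 / l) x := (hasDerivAt_id x).div_const l
    have h2 := (h1.arctan).const_mul (1 / l)
    refine h2.congr_deriv ?_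
    have : 0 < l ^ 2 + x ^ 2 := by positivity
    have : 0 < 1 + (x / l) ^ 2 := by positivity
    field_simp
  have ht : Tendsto (fun t : ℝ => (1 / l) * Real.arctan (t / l)) atTop
      (𝓝 ((1 / l) * (Real.pi / 2))) := by
    apply Tendsto.const_mul
    have := Real.tendsto_arctan_atTop.mono_right nhdsWithin_le_nhds
    exact this.comp (tendsto_id.atTop_div_const hl)
  have hp : ∀ x ∈ Set.Ioi (0:ℝ), 0 ≤ 1 / (l ^ 2 + x ^ 2) := fun x _ => by positivity
  refine ⟨integrableOn_Ioi_deriv_of_nonneg' hd hp ht, ?_⟩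
  rw [integral_Ioi_of_hasDerivAt_of_nonneg' hd hp ht]
  simp
  ring

open MeasureTheory Filter Topology in
theorem aux_int2 (a b : ℝ) (ha : 0 < a) (hb : 0 < b) :
    IntegrableOn (fun t : ℝ => 1 / ((a ^ 2 + t ^ 2) * (b ^ 2 + t ^ 2))) (Set.Ioi 0) ∧
      ∫ t in Set.Ioi (0:ℝ), 1 / ((a ^ 2 + t ^ 2) * (b ^ 2 + t ^ 2))
        = Real.pi / 2 * (1 / (a * b * (a + b))) := by
  by_cases hab : a = b
  · subst hab
    have hd : ∀ x ∈ Set.Ici (0:ℝ), HasDerivAt (fun t : ℝ => (1 / (2 * a ^ 2)) * (t / (a ^ 2 + t ^ 2))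
        + (1 / (2 * a ^ 3)) * Real.arctan (t / a))
        (1 / ((a ^ 2 + x ^ 2) * (a ^ 2 + x ^ 2))) x := by
      intro x _
      have h1 : HasDerivAt (fun t : ℝ => t / a) (1 / a) x := (hasDerivAt_id x).div_const a
      have h2 := (h1.arctan).const_mul (1 / (2 * a ^ 3))
      have hq : 0 < a ^ 2 + x ^ 2 := by positivity
      have h3 : HasDerivAt (fun t : ℝ => a ^ 2 + t ^ 2) (2 * x) x := by
        simpa using (hasDerivAt_pow 2 x).const_add (a ^ 2)
      have h4 := ((hasDerivAt_id x).div h3 hq.ne').const_mul (1 / (2 * a ^ 2))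
      refine (h4.add h2).congr_deriv ?_
      have e : 1 + (x / a) ^ 2 = (a ^ 2 + x ^ 2) / a ^ 2 := by field_simp
      rw [e]
      simp only [id]
      field_simp
      ring
    have ht : Tendsto (fun t : ℝ => (1 / (2 * a ^ 2)) * (t / (a ^ 2 + t ^ 2))
        + (1 / (2 * a ^ 3)) * Real.arctan (t / a)) atTop
        (𝓝 ((1 / (2 * a ^ 2)) * 0 + (1 / (2 * a ^ 3)) * (Real.pi / 2))) := by
      apply Tendsto.add
      · apply Tendsto.const_mul
        refine squeeze_zero' (g := fun t : ℝ => t⁻¹) ?_ ?_ tendsto_inv_atTop_zero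
        · filter_upwards [eventually_gt_atTop 0] with t ht
          positivity
        · filter_upwards [eventually_gt_atTop 0] with t ht
          rw [div_le_iff₀ (by positivity)]
          field_simp
          nlinarith [sq_nonneg a]
      · apply Tendsto.const_mul
        have := Real.tendsto_arctan_atTop.mono_right nhdsWithin_le_nhds
        exact this.comp (tendsto_id.atTop_div_const ha)
    have hp : ∀ x ∈ Set.Ioi (0:ℝ), 0 ≤ 1 / ((a ^ 2 + x ^ 2) * (a ^ 2 + x ^ 2)) :=
      fun x _ => by positivity
    refine ⟨integrableOn_Ioi_deriv_of_nonneg' hd hp ht, ?_⟩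
    rw [integral_Ioi_of_hasDerivAt_of_nonneg' hd hp ht]
    simp
    field_simp
    norm_num
  · have hne : b - a ≠ 0 := fun h => hab (by linarith)
    have hne2 : b ^ 2 - a ^ 2 ≠ 0 := by
      have : b ^ 2 - a ^ 2 = (b - a) * (b + a) := by ring
      rw [this]; exact mul_ne_zero hne (by positivity)
    have e : (fun t : ℝ => 1 / ((a ^ 2 + t ^ 2) * (b ^ 2 + t ^ 2)))
        = fun t => (1 / (b ^ 2 - a ^ 2)) * (1 / (a ^ 2 + t ^ 2) - 1 / (b ^ 2 + t ^ 2)) := by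
      funext t
      have : 0 < a ^ 2 + t ^ 2 := by positivity
      have : 0 < b ^ 2 + t ^ 2 := by positivity
      field_simp
      ring
    obtain ⟨i1, v1⟩ := aux_int a ha
    obtain ⟨i2, v2⟩ := aux_int b hb
    rw [e]
    refine ⟨(i1.sub i2).const_mul _, ?_⟩
    rw [integral_const_mul, integral_sub i1 i2, v1, v2]
    have : b ^ 2 - a ^ 2 = (b - a) * (b + a) := by ring
    rw [this]
    field_simp
    ring

theorem aux_sm {n : ℕ} (p w : Fin n → ℝ) (hp : ∀ i, 0 < p i) (c : ℝ) (hc : 0 < c) :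
    (diagonal p + c • vecMulVec w w) * (diagonal (fun i => 1 / p i) -
      (c / (1 + c * ∑ i, w i ^ 2 / p i)) •
        vecMulVec (fun i => w i / p i) (fun i => w i / p i)) = 1 := by
  have hs : 0 ≤ ∑ i, w i ^ 2 / p i :=
    Finset.sum_nonneg fun i _ => div_nonneg (sq_nonneg _) (hp i).le
  set s := ∑ i, w i ^ 2 / p i with hsdef
  have hpos : 0 < 1 + c * s := by positivity
  have e1 : diagonal p * diagonal (fun i => 1 / p i) = 1 := by
    rw [diagonal_mul_diagonal, ← diagonal_one]
    congr 1
    funext i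
    have := (hp i).ne'
    field_simp
  have e2 : diagonal p * vecMulVec (fun i => w i / p i) (fun i => w i / p i)
      = vecMulVec w (fun i => w i / p i) := by
    ext i j
    have := (hp i).ne'
    simp only [diagonal_mul, vecMulVec_apply]
    field_simp
  have e3 : vecMulVec w w * diagonal (fun i => 1 / p i) = vecMulVec w (fun i => w i / p i) := by
    ext i j
    simp only [mul_diagonal, vecMulVec_apply]
    ring
  have e4 : vecMulVec w w * vecMulVec (fun i => w i / p i) (fun i => w i / p i)
      = s • vecMulVec w (fun i => w i / p i) := by
    ext i j
    simp only [Matrix.mul_apply, vecMulVec_apply, Matrix.smul_apply, smul_eq_mul, hsdef, Finset.sum_mul]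
    refine Finset.sum_congr rfl fun k _ => ?_
    ring
  rw [mul_sub, add_mul, add_mul, mul_smul_comm, mul_smul_comm, smul_mul_assoc, smul_mul_assoc,
    e1, e2, e3, e4]
  ext i j
  simp only [Matrix.add_apply, Matrix.sub_apply, Matrix.smul_apply, smul_eq_mul]
  field_simp
  ring

open MeasureTheory in
theorem aux_main {n : ℕ} (a w : Fin n → ℝ) (ha : ∀ i, 0 < a i) (c : ℝ) (hc : 0 < c)
    (Q : Matrix (Fin n) (Fin n) ℝ) (μ : Fin n → ℝ) (hμ : ∀ i, 0 < μ i)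
    (h1 : Q * star Q = 1) (h2 : star Q * Q = 1)
    (hM : diagonal a ^ 2 + c • vecMulVec w w = Q * diagonal μ * star Q) (α β : Fin n) :
    |(Q * diagonal (fun i => 1 / Real.sqrt (μ i)) * star Q) α β
        - diagonal (fun i => 1 / a i) α β|
      ≤ c * |w α * w β| * (1 / (a α * a β * (a α + a β))) := by
  have entry : ∀ f : Fin n → ℝ, (Q * diagonal f * star Q) α β = ∑ i, Q α i * Q β i * f i := by
    intro f
    rw [Matrix.mul_apply]
    refine Finset.sum_congr rfl fun i _ => ?_
    rw [mul_diagonal, Matrix.star_apply, star_trivial]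
    ring
  let F : ℝ → ℝ := fun t => (Q * diagonal (fun i => 1 / (μ i + t ^ 2)) * star Q : Matrix (Fin n) (Fin n) ℝ) α β
    - diagonal (fun i => 1 / (a i ^ 2 + t ^ 2)) α β
  let G : ℝ → ℝ := fun t => c * |w α * w β| * (1 / ((a α ^ 2 + t ^ 2) * (a β ^ 2 + t ^ 2)))
  have hFG : ∀ t, ‖F t‖ ≤ G t := by
    intro t
    have hp : ∀ i, 0 < a i ^ 2 + t ^ 2 := fun i => by have := ha i; positivity
    have hS := aux_sm (fun i => a i ^ 2 + t ^ 2) w hp c hc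
    have hN : (Q * diagonal (fun i => 1 / (μ i + t ^ 2)) * star Q) *
        (diagonal (fun i => a i ^ 2 + t ^ 2) + c • vecMulVec w w) = 1 := by
      have e : diagonal (fun i => a i ^ 2 + t ^ 2) + c • vecMulVec w w
          = Q * diagonal (fun i => μ i + t ^ 2) * star Q := by
        have e1 : diagonal (fun i => a i ^ 2 + t ^ 2)
            = diagonal a ^ 2 + t ^ 2 • (1 : Matrix (Fin n) (Fin n) ℝ) := by
          rw [diagonal_pow, smul_one_eq_diagonal, diagonal_add]; rfl
        have e2 : diagonal (fun i => μ i + t ^ 2)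
            = diagonal μ + t ^ 2 • (1 : Matrix (Fin n) (Fin n) ℝ) := by
          rw [smul_one_eq_diagonal, diagonal_add]
        rw [e1, e2, mul_add, add_mul, ← hM, mul_smul_comm, smul_mul_assoc, mul_one, h1]
        abel
      rw [e]
      have e3 : diagonal (fun i => 1 / (μ i + t ^ 2)) * diagonal (fun i => μ i + t ^ 2) = 1 := by
        rw [diagonal_mul_diagonal, ← diagonal_one]
        congr 1
        funext i
        have : 0 < μ i + t ^ 2 := by have := hμ i; positivity
        field_simp
      calc _ = Q * diagonal (fun i => 1 / (μ i + t ^ 2)) * (star Q * Q) *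
            diagonal (fun i => μ i + t ^ 2) * star Q := by simp only [mul_assoc]
        _ = Q * (diagonal (fun i => 1 / (μ i + t ^ 2)) * diagonal (fun i => μ i + t ^ 2)) *
            star Q := by rw [h2, mul_one, mul_assoc Q]
        _ = 1 := by rw [e3, mul_one, h1]
    have hNS := left_inv_eq_right_inv hN hS
    have hs : 0 ≤ ∑ i, w i ^ 2 / (a i ^ 2 + t ^ 2) :=
      Finset.sum_nonneg fun i _ => div_nonneg (sq_nonneg _) (hp i).le
    set s := ∑ i, w i ^ 2 / (a i ^ 2 + t ^ 2) with hsdef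
    have hFt : F t = - ((c / (1 + c * s)) *
        (w α * w β * (1 / ((a α ^ 2 + t ^ 2) * (a β ^ 2 + t ^ 2))))) := by
      simp only [F]
      rw [hNS]
      simp only [Matrix.sub_apply, Matrix.smul_apply, smul_eq_mul, vecMulVec_apply]
      rw [sub_sub_cancel_left, one_div, mul_inv]
      simp only [div_eq_mul_inv]
      ring
    have hk : c / (1 + c * s) ≤ c := div_le_self hc.le (by nlinarith)
    have hk0 : 0 ≤ c / (1 + c * s) := by positivity
    have hq : 0 ≤ 1 / ((a α ^ 2 + t ^ 2) * (a β ^ 2 + t ^ 2)) := by positivity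
    rw [hFt, norm_neg, Real.norm_eq_abs, abs_mul, abs_mul (w α * w β), abs_of_nonneg hk0,
      abs_of_nonneg hq, ← mul_assoc]
    simp only [G]
    gcongr
  obtain ⟨gi, gv⟩ := aux_int2 (a α) (a β) (ha α) (ha β)
  have hI := norm_integral_le_of_norm_le (μ := volume.restrict (Set.Ioi (0:ℝ)))
    (f := F) (g := G) (gi.const_mul _) (Filter.Eventually.of_forall hFG)
  have hG : ∫ t in Set.Ioi (0:ℝ), G t
      = Real.pi / 2 * (c * |w α * w β| * (1 / (a α * a β * (a α + a β)))) := by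
    simp only [G]
    rw [integral_const_mul, gv]
    ring
  have hi : ∀ i, IntegrableOn (fun t : ℝ => 1 / (μ i + t ^ 2)) (Set.Ioi 0) ∧
      ∫ t in Set.Ioi (0:ℝ), 1 / (μ i + t ^ 2) = Real.pi / 2 * (1 / Real.sqrt (μ i)) := by
    intro i
    have := aux_int (Real.sqrt (μ i)) (Real.sqrt_pos.2 (hμ i))
    rwa [Real.sq_sqrt (hμ i).le] at this
  have hdiag : IntegrableOn (fun t : ℝ => diagonal (fun i => 1 / (a i ^ 2 + t ^ 2)) α β) (Set.Ioi 0) ∧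
      ∫ t in Set.Ioi (0:ℝ), diagonal (fun i => 1 / (a i ^ 2 + t ^ 2)) α β
        = Real.pi / 2 * diagonal (fun i => 1 / a i) α β := by
    by_cases h : α = β
    · subst h
      simpa only [diagonal_apply_eq] using aux_int (a α) (ha α)
    · simp [diagonal_apply_ne _ h]
  have hF : ∫ t in Set.Ioi (0:ℝ), F t
      = Real.pi / 2 * ((Q * diagonal (fun i => 1 / Real.sqrt (μ i)) * star Q) α β
        - diagonal (fun i => 1 / a i) α β) := by
    simp only [F, entry]
    rw [integral_sub _ hdiag.1, hdiag.2, integral_finsetSum]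
    · simp only [integral_const_mul, (hi _).2]
      rw [mul_sub, Finset.mul_sum]
      congr 1
      refine Finset.sum_congr rfl fun i _ => ?_
      ring
    · intro i _
      exact (hi i).1.const_mul _
    · exact integrable_finsetSum _ fun i _ => (hi i).1.const_mul _
  rw [hF, hG, Real.norm_eq_abs, abs_mul, abs_of_pos (by positivity : 0 < Real.pi / 2)] at hI
  exact le_of_mul_le_mul_left hI (by positivity)

/-- Entrywise bound on `L₁ = d^{1/2} M^{-1/2} d^{1/2} - 𝟙` where
`d = diag(u_α²)` and `M = d² + 2g·w wᵀ` with `w_α = u_α v_α`, `|v_α| ≤ ε u_α`. -/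
theorem L1_entrywise_bound {n : ℕ} (hn : 1 ≤ n) (u v : Fin n → ℝ) (hu : ∀ α, 0 < u α)
    (ε : ℝ) (hε : 0 < ε) (hv : ∀ α, |v α| ≤ ε * u α) (g : ℝ) (hg : 0 < g) :
    ∃ hM : ((Matrix.diagonal fun α => u α ^ 2) ^ 2
        + (2 * g) • Matrix.vecMulVec (fun α => u α * v α) (fun α => u α * v α)).PosDef,
      ∀ α β : Fin n,
        |(Matrix.diagonal u * (hM.posSemidef.sqrt)⁻¹ * Matrix.diagonal u - 1) α β|
            ≤ 2 * g * ε ^ 2 * (u α * u β / (u α ^ 2 + u β ^ 2)) ∧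
        |(Matrix.diagonal u * (hM.posSemidef.sqrt)⁻¹ * Matrix.diagonal u - 1) α β|
            ≤ 2 * g * ε ^ 2 * min (u α / u β) (u β / u α) := by
  have hd : (diagonal fun α => u α ^ 2).PosDef := PosDef.diagonal fun i => by
    have := hu i; positivity
  have hM : ((Matrix.diagonal fun α => u α ^ 2) ^ 2
        + (2 * g) • Matrix.vecMulVec (fun α => u α * v α) (fun α => u α * v α)).PosDef := by
    apply PosDef.add_posSemidef
    · rw [diagonal_pow]
      refine PosDef.diagonal fun i => ?_
      have := hu i
      simp only [Pi.pow_apply]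
      positivity
    · refine PosSemidef.smul ?_ (by positivity)
      simpa using posSemidef_vecMulVec_self_star (fun α => u α * v α)
  refine ⟨hM, ?_⟩
  intro α β
  set Q : Matrix (Fin n) (Fin n) ℝ := hM.posSemidef.1.eigenvectorUnitary.1 with hQ
  set μ : Fin n → ℝ := hM.posSemidef.1.eigenvalues with hμdef
  have hμ : ∀ i, 0 < μ i := fun i => hM.eigenvalues_pos i
  have h1 : Q * star Q = 1 := Unitary.coe_mul_star_self hM.posSemidef.1.eigenvectorUnitary
  have h2 : star Q * Q = 1 := Unitary.coe_star_mul_self hM.posSemidef.1.eigenvectorUnitary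
  have hspec : (Matrix.diagonal fun α => u α ^ 2) ^ 2
        + (2 * g) • Matrix.vecMulVec (fun α => u α * v α) (fun α => u α * v α)
        = Q * diagonal μ * star Q := by
    exact hM.posSemidef.1.spectral_theorem
  have hsq : hM.posSemidef.sqrt = Q * diagonal (fun i => Real.sqrt (μ i)) * star Q := rfl
  have hinv : (hM.posSemidef.sqrt)⁻¹ = Q * diagonal (fun i => 1 / Real.sqrt (μ i)) * star Q := by
    apply Matrix.inv_eq_right_inv
    rw [hsq]
    have e3 : diagonal (fun i => Real.sqrt (μ i)) * diagonal (fun i => 1 / Real.sqrt (μ i)) = 1 := by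
      rw [diagonal_mul_diagonal, ← diagonal_one]
      congr 1
      funext i
      have := (Real.sqrt_pos.2 (hμ i)).ne'
      field_simp
    calc _ = Q * diagonal (fun i => Real.sqrt (μ i)) * (star Q * Q) *
            diagonal (fun i => 1 / Real.sqrt (μ i)) * star Q := by simp only [mul_assoc]
        _ = Q * (diagonal (fun i => Real.sqrt (μ i)) * diagonal (fun i => 1 / Real.sqrt (μ i))) *
            star Q := by rw [h2, mul_one, mul_assoc Q]
        _ = 1 := by rw [e3, mul_one, h1]
  have key := aux_main (fun i => u i ^ 2) (fun i => u i * v i)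
    (fun i => by have := hu i; positivity) (2 * g) (by positivity) Q μ hμ h1 h2 hspec α β
  rw [← hinv] at key
  have ua := hu α
  have ub := hu β
  have hL : (Matrix.diagonal u * (hM.posSemidef.sqrt)⁻¹ * Matrix.diagonal u - 1) α β
      = u α * u β * ((hM.posSemidef.sqrt)⁻¹ α β - diagonal (fun i => 1 / u i ^ 2) α β) := by
    rw [Matrix.sub_apply, mul_diagonal, diagonal_mul]
    by_cases h : α = β
    · subst h
      rw [diagonal_apply_eq, Matrix.one_apply_eq]
      field_simp
    · rw [diagonal_apply_ne _ h, Matrix.one_apply_ne h]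
      ring
  have main : |(Matrix.diagonal u * (hM.posSemidef.sqrt)⁻¹ * Matrix.diagonal u - 1) α β|
            ≤ 2 * g * ε ^ 2 * (u α * u β / (u α ^ 2 + u β ^ 2)) := by
    rw [hL, abs_mul, abs_of_pos (mul_pos ua ub)]
    have hvv : |v α| * |v β| ≤ (ε * u α) * (ε * u β) :=
      mul_le_mul (hv α) (hv β) (abs_nonneg _) (by positivity)
    calc _ ≤ u α * u β * (2 * g * |u α * v α * (u β * v β)| *
          (1 / (u α ^ 2 * u β ^ 2 * (u α ^ 2 + u β ^ 2)))) :=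
          mul_le_mul_of_nonneg_left key (by positivity)
      _ = 2 * g * (|v α| * |v β|) / (u α ^ 2 + u β ^ 2) := by
          rw [abs_mul, abs_mul, abs_mul, abs_of_pos ua, abs_of_pos ub]
          field_simp
      _ ≤ 2 * g * ((ε * u α) * (ε * u β)) / (u α ^ 2 + u β ^ 2) := by gcongr
      _ = _ := by ring
  refine ⟨main, main.trans ?_⟩
  refine mul_le_mul_of_nonneg_left (le_min ?_ ?_) (by positivity)
  · rw [div_le_div_iff₀ (by positivity) ub]
    nlinarith [pow_pos ua 3]
  · rw [div_le_div_iff₀ (by positivity) ua]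
    nlinarith [pow_pos ub 3]
end

section
/- Let n ≥ 1, let u ∈ ℝⁿ have strictly positive entries, let M ≥ n be a real number and let 0 < c < 1. Suppose L is a real n×n matrix satisfying |L_{α,β}| ≤ (c/M)·min{u_α/u_β, u_β/u_α} for all α, β. Then for every integer m ≥ 1 one has |(L^m)_{α,β}| ≤ (c^m/M)·min{u_α/u_β, u_β/u_α}; consequently the series K := (1/2) ∑_{m≥1} (−1)^{m+1} L^m/m converges absolutely entrywise and satisfies |K_{α,β}| ≤ (−log(1 − c)/(2M))·min{u_α/u_β, u_β/u_α} for all α, β. -/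
/-- Propagation of a weighted entrywise bound from a matrix `L` to its
powers `L^m` and to the series `K = (1/2)∑_{m≥1} (−1)^{m+1} L^m/m` for `(1/2)log(𝟙+L)`. -/
theorem bogoliubov_kernel_entrywise_bound {n : ℕ} (hn : 1 ≤ n) (u : Fin n → ℝ)
    (hu : ∀ α, 0 < u α) (M : ℝ) (hM : (n : ℝ) ≤ M) (c : ℝ) (hc0 : 0 < c) (hc1 : c < 1)
    (L : Matrix (Fin n) (Fin n) ℝ)
    (hL : ∀ α β, |L α β| ≤ c / M * min (u α / u β) (u β / u α)) :
    (∀ m : ℕ, 1 ≤ m → ∀ α β,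
        |(L ^ m) α β| ≤ c ^ m / M * min (u α / u β) (u β / u α)) ∧
    ∀ α β : Fin n,
      Summable (fun m : ℕ => |(1 / 2 : ℝ) * ((-1 : ℝ) ^ m * (L ^ (m + 1)) α β / (m + 1))|) ∧
      |∑' m : ℕ, (1 / 2 : ℝ) * ((-1 : ℝ) ^ m * (L ^ (m + 1)) α β / (m + 1))|
        ≤ (-Real.log (1 - c)) / (2 * M) * min (u α / u β) (u β / u α) := by
  have hn' : (1 : ℝ) ≤ n := by exact_mod_cast hn
  have hM0 : 0 < M := by linarith
  have hw0 : ∀ a b, 0 ≤ min (u a / u b) (u b / u a) := fun a b =>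
    le_min (div_pos (hu a) (hu b)).le (div_pos (hu b) (hu a)).le
  have hw : ∀ a g b, min (u a / u g) (u g / u a) * min (u g / u b) (u b / u g)
      ≤ min (u a / u b) (u b / u a) := by
    intro a g b
    have ha := hu a
    have hg := hu g
    have hb := hu b
    refine le_min ?_ ?_
    · calc _ ≤ (u a / u g) * (u g / u b) :=
            mul_le_mul (min_le_left _ _) (min_le_left _ _) (hw0 _ _) (by positivity)
        _ = _ := by field_simp
    · calc _ ≤ (u g / u a) * (u b / u g) :=
            mul_le_mul (min_le_right _ _) (min_le_right _ _) (hw0 _ _) (by positivity)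
        _ = _ := by field_simp
  have hpow : ∀ m : ℕ, 1 ≤ m → ∀ α β,
      |(L ^ m) α β| ≤ c ^ m / M * min (u α / u β) (u β / u α) := by
    intro m hm
    induction m, hm using Nat.le_induction with
    | base => simpa using hL
    | succ m hm ih =>
      intro α β
      rw [pow_succ, Matrix.mul_apply]
      calc |∑ g, (L ^ m) α g * L g β| ≤ ∑ g, |(L ^ m) α g * L g β| :=
            Finset.abs_sum_le_sum_abs _ _
        _ ≤ ∑ _g : Fin n, (c ^ m / M * (c / M)) * min (u α / u β) (u β / u α) := by
            refine Finset.sum_le_sum fun g _ => ?_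
            rw [abs_mul]
            calc _ ≤ (c ^ m / M * min (u α / u g) (u g / u α)) *
                  (c / M * min (u g / u β) (u β / u g)) :=
                  mul_le_mul (ih α g) (hL g β) (abs_nonneg _)
                    (mul_nonneg (by positivity) (hw0 _ _))
              _ = (c ^ m / M * (c / M)) *
                  (min (u α / u g) (u g / u α) * min (u g / u β) (u β / u g)) := by ring
              _ ≤ _ := mul_le_mul_of_nonneg_left (hw α g β) (by positivity)
        _ = (n / M) * (c ^ (m + 1) / M * min (u α / u β) (u β / u α)) := by
            simp only [Finset.sum_const, Finset.card_univ, Fintype.card_fin, nsmul_eq_mul]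
            ring
        _ ≤ 1 * (c ^ (m + 1) / M * min (u α / u β) (u β / u α)) :=
            mul_le_mul_of_nonneg_right ((div_le_one hM0).2 hM)
              (mul_nonneg (by positivity) (hw0 _ _))
        _ = _ := one_mul _
  refine ⟨hpow, fun α β => ?_⟩
  have hs := (Real.hasSum_pow_div_log_of_abs_lt_one
    (x := c) (by rw [abs_of_pos hc0]; exact hc1)).mul_right
      (1 / (2 * M) * min (u α / u β) (u β / u α))
  have hb : ∀ m : ℕ, |(1 / 2 : ℝ) * ((-1 : ℝ) ^ m * (L ^ (m + 1)) α β / (m + 1))|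
      ≤ c ^ (m + 1) / ((m : ℝ) + 1) * (1 / (2 * M) * min (u α / u β) (u β / u α)) := by
    intro m
    have h1 : (0 : ℝ) < (m : ℝ) + 1 := by positivity
    rw [abs_mul, abs_of_pos (by norm_num : (0 : ℝ) < 1 / 2), abs_div, abs_mul, abs_pow,
      abs_neg, abs_one, one_pow, one_mul, abs_of_pos h1]
    calc _ ≤ 1 / 2 * (c ^ (m + 1) / M * min (u α / u β) (u β / u α) / ((m : ℝ) + 1)) := by
          have := hpow (m + 1) (by omega) α β
          gcongr
      _ = _ := by field_simp
  have hsum := Summable.of_nonneg_of_le (fun m => abs_nonneg _) hb hs.summable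
  refine ⟨hsum, ?_⟩
  have h2 := tsum_of_norm_bounded hs (f := fun m : ℕ =>
    (1 / 2 : ℝ) * ((-1 : ℝ) ^ m * (L ^ (m + 1)) α β / (m + 1))) hb
  rw [Real.norm_eq_abs] at h2
  refine h2.trans (le_of_eq ?_)
  ring
end

section
/- Let H be a complex Hilbert space, let A be a bounded nonnegative self-adjoint operator on H, and let (P_i)_{i∈ℕ} be mutually orthogonal orthogonal projections on H with ∑_{i∈ℕ} P_i x = x for every x ∈ H. Let ℓ ≥ 1 be an integer and assume P_i A P_j = 0 whenever |i − j| > ℓ. Let f, g : [0,∞) → [0,1] be Lipschitz functions with f(t)² + g(t)² = 1 for all t, and for L ≥ 1 define the bounded operators f_L x := ∑_i f(i/L) P_i x, g_L x := ∑_i g(i/L) P_i x, and A_diag x := ∑_i P_i A P_i x. Then for every x ∈ H, |⟨x, (A − f_L A f_L − g_L A g_L) x⟩| ≤ (C_f ℓ³/L²)·⟨x, A_diag x⟩, where C_f := 2(Lip(f)² + Lip(g)²) and Lip(f), Lip(g) denote Lipschitz constants of f and g. -/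
open scoped BigOperators

lemma pnl_cs {H : Type*} [NormedAddCommGroup H] [InnerProductSpace ℂ H] [CompleteSpace H]
    (A : H →L[ℂ] H) (hA_sa : IsSelfAdjoint A)
    (hA_pos : ∀ x : H, 0 ≤ (inner ℂ x (A x) : ℂ).re) (u v : H) :
    ‖(inner ℂ u (A v) : ℂ)‖ ≤ ((inner ℂ u (A u) : ℂ).re + (inner ℂ v (A v) : ℂ).re) / 2 := by
  obtain ⟨c, hc, hcz⟩ : ∃ c : ℂ, ‖c‖ = 1 ∧ c * inner ℂ u (A v) = (‖(inner ℂ u (A v) : ℂ)‖ : ℂ) := by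
    by_cases hz : (inner ℂ u (A v) : ℂ) = 0
    · exact ⟨1, by simp, by simp [hz]⟩
    · refine ⟨(‖(inner ℂ u (A v) : ℂ)‖ : ℂ) / inner ℂ u (A v), ?_, ?_⟩
      · have := norm_ne_zero_iff.2 hz
        rw [norm_div]; simp [this]
      · field_simp
  have h := hA_pos (u - c • v)
  have hsym : (inner ℂ v (A u) : ℂ) = (starRingEnd ℂ) (inner ℂ u (A v)) := by
    rw [inner_conj_symm, ← ContinuousLinearMap.adjoint_inner_right,
      ContinuousLinearMap.isSelfAdjoint_iff'.1 hA_sa]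
  have hcc : (starRingEnd ℂ) c * c = 1 := by
    rw [mul_comm, Complex.mul_conj, Complex.normSq_eq_norm_sq, hc]; simp
  have e : (inner ℂ (u - c • v) (A (u - c • v)) : ℂ)
      = inner ℂ u (A u) + inner ℂ v (A v) - c * inner ℂ u (A v)
        - (starRingEnd ℂ) (c * inner ℂ u (A v)) := by
    simp only [map_sub, map_smul, inner_sub_left, inner_sub_right, inner_smul_left,
      inner_smul_right, hsym, map_mul]
    linear_combination (inner ℂ v (A v)) * hcc
  rw [e, hcz] at h
  simp at h
  linarith

lemma pnl_count (N ℓ i : ℕ) (hℓ : 1 ≤ ℓ) :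
    (∑ j ∈ Finset.range N, if |(i : ℤ) - (j : ℤ)| ≤ (ℓ : ℤ) then (1 : ℝ) else 0) ≤ 4 * ℓ := by
  rw [Finset.sum_boole]
  have : (Finset.range N).filter (fun j : ℕ => |(i : ℤ) - (j : ℤ)| ≤ (ℓ : ℤ))
      ⊆ Finset.Icc (i - ℓ) (i + ℓ) := by
    intro j hj
    simp only [Finset.mem_filter, Finset.mem_range, abs_le, Finset.mem_Icc] at hj ⊢
    omega
  have h := Finset.card_le_card this
  rw [Nat.card_Icc] at h
  have h2 : ((Finset.range N).filter (fun j : ℕ => |(i : ℤ) - (j : ℤ)| ≤ (ℓ : ℤ))).card ≤ 4 * ℓ := by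
    omega
  exact_mod_cast h2

lemma pnl_sum (N ℓ : ℕ) (hℓ : 1 ≤ ℓ) (a : ℕ → ℝ) (ha : ∀ i, 0 ≤ a i) :
    (∑ i ∈ Finset.range N, ∑ j ∈ Finset.range N,
      (if |(i : ℤ) - (j : ℤ)| ≤ (ℓ : ℤ) then (1 : ℝ) else 0) * ((a i + a j) / 2))
      ≤ 4 * ℓ * ∑ i ∈ Finset.range N, a i := by
  set w : ℕ → ℕ → ℝ := fun i j => if |(i : ℤ) - (j : ℤ)| ≤ (ℓ : ℤ) then (1 : ℝ) else 0 with hw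
  have hs : ∀ i j, w i j = w j i := by
    intro i j; simp only [hw]; rw [abs_sub_comm]
  have h1 : (∑ i ∈ Finset.range N, ∑ j ∈ Finset.range N, w i j * ((a i + a j) / 2))
      = ∑ i ∈ Finset.range N, ∑ j ∈ Finset.range N, w i j * a i := by
    have e1 : (∑ i ∈ Finset.range N, ∑ j ∈ Finset.range N, w i j * a j)
      = ∑ i ∈ Finset.range N, ∑ j ∈ Finset.range N, w i j * a i := by
      rw [Finset.sum_comm]
      exact Finset.sum_congr rfl fun i _ => Finset.sum_congr rfl fun j _ => by rw [hs]
    have e2 : (∑ i ∈ Finset.range N, ∑ j ∈ Finset.range N, w i j * ((a i + a j) / 2))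
      = ((∑ i ∈ Finset.range N, ∑ j ∈ Finset.range N, w i j * a i)
        + ∑ i ∈ Finset.range N, ∑ j ∈ Finset.range N, w i j * a j) / 2 := by
      simp only [← Finset.sum_add_distrib, Finset.sum_div]
      exact Finset.sum_congr rfl fun i _ => Finset.sum_congr rfl fun j _ => by ring
    rw [e2, e1]; ring
  rw [h1, Finset.mul_sum]
  refine Finset.sum_le_sum fun i _ => ?_
  rw [← Finset.sum_mul]
  exact mul_le_mul_of_nonneg_right (pnl_count N ℓ i hℓ) (ha i)



/-- Localization on Fock space, Lieb–Solovej / Lewin–Nam–Serfaty–Solovej.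
Double-commutator IMS localization bound for a nonnegative banded operator with respect to
a family of mutually orthogonal projections. -/
theorem particle_number_localization
    {H : Type*} [NormedAddCommGroup H] [InnerProductSpace ℂ H] [CompleteSpace H]
    (A : H →L[ℂ] H) (hA_sa : IsSelfAdjoint A)
    (hA_pos : ∀ x : H, 0 ≤ (inner ℂ x (A x) : ℂ).re)
    (P : ℕ → H →L[ℂ] H)
    (hP_sa : ∀ i, IsSelfAdjoint (P i))
    (hP_idem : ∀ i, P i * P i = P i)
    (hP_orth : ∀ i j, i ≠ j → P i * P j = 0)
    (hP_complete : ∀ x : H, HasSum (fun i : ℕ => P i x) x)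
    (ℓ : ℕ) (hℓ : 1 ≤ ℓ)
    (hband : ∀ i j : ℕ, (ℓ : ℤ) < |(i : ℤ) - (j : ℤ)| → P i * A * P j = 0)
    (f g : ℝ → ℝ) (Kf Kg : NNReal)
    (hf_lip : LipschitzOnWith Kf f (Set.Ici 0))
    (hg_lip : LipschitzOnWith Kg g (Set.Ici 0))
    (hf_range : ∀ t : ℝ, 0 ≤ t → f t ∈ Set.Icc (0 : ℝ) 1)
    (hg_range : ∀ t : ℝ, 0 ≤ t → g t ∈ Set.Icc (0 : ℝ) 1)
    (hfg : ∀ t : ℝ, 0 ≤ t → f t ^ 2 + g t ^ 2 = 1)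
    (L : ℝ) (hL : 1 ≤ L)
    (fL gL Adiag : H →L[ℂ] H)
    (hfL : ∀ x : H, HasSum (fun i : ℕ => (f (i / L) : ℂ) • P i x) (fL x))
    (hgL : ∀ x : H, HasSum (fun i : ℕ => (g (i / L) : ℂ) • P i x) (gL x))
    (hAdiag : ∀ x : H, HasSum (fun i : ℕ => P i (A (P i x))) (Adiag x)) :
    ∀ x : H, ‖(inner ℂ x ((A - fL * A * fL - gL * A * gL) x) : ℂ)‖
      ≤ 2 * ((Kf : ℝ) ^ 2 + (Kg : ℝ) ^ 2) * (ℓ : ℝ) ^ 3 / L ^ 2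
          * (inner ℂ x (Adiag x) : ℂ).re := by
  have hL0 : 0 < L := by linarith
  have hPP : ∀ i (y : H), P i (P i y) = P i y := fun i y => by
    rw [← mul_apply_eq_comp, hP_idem]
  have hPQ : ∀ i j (y : H), i ≠ j → P i (P j y) = 0 := fun i j y h => by
    rw [← mul_apply_eq_comp, hP_orth i j h]; simp
  have hadj : ∀ i (y z : H), (inner ℂ (P i y) z : ℂ) = inner ℂ y (P i z) := fun i y z => by
    rw [← ContinuousLinearMap.adjoint_inner_right,
      ContinuousLinearMap.isSelfAdjoint_iff'.1 (hP_sa i)]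
  -- multiplication operators
  have mulR : ∀ (φ : ℕ → ℂ) (T : H →L[ℂ] H),
      (∀ y : H, HasSum (fun i : ℕ => φ i • P i y) (T y)) → ∀ i y, T (P i y) = φ i • P i y := by
    intro φ T hT i y
    refine (hT (P i y)).unique ?_
    have := hasSum_single (f := fun j : ℕ => φ j • P j (P i y)) i
      (fun j hj => by simp [hPQ j i y hj])
    simpa [hPP] using this
  have mulL : ∀ (φ : ℕ → ℂ) (T : H →L[ℂ] H),
      (∀ y : H, HasSum (fun i : ℕ => φ i • P i y) (T y)) → ∀ i y, P i (T y) = φ i • P i y := by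
    intro φ T hT i y
    refine ((P i).hasSum (hT y)).unique ?_
    have := hasSum_single (f := fun j : ℕ => P i (φ j • P j y)) i
      (fun j hj => by simp [hPQ i j y hj.symm])
    simpa [hPP] using this
  have hD : ∀ i y, Adiag (P i y) = P i (A (P i y)) := by
    intro i y
    refine (hAdiag (P i y)).unique ?_
    have := hasSum_single (f := fun j : ℕ => P j (A (P j (P i y)))) i
      (fun j hj => by simp [hPQ j i y hj])
    simpa [hPP] using this
  intro x
  set M : ℝ := ((Kf : ℝ) ^ 2 + (Kg : ℝ) ^ 2) * (ℓ : ℝ) ^ 2 / L ^ 2 / 2 with hM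
  have hM0 : 0 ≤ M := by positivity
  have hMe : 2 * ((Kf : ℝ) ^ 2 + (Kg : ℝ) ^ 2) * (ℓ : ℝ) ^ 3 / L ^ 2 = M * (4 * ℓ) := by
    rw [hM]; field_simp; ring
  have hlim := (hP_complete x).tendsto_sum_nat
  have key : ∀ N : ℕ, ‖(inner ℂ (∑ i ∈ Finset.range N, P i x)
      ((A - fL * A * fL - gL * A * gL) (∑ i ∈ Finset.range N, P i x)) : ℂ)‖
      ≤ 2 * ((Kf : ℝ) ^ 2 + (Kg : ℝ) ^ 2) * (ℓ : ℝ) ^ 3 / L ^ 2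
          * (inner ℂ (∑ i ∈ Finset.range N, P i x)
              (Adiag (∑ i ∈ Finset.range N, P i x)) : ℂ).re := by
    intro N
    have hdiag : (inner ℂ (∑ i ∈ Finset.range N, P i x)
              (Adiag (∑ i ∈ Finset.range N, P i x)) : ℂ).re
        = ∑ i ∈ Finset.range N, (inner ℂ (P i x) (A (P i x)) : ℂ).re := by
      rw [map_sum, inner_sum, Complex.re_sum]
      refine Finset.sum_congr rfl fun i hi => ?_
      rw [hD, ← hadj, map_sum, Finset.sum_eq_single i, hPP]
      · intro j _ hj; exact hPQ i j x hj.symm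
      · intro h; exact absurd hi h
    have hq : (inner ℂ (∑ i ∈ Finset.range N, P i x)
      ((A - fL * A * fL - gL * A * gL) (∑ i ∈ Finset.range N, P i x)) : ℂ)
        = ∑ i ∈ Finset.range N, ∑ j ∈ Finset.range N,
          ((1 - f (i / L) * f (j / L) - g (i / L) * g (j / L) : ℝ) : ℂ)
            * inner ℂ (P i x) (A (P j x)) := by
      rw [sum_inner]
      refine Finset.sum_congr rfl fun i hi => ?_
      rw [map_sum, inner_sum]
      refine Finset.sum_congr rfl fun j hj => ?_
      have hl : ∀ (φ : ℕ → ℂ) (T : H →L[ℂ] H),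
          (∀ y : H, HasSum (fun i : ℕ => φ i • P i y) (T y)) →
          (inner ℂ (P i x) (T (A (T (P j x)))) : ℂ)
            = φ i * φ j * inner ℂ (P i x) (A (P j x)) := by
        intro φ T hT
        rw [hadj, mulL φ T hT, mulR φ T hT, inner_smul_right, ← hadj, map_smul, inner_smul_right]
        ring
      have h1 := hl (fun i => (f (i / L) : ℂ)) fL hfL
      have h2 := hl (fun i => (g (i / L) : ℂ)) gL hgL
      simp only [sub_apply, mul_apply_eq_comp, inner_sub_right]
      rw [h1, h2]
      push_cast
      ring
    rw [hdiag, hq, hMe, mul_assoc]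
    refine le_trans ?_ (mul_le_mul_of_nonneg_left
      (pnl_sum N ℓ hℓ (fun i => (inner ℂ (P i x) (A (P i x)) : ℂ).re) (fun i => hA_pos _)) hM0)
    rw [Finset.mul_sum]
    refine (norm_sum_le _ _).trans (Finset.sum_le_sum fun i _ => ?_)
    rw [Finset.mul_sum]
    refine (norm_sum_le _ _).trans (Finset.sum_le_sum fun j _ => ?_)
    by_cases hij : |(i : ℤ) - (j : ℤ)| ≤ (ℓ : ℤ)
    · rw [if_pos hij, one_mul, norm_mul]
      refine mul_le_mul ?_ (pnl_cs A hA_sa hA_pos _ _) (norm_nonneg _) hM0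
      have hi0 : (0 : ℝ) ≤ i / L := by positivity
      have hj0 : (0 : ℝ) ≤ j / L := by positivity
      have hd : |(i : ℝ) / L - j / L| ≤ ℓ / L := by
        rw [← sub_div, abs_div, abs_of_pos hL0]
        gcongr
        exact_mod_cast hij
      have hsq : ∀ (φ : ℝ → ℝ) (K : NNReal), LipschitzOnWith K φ (Set.Ici 0) →
          (φ (i / L) - φ (j / L)) ^ 2 ≤ (K : ℝ) ^ 2 * (ℓ / L) ^ 2 := by
        intro φ K hφ
        have h := hφ.dist_le_mul _ hi0 _ hj0
        rw [Real.dist_eq, Real.dist_eq] at h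
        rw [← mul_pow, ← sq_abs]
        exact pow_le_pow_left₀ (abs_nonneg _)
          (h.trans (mul_le_mul_of_nonneg_left hd K.2)) 2
      have h1 := hsq f Kf hf_lip
      have h2 := hsq g Kg hg_lip
      have e1 := hfg _ hi0
      have e2 := hfg _ hj0
      rw [Complex.norm_real, Real.norm_eq_abs]
      have e : 1 - f (i / L) * f (j / L) - g (i / L) * g (j / L)
          = ((f (i / L) - f (j / L)) ^ 2 + (g (i / L) - g (j / L)) ^ 2) / 2 := by
        linear_combination (-1 / 2) * e1 - (1 / 2) * e2
      rw [e, abs_of_nonneg (by positivity)]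
      have hM' : M = ((Kf : ℝ) ^ 2 * (ℓ / L) ^ 2 + (Kg : ℝ) ^ 2 * (ℓ / L) ^ 2) / 2 := by
        rw [hM]; field_simp
      rw [hM']
      linarith
    · have hz : (inner ℂ (P i x) (A (P j x)) : ℂ) = 0 := by
        have h := hband i j (not_le.1 hij)
        rw [hadj, ← mul_apply_eq_comp, ← mul_apply_eq_comp,
          h]
        simp
      rw [if_neg hij, hz]
      simp
  have c1 : Continuous fun y : H =>
      ‖(inner ℂ y ((A - fL * A * fL - gL * A * gL) y) : ℂ)‖ :=
    (continuous_id.inner (ContinuousLinearMap.continuous _)).norm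
  have c2 : Continuous fun y : H => 2 * ((Kf : ℝ) ^ 2 + (Kg : ℝ) ^ 2) * (ℓ : ℝ) ^ 3 / L ^ 2
          * (inner ℂ y (Adiag y) : ℂ).re :=
    continuous_const.mul (Complex.continuous_re.comp
      (continuous_id.inner (ContinuousLinearMap.continuous _)))
  exact le_of_tendsto_of_tendsto' ((c1.tendsto x).comp hlim) ((c2.tendsto x).comp hlim) key
end

section
/- Let A, B, E be real n×n matrices and let S₁ be an invertible real n×n matrix; set S₂ := (S₁ᵀ)⁻¹. Assume S₁ᵀ (A + B) S₁ = E and S₂ᵀ (A − B) S₂ = E. Then, setting C := (1/2)(S₁ + S₂) and S := (1/2)(S₁ − S₂), one has Cᵀ A S + Sᵀ A C + Cᵀ B C + Sᵀ B S = 0. -/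
open Matrix

/-- Vanishing of the off-diagonal (pair-creation) terms after Bogoliubov
diagonalization: if `S₁ᵀ(A+B)S₁ = E` and `S₂ᵀ(A−B)S₂ = E` with `S₂ = (S₁ᵀ)⁻¹`, then with
`C = (S₁+S₂)/2` and `S = (S₁−S₂)/2` one has `CᵀAS + SᵀAC + CᵀBC + SᵀBS = 0`. -/
theorem offdiagonal_terms_vanish {n : ℕ} (A B E S₁ : Matrix (Fin n) (Fin n) ℝ)
    (hS : IsUnit S₁.det)
    (h1 : S₁ᵀ * (A + B) * S₁ = E)
    (h2 : ((S₁ᵀ)⁻¹)ᵀ * (A - B) * (S₁ᵀ)⁻¹ = E) :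
    let S₂ := (S₁ᵀ)⁻¹
    let C := (1 / 2 : ℝ) • (S₁ + S₂)
    let S := (1 / 2 : ℝ) • (S₁ - S₂)
    Cᵀ * A * S + Sᵀ * A * C + Cᵀ * B * C + Sᵀ * B * S = 0 := by
  intro S₂ C S
  have h3 : S₁ᵀ * (A + B) * S₁ - S₂ᵀ * (A - B) * S₂ = 0 := by
    rw [h1, sub_eq_zero]; exact h2.symm
  have h4 : Cᵀ * A * S + Sᵀ * A * C + Cᵀ * B * C + Sᵀ * B * S
      = (1 / 2 : ℝ) • (S₁ᵀ * (A + B) * S₁ - S₂ᵀ * (A - B) * S₂) := by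
    simp only [C, S]
    clear_value S₂
    simp only [transpose_smul, transpose_add, transpose_sub, smul_mul_assoc, mul_smul_comm,
      mul_add, add_mul, mul_sub, sub_mul]
    module
  rw [h4, h3, smul_zero]
end

section
/- Let A, B, E be real n×n matrices and let S₁ be an invertible real n×n matrix; set S₂ := (S₁ᵀ)⁻¹. Assume S₁ᵀ (A + B) S₁ = E and S₂ᵀ (A − B) S₂ = E. Then, setting C := (1/2)(S₁ + S₂) and S := (1/2)(S₁ − S₂), one has tr(2 Sᵀ A S + Sᵀ B C + Cᵀ B S) = tr(E) − tr(A). -/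
open Matrix

/-- Trace identity identifying the constant term produced by the Bogoliubov
diagonalization: if `S₁ᵀ(A+B)S₁ = E` and `S₂ᵀ(A−B)S₂ = E` with `S₂ = (S₁ᵀ)⁻¹`, then with
`C = (S₁+S₂)/2` and `S = (S₁−S₂)/2` one has `tr(2SᵀAS + SᵀBC + CᵀBS) = tr E − tr A`. -/
theorem bogoliubov_constant_term {n : ℕ} (A B E S₁ : Matrix (Fin n) (Fin n) ℝ)
    (hS : IsUnit S₁.det)
    (h1 : S₁ᵀ * (A + B) * S₁ = E)
    (h2 : ((S₁ᵀ)⁻¹)ᵀ * (A - B) * (S₁ᵀ)⁻¹ = E) :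
    let S₂ := (S₁ᵀ)⁻¹
    let C := (1 / 2 : ℝ) • (S₁ + S₂)
    let S := (1 / 2 : ℝ) • (S₁ - S₂)
    Matrix.trace ((2 : ℝ) • (Sᵀ * A * S) + Sᵀ * B * C + Cᵀ * B * S)
      = Matrix.trace E - Matrix.trace A := by
  intro S₂ C S
  have hT : IsUnit (S₁ᵀ).det := by rwa [Matrix.det_transpose]
  have e1 : S₂ * S₁ᵀ = 1 := Matrix.nonsing_inv_mul _ hT
  have e2 : S₁ * S₂ᵀ = 1 := by
    have h := congrArg Matrix.transpose e1
    rwa [Matrix.transpose_mul, Matrix.transpose_transpose, Matrix.transpose_one] at h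
  have t1 : Matrix.trace (S₁ᵀ * A * S₂) = Matrix.trace A := by
    rw [Matrix.trace_mul_comm, ← Matrix.mul_assoc, e1, Matrix.one_mul]
  have t2 : Matrix.trace (S₂ᵀ * A * S₁) = Matrix.trace A := by
    rw [Matrix.trace_mul_comm, ← Matrix.mul_assoc, e2, Matrix.one_mul]
  have h1' := congrArg Matrix.trace h1
  have h2' : Matrix.trace (S₂ᵀ * (A - B) * S₂) = Matrix.trace E := congrArg Matrix.trace h2
  have hC : C = (1 / 2 : ℝ) • (S₁ + S₂) := rfl
  have hSS : S = (1 / 2 : ℝ) • (S₁ - S₂) := rfl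
  rw [hC, hSS]
  clear_value S₂
  simp only [Matrix.transpose_smul, Matrix.transpose_add, Matrix.transpose_sub, Matrix.smul_mul,
    Matrix.mul_smul, Matrix.add_mul, Matrix.mul_add, Matrix.sub_mul, Matrix.mul_sub,
    Matrix.trace_add, Matrix.trace_sub, Matrix.trace_smul, smul_eq_mul] at h1' h2' ⊢
  linarith
end

section
/- Let h be an n×n Hermitian matrix, let Q be an n×n orthogonal projection matrix (Q² = Q = Q*) commuting with h, and let μ₁ ≤ μ₂ be real numbers such that Q h Q ≤ μ₁ Q and (𝟙 − Q) h (𝟙 − Q) ≥ μ₂ (𝟙 − Q) in the sense of positive semidefiniteness. Then for every n×n orthogonal projection matrix P with tr P = tr Q, the trace tr(h(P − Q)) is real and satisfies tr(h(P − Q)) ≥ ((μ₂ − μ₁)/2) · tr((P − Q)²). -/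
open Matrix
open scoped ComplexOrder

theorem trace_mul_proj_nonneg_aux {n : ℕ} (A P : Matrix (Fin n) (Fin n) ℂ)
    (hA : A.PosSemidef) (hP : P * P = P) (hPh : P.IsHermitian) : 0 ≤ (A * P).trace := by
  have h1 := (hA.conjTranspose_mul_mul_same P).trace_nonneg
  rw [hPh.eq, Matrix.trace_mul_comm, ← Matrix.mul_assoc, hP, Matrix.trace_mul_comm] at h1
  exact h1

/-- Abstract spectral-gap inequality behind the Hartree–Fock minimization:
if `h` is Hermitian, `Q` an orthogonal projection commuting with `h`, `QhQ ≤ μ₁Q` and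
`(𝟙−Q)h(𝟙−Q) ≥ μ₂(𝟙−Q)`, then for every orthogonal projection `P` with `tr P = tr Q`,
`tr(h(P−Q))` is real and `tr(h(P−Q)) ≥ ((μ₂−μ₁)/2)·tr((P−Q)²)`. -/
theorem spectral_gap_trace_inequality {n : ℕ} (h Q : Matrix (Fin n) (Fin n) ℂ)
    (hh : h.IsHermitian) (hQ_idem : Q * Q = Q) (hQ_herm : Q.IsHermitian)
    (hcomm : Q * h = h * Q) (μ₁ μ₂ : ℝ) (hμ : μ₁ ≤ μ₂)
    (hgap₁ : ((μ₁ : ℂ) • Q - Q * h * Q).PosSemidef)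
    (hgap₂ : ((1 - Q) * h * (1 - Q) - (μ₂ : ℂ) • (1 - Q)).PosSemidef) :
    ∀ P : Matrix (Fin n) (Fin n) ℂ, P * P = P → P.IsHermitian → P.trace = Q.trace →
      (Matrix.trace (h * (P - Q))).im = 0 ∧
      ((μ₂ - μ₁) / 2) * (Matrix.trace ((P - Q) ^ 2)).re
        ≤ (Matrix.trace (h * (P - Q))).re := by
  intro P hP hPh htr
  have hP1 : (1 - P) * (1 - P) = 1 - P := by
    simp [mul_sub, sub_mul, hP]
  have hP1h : (1 - P).IsHermitian := Matrix.isHermitian_one.sub hPh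
  have hQp : Q.PosSemidef := by
    have := Matrix.posSemidef_conjTranspose_mul_self Q
    rwa [hQ_herm.eq, hQ_idem] at this
  have e1 := trace_mul_proj_nonneg_aux _ _ hgap₁ hP1 hP1h
  have e2 := trace_mul_proj_nonneg_aux _ _ hgap₂ hP hPh
  have e3 := trace_mul_proj_nonneg_aux _ _ hQp hP1 hP1h
  have hA : Q * h * Q = h * Q := by rw [hcomm, Matrix.mul_assoc, hQ_idem]
  have hB : (1 - Q) * h * (1 - Q) = h - h * Q := by
    simp only [sub_mul, mul_sub, one_mul, mul_one, hcomm, Matrix.mul_assoc, hQ_idem]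
    abel
  rw [hA] at e1
  rw [hB] at e2
  have hPQ : (P * Q).trace = (Q * P).trace := Matrix.trace_mul_comm _ _
  have k1 : (h * (P - Q)).trace = ((μ₂ - μ₁ : ℝ) : ℂ) * (Q * (1 - P)).trace
      + (((μ₁ : ℂ) • Q - h * Q) * (1 - P)).trace
      + ((h - h * Q - (μ₂ : ℂ) • (1 - Q)) * P).trace := by
    simp only [sub_mul, mul_sub, one_mul, mul_one, Matrix.trace_sub, Matrix.smul_mul,
      Matrix.trace_smul, smul_eq_mul, smul_sub, htr]
    push_cast
    ring
  have k2 : ((P - Q) ^ 2).trace = 2 * (Q * (1 - P)).trace := by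
    simp only [pow_two, sub_mul, mul_sub, mul_one, Matrix.trace_sub, htr, hP, hQ_idem, hPQ]
    ring
  rw [Complex.le_def] at e1 e2 e3
  obtain ⟨a1, b1⟩ := e1
  obtain ⟨a2, b2⟩ := e2
  obtain ⟨a3, b3⟩ := e3
  rw [k1, k2]
  simp only [Complex.add_re, Complex.add_im, Complex.re_ofReal_mul, Complex.im_ofReal_mul,
    ← b1, ← b2, ← b3]
  simp only [Complex.zero_re, Complex.zero_im] at *
  refine ⟨by ring, ?_⟩
  have : (2 * (Q * (1 - P)).trace).re = 2 * ((Q * (1 - P)).trace).re := by simp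
  rw [this]
  linarith
end
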